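/- arXiv:2411.18297 — 3 statements merged into one kernel-verified Lean document; each statement's English description precedes it below -/
import Mathlib

section
/- Let Φ = {φ_i}_{i∈I} be an infinite parabolic IFS on [0,1] such that each φ_i is C² and sup_{i∈I} max_{x∈[0,1]} |(log|φ_i'(x)|)'| < ∞. Then Φ satisfies both (B1) and (B2). -/
open Set MeasureTheory Filter Topology

open scoped ENNReal NNReal Classical

namespace ParabolicIFSPaper

noncomputable section

/-- Composition `φ_{ω₁} ∘ ⋯ ∘ φ_{ω_n}` for a (0-indexed) sequence of digits `ω`. -/
def comp (φ : ℕ → ℝ → ℝ) (ω : ℕ → ℕ) : ℕ → ℝ → ℝ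
  | 0 => id
  | n + 1 => comp φ ω n ∘ φ (ω n)

/-- Composition `φ_{a₁} ∘ ⋯ ∘ φ_{a_n}` along a finite word given as a list. -/
def wcomp (φ : ℕ → ℝ → ℝ) : List ℕ → ℝ → ℝ
  | [] => id
  | a :: l => φ a ∘ wcomp φ l

/-- A parabolic Iterated Function System on `[0,1]`:  an index set `I ⊆ ℕ` with at least two
elements, `C¹` maps `φ i : [0,1] → [0,1]`, the open set condition, the non-uniform contraction
condition (A1) with finitely many parabolic pairs, and the bounded distortion condition (A2). -/
structure PIFS where
  I : Set ℕ
  I_nontrivial : I.Nontrivial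
  φ : ℕ → ℝ → ℝ
  smooth : ∀ i ∈ I, ContDiff ℝ 1 (φ i)
  maps_to : ∀ i ∈ I, MapsTo (φ i) (Icc (0:ℝ) 1) (Icc (0:ℝ) 1)
  osc : ∀ i ∈ I, ∀ j ∈ I, i ≠ j → φ i '' Ioo (0:ℝ) 1 ∩ φ j '' Ioo (0:ℝ) 1 = ∅
  Par : Set ℕ
  Par_sub : Par ⊆ I
  Par_finite : Par.Finite
  fixpt : ℕ → ℝ
  fixpt_mem : ∀ i ∈ Par, fixpt i ∈ Icc (0:ℝ) 1
  fixpt_fixed : ∀ i ∈ Par, φ i (fixpt i) = fixpt i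
  fixpt_unique : ∀ i ∈ Par, ∀ x ∈ Icc (0:ℝ) 1, φ i x = x → x = fixpt i
  deriv_one : ∀ i ∈ Par, |deriv (φ i) (fixpt i)| = 1
  contracting : ∀ i ∈ I, ∀ x ∈ Icc (0:ℝ) 1, (i ∉ Par ∨ x ≠ fixpt i) → |deriv (φ i) x| < 1
  distC : ℝ
  distC_ge_one : 1 ≤ distC
  distortion : ∀ ω : ℕ → ℕ, (∀ k, ω k ∈ I) → ∀ n, 2 ≤ n →
    (ω (n - 1) ∉ Par ∨ ω (n - 2) ≠ ω (n - 1)) →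
    ∀ x ∈ Icc (0:ℝ) 1, ∀ y ∈ Icc (0:ℝ) 1,
      |deriv (comp φ ω n) x| ≤ distC * |deriv (comp φ ω n) y|

/-- The set of admissible digit sequences `I^ℕ`. -/
def PIFS.Seqs (Φ : PIFS) : Set (ℕ → ℕ) := {ω | ∀ k, ω k ∈ Φ.I}

/-- The set of admissible words of length `n`, i.e. `I^n`. -/
def Words (Φ : PIFS) (n : ℕ) : Set (List ℕ) := {l | l.length = n ∧ ∀ a ∈ l, a ∈ Φ.I}

/-- The fundamental interval `J(ω) = φ_ω([0,1])` of a finite word. -/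
def Jset (Φ : PIFS) (l : List ℕ) : Set ℝ := wcomp Φ.φ l '' Icc (0:ℝ) 1

/-- `Pi` is an address map for `Φ` if `Pi ω` lies in every fundamental interval
`φ_{ω₁⋯ω_n}([0,1])`; since these intersections are singletons for a parabolic IFS, this
characterizes the address map. -/
def IsAddressMap (Φ : PIFS) (Pi : (ℕ → ℕ) → ℝ) : Prop :=
  ∀ ω ∈ Φ.Seqs, ∀ n : ℕ, Pi ω ∈ comp Φ.φ ω n '' Icc (0:ℝ) 1

/-- The limit set `Λ(Φ) = Π(I^ℕ)`. -/
def limitSet (Φ : PIFS) (Pi : (ℕ → ℕ) → ℝ) : Set ℝ := Pi '' Φ.Seqs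

/-- The set `Λ_*(Φ)` of points having exactly one address. -/
def uniqueCoded (Φ : PIFS) (Pi : (ℕ → ℕ) → ℝ) : Set ℝ :=
  {x | ∃! ω : ℕ → ℕ, ω ∈ Φ.Seqs ∧ Pi ω = x}

/-- `max{a₁(x),…,a_n(x)} ⋅ (log log n) / n` for the digit sequence `ω`. -/
def ratio (ω : ℕ → ℕ) (n : ℕ) : ℝ :=
  ((((Finset.range n).sup ω : ℕ) : ℝ)) * Real.log (Real.log n) / n

/-- The level set `L(α)` of points whose largest-digit growth rate is `α ∈ [0,∞]`. -/
def levelSet (Φ : PIFS) (Pi : (ℕ → ℕ) → ℝ) (α : EReal) : Set ℝ :=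
  {x ∈ uniqueCoded Φ Pi |
    ∀ ω ∈ Φ.Seqs, Pi ω = x → Tendsto (fun n => (ratio ω n : EReal)) atTop (𝓝 α)}

/-- `Φ` is `d`-decaying: `min_x |φ_i'(x)| ≥ c / i^d`. -/
def Decaying (Φ : PIFS) (d : ℝ) : Prop :=
  ∃ c : ℝ, 0 < c ∧ ∀ i ∈ Φ.I, ∀ x ∈ Icc (0:ℝ) 1, c / (i : ℝ) ^ d ≤ |deriv (Φ.φ i) x|

/-- The shift map on sequence space. -/
def shift : (ℕ → ℕ) → (ℕ → ℕ) := fun ω n => ω (n + 1)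

/-- The Lyapunov exponent `χ(ν) = -∫ log |φ'_{ω₁}(Π ω)| dν(ω)` (in `[0,∞]`). -/
def lyap (Φ : PIFS) (Pi : (ℕ → ℕ) → ℝ) (ν : Measure (ℕ → ℕ)) : ℝ≥0∞ :=
  ∫⁻ ω, ENNReal.ofReal (- Real.log |deriv (Φ.φ (ω 0)) (Pi ω)|) ∂ν

/-- The class `𝓜(Φ)` of shift-invariant ergodic probability measures carried by `I^ℕ`
with finite Lyapunov exponent. -/
def MeasClass (Φ : PIFS) (Pi : (ℕ → ℕ) → ℝ) : Set (Measure (ℕ → ℕ)) :=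
  {ν | IsProbabilityMeasure ν ∧ ν Φ.Seqs = 1 ∧ Ergodic shift ν ∧ lyap Φ Pi ν < ⊤}

/-- `dim(μ) = inf {dim_H A : A ⊆ [0,1], μ(A) = 1}`. -/
def mdim (μ : Measure ℝ) : ℝ≥0∞ :=
  ⨅ (A : Set ℝ) (_ : A ⊆ Icc (0:ℝ) 1) (_ : μ A = 1), dimH A

/-- Condition (B1) (saturation). -/
def SatB1 (Φ : PIFS) (Pi : (ℕ → ℕ) → ℝ) : Prop :=
  dimH (limitSet Φ Pi) = ⨆ ν ∈ MeasClass Φ Pi, mdim (Measure.map Pi ν)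

/-- Condition (B2) (mild distortion): `D₁(Φ) < ∞` and `D_n(Φ) = o(n)`. -/
def MildB2 (Φ : PIFS) : Prop :=
  (∃ C : ℝ, ∀ i ∈ Φ.I, ∀ x ∈ Icc (0:ℝ) 1, ∀ y ∈ Icc (0:ℝ) 1,
    |deriv (Φ.φ i) x| ≤ C * |deriv (Φ.φ i) y|) ∧
  ∀ ε : ℝ, 0 < ε → ∃ N : ℕ, ∀ n, N ≤ n → ∀ l ∈ Words Φ n,
    ∀ x ∈ Icc (0:ℝ) 1, ∀ y ∈ Icc (0:ℝ) 1,
      |deriv (wcomp Φ.φ l) x| ≤ Real.exp (ε * n) * |deriv (wcomp Φ.φ l) y|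

/-- Composition along a sequence of finite words:
`φ_{σ₀} ∘ φ_{σ₁} ∘ ⋯ ∘ φ_{σ_{n-1}}`. -/
def seqComp (φ : ℕ → ℝ → ℝ) (σ : ℕ → List ℕ) : ℕ → ℝ → ℝ
  | 0 => id
  | n + 1 => seqComp φ σ n ∘ wcomp φ (σ n)

/-- The limit set of the finite IFS `{φ_w}_{w ∈ W}` indexed by words. -/
def finLimitSet (φ : ℕ → ℝ → ℝ) (W : Set (List ℕ)) : Set ℝ :=
  {x | ∃ σ : ℕ → List ℕ, (∀ k, σ k ∈ W) ∧ ∀ n, x ∈ seqComp φ σ n '' Icc (0:ℝ) 1}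

/-- `τ(x) = x / log log x`. -/
def tau (x : ℝ) : ℝ := x / Real.log (Real.log x)

/-- Number of insertion positions among `1,…,j`. -/
def cnt (nseq : ℕ → ℕ) (j : ℕ) : ℕ :=
  ((Finset.range (j + 1)).filter fun k => 1 ≤ k ∧ nseq k ≤ j).card

/-- Insertion of the digits `⌊α τ(n(k))⌋` at the positions `n(k)`, `k ≥ 1`, into the
(0-indexed) digit sequence `b`; index `m` corresponds to the (1-indexed) position `m + 1`. -/
def insertSeq (nseq : ℕ → ℕ) (α : ℝ) (b : ℕ → ℕ) : ℕ → ℕ := fun m =>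
  if ∃ k, 1 ≤ k ∧ nseq k = m + 1 then ⌊α * tau (m + 1)⌋₊
  else b (m - cnt nseq (m + 1))

/-- The digit sequence obtained by concatenating the words `σ 0, σ 1, …`, each of length `p`. -/
def flattenSeq (p : ℕ) (σ : ℕ → List ℕ) : ℕ → ℕ := fun m => (σ (m / p)).getD (m % p) 0

/-- The set `L_p(α)` of points obtained from points of `Λ(Φ_p)` by inserting the digits
`⌊α τ(n(k))⌋` at the positions `n(k)`. -/
def LpSet (Φ : PIFS) (Pi : (ℕ → ℕ) → ℝ) (W : Set (List ℕ)) (p : ℕ)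
    (nseq : ℕ → ℕ) (α : ℝ) : Set ℝ :=
  {x | ∃ σ : ℕ → List ℕ, (∀ k, σ k ∈ W) ∧ x = Pi (insertSeq nseq α (flattenSeq p σ))}

/-- The set `A_k` of admissible words `a₁ ⋯ a_{n(k+1)}` (0-indexed: `a 0 = a₁`):
each block between consecutive insertion positions is a concatenation of words of `W`,
and the digit at each insertion position `n(j+1)` is `⌊α τ(n(j+1))⌋`. -/
def Aset (Φ : PIFS) (W : Set (List ℕ)) (p : ℕ) (nseq mseq : ℕ → ℕ) (α : ℝ) (k : ℕ) :
    Set (ℕ → ℕ) :=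
  {a | (∀ i < nseq (k + 1), a i ∈ Φ.I) ∧
    ∀ j ≤ k,
      (∀ i < mseq j, ∃ w ∈ W, ∀ r < p, a (nseq j + i * p + r) = w.getD r 0) ∧
      a (nseq (j + 1) - 1) = ⌊α * tau (nseq (j + 1))⌋₊}

/-- `B_k = {n(k) + m p : m = 0,…,m(k)}`. -/
def Bset (nseq mseq : ℕ → ℕ) (p k : ℕ) : Set ℕ :=
  {n | ∃ m ≤ mseq k, n = nseq k + m * p}

/-- The composition `φ_{ā₁⋯ā_n}` along the word obtained from `a₁ ⋯ a_n` by eliminating the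
digits at the insertion positions `n(1), n(2), …` (0-indexed: index `n` ↔ position `n + 1`). -/
def elimComp (φ : ℕ → ℝ → ℝ) (nseq : ℕ → ℕ) (a : ℕ → ℕ) : ℕ → ℝ → ℝ
  | 0 => id
  | n + 1 =>
    if ∃ k, 1 ≤ k ∧ nseq k = n + 1 then elimComp φ nseq a n
    else elimComp φ nseq a n ∘ φ (a n)

/-- The minimal distance `K` between distinct fundamental intervals `J(w)`, `w ∈ W`. -/
def Kdist (Φ : PIFS) (W : Set (List ℕ)) : ℝ :=
  sInf {r | ∃ w ∈ W, ∃ w' ∈ W, w ≠ w' ∧ ∃ u ∈ Jset Φ w, ∃ v ∈ Jset Φ w', r = |u - v|}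

/-- The data of the insertion construction of Section 3 of the paper: a `d`-decaying
parabolic IFS `Φ` with address map `Pi` satisfying (B1) and (B2), `ε > 0`, an integer `p ≥ 2`
with `(k+p+1)^d + 2p + 1 < (k+p+2)^d`, a finite set `W ⊆ I^p` of words with pairwise disjoint
fundamental intervals, non-parabolic last letters, uniform contraction rate `e^{-γp}` and
limit set of dimension `> dim_H Λ(Φ) - ε`, the insertion positions `n(k)` (with the block
lengths `m(k)`), and `α ∈ (0,∞)`, the inserted digits `⌊α τ(n(k))⌋` belonging to `I`. -/
structure InsSetup (Φ : PIFS) (Pi : (ℕ → ℕ) → ℝ) where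
  d : ℝ
  hd : 1 < d
  hdec : Decaying Φ d
  hPi : IsAddressMap Φ Pi
  hPiMeas : Measurable Pi
  hB1 : SatB1 Φ Pi
  hB2 : MildB2 Φ
  ε : ℝ
  hε : 0 < ε
  p : ℕ
  hp2 : 2 ≤ p
  hpd : ∀ k : ℕ, ((k : ℝ) + p + 1) ^ d + 2 * p + 1 < ((k : ℝ) + p + 2) ^ d
  W : Finset (List ℕ)
  hWne : W.Nonempty
  hWsub : (↑W : Set (List ℕ)) ⊆ Words Φ p
  hWdisj : ∀ w ∈ W, ∀ w' ∈ W, w ≠ w' → Jset Φ w ∩ Jset Φ w' = ∅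
  hWlast : ∀ w ∈ W, ∀ h : w ≠ [], w.getLast h ∉ Φ.Par
  γ : ℝ
  hγ : 0 < γ
  hWcontr : ∀ w ∈ W, ∀ x ∈ Icc (0:ℝ) 1, |deriv (wcomp Φ.φ w) x| < Real.exp (-(γ * p))
  hWdim : dimH (limitSet Φ Pi) - ENNReal.ofReal ε < dimH (finLimitSet Φ.φ (↑W : Set (List ℕ)))
  α : ℝ
  hα : 0 < α
  nseq : ℕ → ℕ
  mseq : ℕ → ℕ
  hn0 : nseq 0 = 0
  hm2 : ∀ k, 2 ≤ mseq k
  hmlow : ∀ k : ℕ, (nseq k : ℝ) + ((mseq k : ℝ) - 1) * p ≤ ((k : ℝ) + p + 1) ^ d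
  hmhigh : ∀ k : ℕ, ((k : ℝ) + p + 1) ^ d < (nseq k : ℝ) + (mseq k : ℝ) * p
  hnrec : ∀ k, nseq (k + 1) = nseq k + mseq k * p + 1
  hins : ∀ k, 1 ≤ k → ⌊α * tau (nseq k)⌋₊ ∈ Φ.I

section

/-! ### Words and compositions -/

/-- The prefix of length `n` of a sequence. -/
def pre {α : Type*} (ω : ℕ → α) (n : ℕ) : List α := (List.range n).map ω

@[simp] lemma length_pre {α : Type*} (ω : ℕ → α) (n : ℕ) : (pre ω n).length = n := by
  simp [pre]

lemma pre_succ {α : Type*} (ω : ℕ → α) (n : ℕ) : pre ω (n + 1) = pre ω n ++ [ω n] := by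
  simp [pre, List.range_succ]

lemma pre_succ' {α : Type*} (ω : ℕ → α) (n : ℕ) :
    pre ω (n + 1) = ω 0 :: pre (fun k => ω (k + 1)) n := by
  simp [pre, List.range_succ_eq_map, Function.comp_def]

lemma pre_isPrefix {α : Type*} (ω : ℕ → α) {m n : ℕ} (h : m ≤ n) : pre ω m <+: pre ω n := by
  induction n, h using Nat.le_induction with
  | base => exact List.prefix_rfl
  | succ n _ ih => rw [pre_succ]; exact ih.trans (List.prefix_append _ _)

lemma eq_pre_of_isPrefix {α : Type*} {ω : ℕ → α} {n : ℕ} {v : List α} (h : v <+: pre ω n) :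
    v = pre ω v.length := by
  have hl : v.length ≤ n := by simpa using h.length_le
  exact (List.prefix_of_prefix_length_le h (pre_isPrefix ω hl) (by simp)).eq_of_length (by simp)

lemma wcomp_append (φ : ℕ → ℝ → ℝ) (u v : List ℕ) :
    wcomp φ (u ++ v) = wcomp φ u ∘ wcomp φ v := by
  induction u with
  | nil => rfl
  | cons a u ih => simp [wcomp, ih, Function.comp_assoc]

lemma comp_eq_wcomp_pre (φ : ℕ → ℝ → ℝ) (ω : ℕ → ℕ) (n : ℕ) :
    comp φ ω n = wcomp φ (pre ω n) := by
  induction n with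
  | zero => rfl
  | succ n ih => rw [pre_succ, wcomp_append, comp, ih]; rfl

lemma pre_getD (w : List ℕ) (i : ℕ) : pre (fun n => w.getD n i) w.length = w := by
  apply List.ext_getElem
  · simp
  · intro n h1 h2
    simp [pre, h2]

variable {Φ : PIFS}

lemma wcomp_contDiff {w : List ℕ} (hw : ∀ a ∈ w, a ∈ Φ.I) : ContDiff ℝ 1 (wcomp Φ.φ w) := by
  induction w with
  | nil => exact contDiff_id
  | cons a l ih =>
    exact (Φ.smooth a (hw a (by simp))).comp (ih fun b hb => hw b (by simp [hb]))

lemma wcomp_mapsTo {w : List ℕ} (hw : ∀ a ∈ w, a ∈ Φ.I) :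
    MapsTo (wcomp Φ.φ w) (Icc 0 1) (Icc 0 1) := by
  induction w with
  | nil => exact fun x hx => hx
  | cons a l ih =>
    exact (Φ.maps_to a (hw a (by simp))).comp (ih fun b hb => hw b (by simp [hb]))

lemma wcomp_differentiable {w : List ℕ} (hw : ∀ a ∈ w, a ∈ Φ.I) :
    Differentiable ℝ (wcomp Φ.φ w) :=
  (wcomp_contDiff hw).differentiable one_ne_zero

lemma deriv_wcomp_append {u v : List ℕ} (hu : ∀ a ∈ u, a ∈ Φ.I) (hv : ∀ a ∈ v, a ∈ Φ.I) (x : ℝ) :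
    deriv (wcomp Φ.φ (u ++ v)) x =
      deriv (wcomp Φ.φ u) (wcomp Φ.φ v x) * deriv (wcomp Φ.φ v) x := by
  rw [wcomp_append]
  exact deriv_comp x (wcomp_differentiable hu _) (wcomp_differentiable hv _)

lemma exists_deriv_abs {f : ℝ → ℝ} (hf : Differentiable ℝ f) {x y : ℝ} (hxy : x < y) :
    ∃ z ∈ Ioo x y, |f x - f y| = |deriv f z| * |x - y| := by
  obtain ⟨z, hz, h⟩ := exists_deriv_eq_slope f hxy hf.continuous.continuousOn hf.differentiableOn
  refine ⟨z, hz, ?_⟩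
  have : y - x ≠ 0 := by linarith
  rw [← abs_mul, h, abs_sub_comm, ← abs_neg (_ * _)]
  congr 1
  field_simp
  ring

lemma exists_deriv_abs_Icc {f : ℝ → ℝ} (hf : Differentiable ℝ f) {x y : ℝ}
    (hx : x ∈ Icc (0 : ℝ) 1) (hy : y ∈ Icc (0 : ℝ) 1) :
    ∃ z ∈ Icc (0 : ℝ) 1, |f x - f y| = |deriv f z| * |x - y| := by
  rcases lt_trichotomy x y with h | h | h
  · obtain ⟨z, hz, e⟩ := exists_deriv_abs hf h
    exact ⟨z, ⟨hx.1.trans hz.1.le, hz.2.le.trans hy.2⟩, e⟩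
  · exact ⟨x, hx, by simp [h]⟩
  · obtain ⟨z, hz, e⟩ := exists_deriv_abs hf h
    exact ⟨z, ⟨hy.1.trans hz.1.le, hz.2.le.trans hx.2⟩, by rw [abs_sub_comm, e, abs_sub_comm y]⟩

/-- Words whose last letter is non-parabolic or different from the preceding letter. -/
def Good (Φ : PIFS) (w : List ℕ) : Prop :=
  ∃ u a b, w = u ++ [a, b] ∧ (b ∉ Φ.Par ∨ a ≠ b)

lemma Good.append {w : List ℕ} (h : Good Φ w) (v : List ℕ) : Good Φ (v ++ w) := by
  obtain ⟨u, a, b, rfl, h⟩ := h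
  exact ⟨v ++ u, a, b, by simp, h⟩

lemma Good.ne_nil {w : List ℕ} (h : Good Φ w) : w ≠ [] := by
  obtain ⟨u, a, b, rfl, h⟩ := h
  simp

lemma Good.distortion {w : List ℕ} (h : Good Φ w) (hw : ∀ a ∈ w, a ∈ Φ.I) {x y : ℝ}
    (hx : x ∈ Icc (0 : ℝ) 1) (hy : y ∈ Icc (0 : ℝ) 1) :
    |deriv (wcomp Φ.φ w) x| ≤ Φ.distC * |deriv (wcomp Φ.φ w) y| := by
  obtain ⟨i, hi, -⟩ := Φ.I_nontrivial
  obtain ⟨u, a, b, rfl, h⟩ := h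
  have := Φ.distortion (fun n => (u ++ [a, b]).getD n i) (fun k => ?_) (u ++ [a, b]).length
    (by simp) (by simpa using h) x hx y hy
  · rwa [comp_eq_wcomp_pre, pre_getD] at this
  · by_cases hk : k < (u ++ [a, b]).length
    · simp only [List.getD_eq_getElem _ _ hk]
      exact hw _ (List.getElem_mem hk)
    · simp only [List.getD_eq_default _ _ (not_lt.1 hk)]
      exact hi

/-- The length of the fundamental interval of a word. -/
def len (Φ : PIFS) (w : List ℕ) : ℝ := |wcomp Φ.φ w 1 - wcomp Φ.φ w 0|

lemma len_nonneg (w : List ℕ) : 0 ≤ len Φ w := abs_nonneg _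

@[simp] lemma len_nil : len Φ [] = 1 := by simp [len, wcomp]

lemma Good.len_mul_le {w : List ℕ} (h : Good Φ w) (hw : ∀ a ∈ w, a ∈ Φ.I) {x y : ℝ}
    (hx : x ∈ Icc (0 : ℝ) 1) (hy : y ∈ Icc (0 : ℝ) 1) :
    len Φ w * |x - y| ≤ Φ.distC * |wcomp Φ.φ w x - wcomp Φ.φ w y| := by
  obtain ⟨z, hz, e⟩ := exists_deriv_abs_Icc (wcomp_differentiable hw) hx hy
  obtain ⟨z', hz', e'⟩ := exists_deriv_abs_Icc (wcomp_differentiable hw)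
    (right_mem_Icc.2 zero_le_one) (left_mem_Icc.2 zero_le_one)
  rw [len, e, e']
  have := h.distortion hw hz' hz
  have h2 := mul_le_mul_of_nonneg_right this (abs_nonneg (x - y))
  simpa [mul_assoc] using h2

lemma Good.len_mul_len_le {w v : List ℕ} (h : Good Φ w) (hw : ∀ a ∈ w, a ∈ Φ.I)
    (hv : ∀ a ∈ v, a ∈ Φ.I) :
    len Φ w * len Φ v ≤ Φ.distC * len Φ (w ++ v) := by
  have := h.len_mul_le hw (wcomp_mapsTo hv (right_mem_Icc.2 zero_le_one))
    (wcomp_mapsTo hv (left_mem_Icc.2 zero_le_one))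
  simpa [len, wcomp_append] using this

/-! ### Contraction and distortion of single maps -/

lemma abs_deriv_le_one {i : ℕ} (hi : i ∈ Φ.I) {x : ℝ} (hx : x ∈ Icc (0 : ℝ) 1) :
    |deriv (Φ.φ i) x| ≤ 1 := by
  by_cases h : i ∉ Φ.Par ∨ x ≠ Φ.fixpt i
  · exact (Φ.contracting i hi x hx h).le
  · push Not at h
    rw [h.2]
    exact (Φ.deriv_one i h.1).le

lemma strict_contraction_of_lt {i : ℕ} (hi : i ∈ Φ.I) {x y : ℝ} (hx : x ∈ Icc (0 : ℝ) 1)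
    (hy : y ∈ Icc (0 : ℝ) 1) (hxy : x < y) : |Φ.φ i x - Φ.φ i y| < y - x := by
  have hd := (Φ.smooth i hi).differentiable one_ne_zero
  obtain ⟨z, hz, e⟩ := exists_deriv_abs hd (show x < (x + y) / 2 by linarith)
  obtain ⟨z', hz', e'⟩ := exists_deriv_abs hd (show (x + y) / 2 < y by linarith)
  have hzI : z ∈ Icc (0 : ℝ) 1 := ⟨by linarith [hx.1, hz.1], by linarith [hy.2, hz.2]⟩
  have hzI' : z' ∈ Icc (0 : ℝ) 1 := ⟨by linarith [hx.1, hz'.1], by linarith [hy.2, hz'.2]⟩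
  have h1 := abs_deriv_le_one hi hzI
  have h2 := abs_deriv_le_one hi hzI'
  have e1 : |x - (x + y) / 2| = (y - x) / 2 := by rw [abs_of_nonpos] <;> linarith
  have e2 : |(x + y) / 2 - y| = (y - x) / 2 := by rw [abs_of_nonpos] <;> linarith
  rw [e1] at e
  rw [e2] at e'
  have tri := abs_sub_le (Φ.φ i x) (Φ.φ i ((x + y) / 2)) (Φ.φ i y)
  have hpos : 0 < (y - x) / 2 := by linarith
  have : |deriv (Φ.φ i) z| < 1 ∨ |deriv (Φ.φ i) z'| < 1 := by
    by_cases h : z = Φ.fixpt i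
    · right
      refine Φ.contracting i hi z' hzI' (Or.inr fun h' => ?_)
      linarith [hz.2, hz'.1]
    · exact Or.inl (Φ.contracting i hi z hzI (Or.inr h))
  rcases this with h | h <;> nlinarith

lemma strict_contraction {i : ℕ} (hi : i ∈ Φ.I) {x y : ℝ} (hx : x ∈ Icc (0 : ℝ) 1)
    (hy : y ∈ Icc (0 : ℝ) 1) (hxy : x ≠ y) : |Φ.φ i x - Φ.φ i y| < |x - y| := by
  rcases lt_or_gt_of_ne hxy with h | h
  · rw [abs_sub_comm x y, abs_of_pos (sub_pos.2 h)]
    exact strict_contraction_of_lt hi hx hy h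
  · rw [abs_sub_comm, abs_of_pos (sub_pos.2 h)]
    exact strict_contraction_of_lt hi hy hx h

lemma contraction {i : ℕ} (hi : i ∈ Φ.I) {x y : ℝ} (hx : x ∈ Icc (0 : ℝ) 1)
    (hy : y ∈ Icc (0 : ℝ) 1) : |Φ.φ i x - Φ.φ i y| ≤ |x - y| := by
  by_cases h : x = y
  · simp [h]
  · exact (strict_contraction hi hx hy h).le

/-- A function whose logarithmic derivative is bounded by `M` has multiplicative oscillation
controlled by `exp (M |x - y|)`. -/
lemma abs_le_exp_mul_abs {g : ℝ → ℝ} (hg : ContDiff ℝ 1 g) {M : ℝ}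
    (hM : ∀ x ∈ Icc (0 : ℝ) 1, |deriv (fun t => Real.log |g t|) x| ≤ M) {x y : ℝ}
    (hx : x ∈ Icc (0 : ℝ) 1) (hy : y ∈ Icc (0 : ℝ) 1) :
    |g x| ≤ Real.exp (M * |x - y|) * |g y| := by
  have hgd := hg.differentiable one_ne_zero
  have key : ∀ t ∈ Icc (0 : ℝ) 1, |g t * deriv g t| ≤ M * g t ^ 2 := by
    intro t ht
    by_cases h0 : g t = 0
    · simp [h0]
    · have h1 := hM t ht
      have h2 : deriv (fun t => Real.log |g t|) t = deriv g t / g t := by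
        simp only [Real.log_abs]
        exact deriv.log (hgd t) h0
      rw [h2, abs_div, div_le_iff₀ (abs_pos.2 h0)] at h1
      rw [abs_mul, ← sq_abs (g t)]
      nlinarith [abs_nonneg (g t)]
  have hder : ∀ c t : ℝ, HasDerivAt (fun t => g t ^ 2 * Real.exp (2 * c * t))
      (2 * (g t * deriv g t + c * g t ^ 2) * Real.exp (2 * c * t)) t := by
    intro c t
    have h1 := ((hgd t).hasDerivAt.pow 2).mul (((hasDerivAt_id t).const_mul (2 * c)).exp)
    convert! h1 using 1
    simp
    ring
  have mono : MonotoneOn (fun t => g t ^ 2 * Real.exp (2 * M * t)) (Icc 0 1) := by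
    refine monotoneOn_of_deriv_nonneg (convex_Icc 0 1)
      (fun t _ => (hder M t).continuousAt.continuousWithinAt)
      (fun t _ => (hder M t).differentiableAt.differentiableWithinAt) fun t ht => ?_
    rw [(hder M t).deriv]
    have := (abs_le.1 (key t (interior_subset ht))).1
    have h3 : 0 ≤ g t * deriv g t + M * g t ^ 2 := by linarith
    positivity
  have anti : AntitoneOn (fun t => g t ^ 2 * Real.exp (2 * (-M) * t)) (Icc 0 1) := by
    refine antitoneOn_of_deriv_nonpos (convex_Icc 0 1)
      (fun t _ => (hder (-M) t).continuousAt.continuousWithinAt)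
      (fun t _ => (hder (-M) t).differentiableAt.differentiableWithinAt) fun t ht => ?_
    rw [(hder (-M) t).deriv]
    have := (abs_le.1 (key t (interior_subset ht))).2
    have h3 : g t * deriv g t + (-M) * g t ^ 2 ≤ 0 := by linarith
    have := Real.exp_pos (2 * (-M) * t)
    nlinarith
  have sq : g x ^ 2 ≤ g y ^ 2 * Real.exp (2 * M * |x - y|) := by
    rcases le_total x y with h | h
    · have := mono hx hy h
      simp only at this
      rw [abs_sub_comm, abs_of_nonneg (sub_nonneg.2 h)]
      have e : Real.exp (2 * M * (y - x)) * Real.exp (2 * M * x) = Real.exp (2 * M * y) := by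
        rw [← Real.exp_add]; ring_nf
      rw [← e, ← mul_assoc] at this
      exact le_of_mul_le_mul_right this (Real.exp_pos _)
    · have := anti hy hx h
      simp only at this
      rw [abs_of_nonneg (sub_nonneg.2 h)]
      have e : Real.exp (2 * M * (x - y)) * Real.exp (2 * (-M) * x) =
          Real.exp (2 * (-M) * y) := by
        rw [← Real.exp_add]; ring_nf
      rw [← e, ← mul_assoc] at this
      exact le_of_mul_le_mul_right this (Real.exp_pos _)
  refine (abs_le_of_sq_le_sq' ?_ (by positivity)).2
  rw [mul_pow, sq_abs, sq_abs, ← Real.exp_nat_mul]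
  calc g x ^ 2 ≤ _ := sq
    _ = _ := by rw [mul_comm]; congr 2; push_cast; ring

/-- Distortion bound for the single maps of the system. -/
def LogLip (Φ : PIFS) (M : ℝ) : Prop :=
  ∀ i ∈ Φ.I, ∀ x ∈ Icc (0 : ℝ) 1, ∀ y ∈ Icc (0 : ℝ) 1,
    |deriv (Φ.φ i) x| ≤ Real.exp (M * |x - y|) * |deriv (Φ.φ i) y|

lemma logLip_of_bounded (hC2 : ∀ i ∈ Φ.I, ContDiff ℝ 2 (Φ.φ i)) {M : ℝ}
    (hM : ∀ i ∈ Φ.I, ∀ x ∈ Icc (0:ℝ) 1,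
      |deriv (fun t => Real.log |deriv (Φ.φ i) t|) x| ≤ M) : LogLip Φ M := by
  intro i hi x hx y hy
  refine abs_le_exp_mul_abs ?_ (hM i hi) hx hy
  have h2 : ContDiff ℝ (1 + 1) (Φ.φ i) := by simpa [one_add_one_eq_two] using hC2 i hi
  exact (contDiff_succ_iff_deriv.1 h2).2.2

/-! ### Regular letters -/

/-- Letters whose map has non-vanishing derivative on `[0,1]`. -/
def Reg (Φ : PIFS) : Set ℕ := {i ∈ Φ.I | ∀ x ∈ Icc (0 : ℝ) 1, deriv (Φ.φ i) x ≠ 0}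

lemma injOn_of_mem_Reg {i : ℕ} (hi : i ∈ Reg Φ) : InjOn (Φ.φ i) (Icc 0 1) := by
  have hd := (Φ.smooth i hi.1).differentiable one_ne_zero
  have aux : ∀ x ∈ Icc (0 : ℝ) 1, ∀ y ∈ Icc (0 : ℝ) 1, x < y → Φ.φ i x ≠ Φ.φ i y := by
    intro x hx y hy hxy h
    obtain ⟨z, hz, h0⟩ := exists_deriv_eq_zero hxy hd.continuous.continuousOn h
    exact hi.2 z ⟨hx.1.trans hz.1.le, hz.2.le.trans hy.2⟩ h0
  intro x hx y hy h
  by_contra hne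
  rcases lt_or_gt_of_ne hne with h' | h'
  · exact aux x hx y hy h' h
  · exact aux y hy x hx h' h.symm

lemma const_of_notMem_Reg {M : ℝ} (hM : LogLip Φ M) {i : ℕ} (hi : i ∈ Φ.I) (hr : i ∉ Reg Φ)
    {x y : ℝ} (hx : x ∈ Icc (0 : ℝ) 1) (hy : y ∈ Icc (0 : ℝ) 1) : Φ.φ i x = Φ.φ i y := by
  simp only [Reg, mem_ofPred_eq, not_and, not_forall, not_not] at hr
  obtain ⟨z, hz, h0⟩ := hr hi
  obtain ⟨t, ht, e⟩ := exists_deriv_abs_Icc ((Φ.smooth i hi).differentiable one_ne_zero) hx hy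
  have := hM i hi t ht z hz
  rw [h0, abs_zero, mul_zero] at this
  rw [le_antisymm this (abs_nonneg _), zero_mul] at e
  exact sub_eq_zero.1 (abs_eq_zero.1 e)

lemma Par_sub_Reg {M : ℝ} (hM : LogLip Φ M) : Φ.Par ⊆ Reg Φ := by
  intro i hi
  refine ⟨Φ.Par_sub hi, fun x hx h0 => ?_⟩
  have := hM i (Φ.Par_sub hi) _ (Φ.fixpt_mem i hi) x hx
  rw [h0, Φ.deriv_one i hi, abs_zero, mul_zero] at this
  linarith

lemma wcomp_injOn {w : List ℕ} (hw : ∀ a ∈ w, a ∈ Reg Φ) : InjOn (wcomp Φ.φ w) (Icc 0 1) := by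
  induction w with
  | nil => exact injOn_id _
  | cons a l ih =>
    exact (injOn_of_mem_Reg (hw a (by simp))).comp (ih fun b hb => hw b (by simp [hb]))
      (wcomp_mapsTo fun b hb => (hw b (by simp [hb])).1)

lemma wcomp_mono {w : List ℕ} (hw : ∀ a ∈ w, a ∈ Reg Φ) :
    StrictMonoOn (wcomp Φ.φ w) (Icc 0 1) ∨ StrictAntiOn (wcomp Φ.φ w) (Icc 0 1) :=
  (wcomp_differentiable fun a ha => (hw a ha).1).continuous.continuousOn.strictMonoOn_of_injOn_Icc'
    zero_le_one (wcomp_injOn hw)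

lemma len_pos {w : List ℕ} (hw : ∀ a ∈ w, a ∈ Reg Φ) : 0 < len Φ w := by
  refine abs_pos.2 (sub_ne_zero.2 fun h => ?_)
  have := wcomp_injOn hw (right_mem_Icc.2 zero_le_one) (left_mem_Icc.2 zero_le_one) h
  norm_num at this

lemma abs_sub_le_len {w : List ℕ} (hw : ∀ a ∈ w, a ∈ Reg Φ) {x y : ℝ}
    (hx : x ∈ Icc (0 : ℝ) 1) (hy : y ∈ Icc (0 : ℝ) 1) :
    |wcomp Φ.φ w x - wcomp Φ.φ w y| ≤ len Φ w := by
  have m0 : (0 : ℝ) ∈ Icc (0 : ℝ) 1 := left_mem_Icc.2 zero_le_one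
  have m1 : (1 : ℝ) ∈ Icc (0 : ℝ) 1 := right_mem_Icc.2 zero_le_one
  rcases wcomp_mono hw with h | h
  · have := h.monotoneOn m0 hx hx.1
    have := h.monotoneOn m0 hy hy.1
    have := h.monotoneOn hx m1 hx.2
    have := h.monotoneOn hy m1 hy.2
    exact (abs_le.2 ⟨by linarith, by linarith⟩).trans (le_abs_self _)
  · have := h.antitoneOn m0 hx hx.1
    have := h.antitoneOn m0 hy hy.1
    have := h.antitoneOn hx m1 hx.2
    have := h.antitoneOn hy m1 hy.2
    exact (abs_le.2 ⟨by linarith, by linarith⟩).trans (neg_le_abs _)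

lemma len_append_le {u v : List ℕ} (hu : ∀ a ∈ u, a ∈ Reg Φ) (hv : ∀ a ∈ v, a ∈ Φ.I) :
    len Φ (u ++ v) ≤ len Φ u := by
  rw [len, wcomp_append]
  exact abs_sub_le_len hu (wcomp_mapsTo hv (right_mem_Icc.2 zero_le_one))
    (wcomp_mapsTo hv (left_mem_Icc.2 zero_le_one))

/-! ### Mild distortion -/

lemma tendsto_len_replicate {i : ℕ} (hi : i ∈ Φ.I) :
    Tendsto (fun n => len Φ (List.replicate n i)) atTop (𝓝 0) := by
  have hmem : ∀ n, ∀ a ∈ List.replicate n i, a ∈ Φ.I := by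
    intro n a ha
    rw [List.eq_of_mem_replicate ha]; exact hi
  set X : ℕ → ℝ := fun n => wcomp Φ.φ (List.replicate n i) 1 with hX
  set Y : ℕ → ℝ := fun n => wcomp Φ.φ (List.replicate n i) 0 with hY
  have hXm : ∀ n, X n ∈ Icc (0 : ℝ) 1 := fun n =>
    wcomp_mapsTo (hmem n) (right_mem_Icc.2 zero_le_one)
  have hYm : ∀ n, Y n ∈ Icc (0 : ℝ) 1 := fun n =>
    wcomp_mapsTo (hmem n) (left_mem_Icc.2 zero_le_one)
  have hXs : ∀ n, X (n + 1) = Φ.φ i (X n) := fun n => by simp [hX, List.replicate_succ, wcomp]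
  have hYs : ∀ n, Y (n + 1) = Φ.φ i (Y n) := fun n => by simp [hY, List.replicate_succ, wcomp]
  have hlen : ∀ n, len Φ (List.replicate n i) = |X n - Y n| := fun n => rfl
  have hanti : Antitone fun n => |X n - Y n| := by
    refine antitone_nat_of_succ_le fun n => ?_
    rw [hXs, hYs]
    exact contraction hi (hXm n) (hYm n)
  have hlim : Tendsto (fun n => |X n - Y n|) atTop (𝓝 (⨅ n, |X n - Y n|)) :=
    tendsto_atTop_ciInf hanti ⟨0, by rintro _ ⟨n, rfl⟩; exact abs_nonneg _⟩
  set d := ⨅ n, |X n - Y n|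
  obtain ⟨⟨x, y⟩, hxy, ψ, hψ, hconv⟩ := (isCompact_Icc.prod isCompact_Icc).tendsto_subseq
    (x := fun n => (X n, Y n)) (fun n => ⟨hXm n, hYm n⟩)
  have cx : Tendsto (fun n => X (ψ n)) atTop (𝓝 x) := (continuous_fst.tendsto _).comp hconv
  have cy : Tendsto (fun n => Y (ψ n)) atTop (𝓝 y) := (continuous_snd.tendsto _).comp hconv
  have e1 : |x - y| = d :=
    tendsto_nhds_unique (cx.sub cy).abs (hlim.comp hψ.tendsto_atTop)
  have hc := (Φ.smooth i hi).continuous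
  have e2 : |Φ.φ i x - Φ.φ i y| = d := by
    refine tendsto_nhds_unique
      ((((hc.tendsto x).comp cx).sub ((hc.tendsto y).comp cy)).abs) ?_
    have := (hlim.comp (tendsto_add_atTop_nat 1)).comp hψ.tendsto_atTop
    refine this.congr fun n => ?_
    simp [hXs, hYs]
  have : x = y := by
    by_contra hne
    have := strict_contraction hi hxy.1 hxy.2 hne
    linarith
  rw [this, sub_self, abs_zero] at e1
  simp only [hlen]
  rwa [← e1] at hlim

lemma replicate_distortion {M : ℝ} (hM0 : 0 ≤ M) (hM : LogLip Φ M) {i : ℕ} (hi : i ∈ Reg Φ)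
    (n : ℕ) {x y : ℝ} (hx : x ∈ Icc (0 : ℝ) 1) (hy : y ∈ Icc (0 : ℝ) 1) :
    |deriv (wcomp Φ.φ (List.replicate n i)) x| ≤
      Real.exp (M * ∑ k ∈ Finset.range n, len Φ (List.replicate k i)) *
        |deriv (wcomp Φ.φ (List.replicate n i)) y| := by
  have hmem : ∀ n, ∀ a ∈ List.replicate n i, a ∈ Reg Φ := by
    intro n a ha
    rw [List.eq_of_mem_replicate ha]; exact hi
  have hmI : ∀ n, ∀ a ∈ List.replicate n i, a ∈ Φ.I := fun n a ha => (hmem n a ha).1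
  induction n with
  | zero => simp [wcomp]
  | succ n ih =>
    have hs : List.replicate (n + 1) i = [i] ++ List.replicate n i := rfl
    have h1 : ∀ a ∈ [i], a ∈ Φ.I := by simpa using hi.1
    rw [hs, deriv_wcomp_append h1 (hmI n), deriv_wcomp_append h1 (hmI n), abs_mul, abs_mul,
      Finset.sum_range_succ, mul_add, Real.exp_add]
    have e : wcomp Φ.φ [i] = Φ.φ i := rfl
    rw [e]
    have h2 := hM i hi.1 _ (wcomp_mapsTo (hmI n) hx) _ (wcomp_mapsTo (hmI n) hy)
    have h3 := abs_sub_le_len (hmem n) hx hy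
    have h4 := Real.exp_le_exp.2 (mul_le_mul_of_nonneg_left h3 hM0)
    have h5 := h2.trans (mul_le_mul_of_nonneg_right h4 (abs_nonneg _))
    calc _ ≤ _ := mul_le_mul h5 ih (abs_nonneg _) (by positivity)
      _ = _ := by ring

lemma exists_decomposition {l : List ℕ} (hl : l ≠ []) :
    ∃ τ i k, l = (τ ++ [i]) ++ List.replicate k i ∧ (τ = [] ∨ Good Φ (τ ++ [i])) ∧
      (k = 0 ∨ i ∈ Φ.Par) := by
  induction l using List.reverseRecOn with
  | nil => exact absurd rfl hl
  | append_singleton l a ih =>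
    by_cases h : l = []
    · exact ⟨[], a, 0, by simp [h], Or.inl rfl, Or.inl rfl⟩
    · obtain ⟨τ, i, k, e, h1, h2⟩ := ih h
      by_cases hg : a ∉ Φ.Par ∨ i ≠ a
      · refine ⟨l, a, 0, by simp, Or.inr ?_, Or.inl rfl⟩
        refine ⟨τ ++ List.replicate k i, i, a, ?_, hg⟩
        have : [i] ++ List.replicate k i = List.replicate k i ++ [i] := by
          rw [← List.replicate_succ']; rfl
        rw [e, List.append_assoc τ, this]
        simp
      · push Not at hg
        refine ⟨τ, i, k + 1, ?_, h1, Or.inr (hg.2 ▸ hg.1)⟩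
        rw [e, List.replicate_succ', ← hg.2]
        simp

lemma mildB2_of_logLip {M : ℝ} (hM0 : 0 ≤ M) (hM : LogLip Φ M) : MildB2 Φ := by
  have habs : ∀ x ∈ Icc (0 : ℝ) 1, ∀ y ∈ Icc (0 : ℝ) 1, |x - y| ≤ 1 := by
    intro x hx y hy
    exact abs_le.2 ⟨by linarith [hx.1, hy.2], by linarith [hx.2, hy.1]⟩
  have hD1 : ∀ i ∈ Φ.I, ∀ x ∈ Icc (0 : ℝ) 1, ∀ y ∈ Icc (0 : ℝ) 1,
      |deriv (Φ.φ i) x| ≤ Real.exp M * |deriv (Φ.φ i) y| := by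
    intro i hi x hx y hy
    refine (hM i hi x hx y hy).trans (mul_le_mul_of_nonneg_right ?_ (abs_nonneg _))
    exact Real.exp_le_exp.2 (mul_le_of_le_one_right hM0 (habs x hx y hy))
  refine ⟨⟨Real.exp M, hD1⟩, fun ε hε => ?_⟩
  set D := max Φ.distC (Real.exp M) with hD
  have hD1' : 1 ≤ D := Φ.distC_ge_one.trans (le_max_left _ _)
  set S : ℕ → ℕ → ℝ := fun i n => ∑ k ∈ Finset.range n, len Φ (List.replicate k i) with hS
  have hSmono : ∀ i, Monotone (S i) := fun i => by
    refine monotone_nat_of_le_succ fun n => ?_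
    simp only [hS, Finset.sum_range_succ]
    linarith [len_nonneg (Φ := Φ) (List.replicate n i)]
  have hev : ∀ i ∈ Φ.Par, ∀ᶠ n : ℕ in atTop, M * S i n ≤ ε / 2 * n := by
    intro i hi
    have h1 := ((tendsto_len_replicate (Φ.Par_sub hi)).cesaro).const_mul M
    rw [mul_zero] at h1
    filter_upwards [h1.eventually (ge_mem_nhds (half_pos hε)), eventually_gt_atTop 0] with n hn hn0
    have hn0' : (0 : ℝ) < n := by exact_mod_cast hn0
    have := mul_le_mul_of_nonneg_right hn hn0'.le
    calc M * S i n = M * ((n : ℝ)⁻¹ * S i n) * n := by field_simp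
      _ ≤ _ := this
  have hev2 : ∀ᶠ n : ℕ in atTop, Real.log D ≤ ε / 2 * n :=
    (tendsto_natCast_atTop_atTop.const_mul_atTop (half_pos hε)).eventually_ge_atTop _
  obtain ⟨N, hN⟩ := eventually_atTop.1
    (((Φ.Par_finite.eventually_all).2 hev).and (hev2.and (eventually_gt_atTop 0)))
  refine ⟨N, fun n hn l hl x hx y hy => ?_⟩
  obtain ⟨hNS, hND, hn0⟩ := hN n hn
  have hlne : l ≠ [] := by
    rintro rfl
    have := hl.1
    simp at this
    omega
  obtain ⟨τ, i, k, e, h1, h2⟩ := exists_decomposition (Φ := Φ) hlne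
  have hτ : ∀ a ∈ τ ++ [i], a ∈ Φ.I := fun a ha => hl.2 a (by rw [e]; simp at ha ⊢; tauto)
  have hi : i ∈ Φ.I := hτ i (by simp)
  have hr : ∀ a ∈ List.replicate k i, a ∈ Φ.I := by
    intro a ha
    rw [List.eq_of_mem_replicate ha]; exact hi
  have hkn : k ≤ n := by
    have := hl.1
    rw [e] at this
    simp at this
    omega
  have hfirst : ∀ x ∈ Icc (0 : ℝ) 1, ∀ y ∈ Icc (0 : ℝ) 1,
      |deriv (wcomp Φ.φ (τ ++ [i])) x| ≤ D * |deriv (wcomp Φ.φ (τ ++ [i])) y| := by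
    intro x hx y hy
    rcases h1 with rfl | h1
    · exact (hD1 i hi x hx y hy).trans
        (mul_le_mul_of_nonneg_right (le_max_right _ _) (abs_nonneg _))
    · exact (h1.distortion hτ hx hy).trans
        (mul_le_mul_of_nonneg_right (le_max_left _ _) (abs_nonneg _))
  have hsecond : |deriv (wcomp Φ.φ (List.replicate k i)) x| ≤
      Real.exp (ε / 2 * n) * |deriv (wcomp Φ.φ (List.replicate k i)) y| := by
    rcases h2 with rfl | h2
    · have : (1 : ℝ) ≤ Real.exp (ε / 2 * n) := Real.one_le_exp (by positivity)
      simpa [wcomp] using this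
    · refine (replicate_distortion hM0 hM (Par_sub_Reg hM h2) k hx hy).trans
        (mul_le_mul_of_nonneg_right (Real.exp_le_exp.2 ?_) (abs_nonneg _))
      exact (mul_le_mul_of_nonneg_left (hSmono i hkn) hM0).trans (hNS i h2)
  have hDexp : D ≤ Real.exp (ε / 2 * n) := by
    rw [← Real.exp_log (by linarith : 0 < D)]
    exact Real.exp_le_exp.2 hND
  rw [e, deriv_wcomp_append hτ hr, deriv_wcomp_append hτ hr, abs_mul, abs_mul]
  have hf := (hfirst _ (wcomp_mapsTo hr hx) _ (wcomp_mapsTo hr hy)).trans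
    (mul_le_mul_of_nonneg_right hDexp (abs_nonneg _))
  have hee : Real.exp (ε * n) = Real.exp (ε / 2 * n) * Real.exp (ε / 2 * n) := by
    rw [← Real.exp_add]; ring_nf
  calc _ ≤ _ := mul_le_mul hf hsecond (abs_nonneg _) (by positivity)
    _ = _ := by rw [hee]; ring

/-! ### Geometry of fundamental intervals -/

lemma mapsTo_Ioo_of_mem_Reg {i : ℕ} (hi : i ∈ Reg Φ) : MapsTo (Φ.φ i) (Ioo 0 1) (Ioo 0 1) := by
  intro x hx
  have m0 : (0 : ℝ) ∈ Icc (0 : ℝ) 1 := left_mem_Icc.2 zero_le_one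
  have m1 : (1 : ℝ) ∈ Icc (0 : ℝ) 1 := right_mem_Icc.2 zero_le_one
  have mx := Ioo_subset_Icc_self hx
  have h0 := Φ.maps_to i hi.1 m0
  have h1 := Φ.maps_to i hi.1 m1
  have := wcomp_mono (Φ := Φ) (w := [i]) (by simpa using hi)
  simp only [wcomp, Function.comp_id] at this
  rcases this with h | h
  · exact ⟨h0.1.trans_lt (h m0 mx hx.1), (h mx m1 hx.2).trans_le h1.2⟩
  · exact ⟨h1.1.trans_lt (h mx m1 hx.2), (h m0 mx hx.1).trans_le h0.2⟩

lemma wcomp_mapsTo_Ioo {w : List ℕ} (hw : ∀ a ∈ w, a ∈ Reg Φ) :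
    MapsTo (wcomp Φ.φ w) (Ioo 0 1) (Ioo 0 1) := by
  induction w with
  | nil => exact fun x hx => hx
  | cons a l ih =>
    exact (mapsTo_Ioo_of_mem_Reg (hw a (by simp))).comp (ih fun b hb => hw b (by simp [hb]))

lemma disjoint_image_Ioo {u v : List ℕ} (hu : ∀ a ∈ u, a ∈ Reg Φ) (hv : ∀ a ∈ v, a ∈ Reg Φ)
    (h1 : ¬ u <+: v) (h2 : ¬ v <+: u) :
    Disjoint (wcomp Φ.φ u '' Ioo 0 1) (wcomp Φ.φ v '' Ioo 0 1) := by
  induction u generalizing v with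
  | nil => exact absurd List.nil_prefix h1
  | cons a u ih =>
    cases v with
    | nil => exact absurd List.nil_prefix h2
    | cons b v =>
      have hu' : ∀ a ∈ u, a ∈ Reg Φ := fun c hc => hu c (by simp [hc])
      have hv' : ∀ a ∈ v, a ∈ Reg Φ := fun c hc => hv c (by simp [hc])
      rw [Set.disjoint_left]
      rintro _ ⟨x, hx, rfl⟩ ⟨y, hy, e⟩
      have hx' := wcomp_mapsTo_Ioo hu' hx
      have hy' := wcomp_mapsTo_Ioo hv' hy
      simp only [wcomp, Function.comp_apply] at e
      by_cases hab : a = b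
      · subst hab
        have e' := injOn_of_mem_Reg (hu a (by simp)) (Ioo_subset_Icc_self hy')
          (Ioo_subset_Icc_self hx') e
        refine Set.disjoint_left.1 (ih hu' hv' (fun h => h1 ?_) (fun h => h2 ?_))
          ⟨x, hx, rfl⟩ ⟨y, hy, e'⟩
        · exact (List.prefix_cons_inj a).2 h
        · exact (List.prefix_cons_inj a).2 h
      · have := Φ.osc a (hu a (by simp)).1 b (hv b (by simp)).1 hab
        rw [← Set.disjoint_iff_inter_eq_empty, Set.disjoint_left] at this
        exact this ⟨_, hx', rfl⟩ ⟨_, hy', e⟩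

lemma volume_image_Ioo {w : List ℕ} (hw : ∀ a ∈ w, a ∈ Reg Φ) :
    MeasurableSet (wcomp Φ.φ w '' Ioo 0 1) ∧
      volume (wcomp Φ.φ w '' Ioo 0 1) = ENNReal.ofReal (len Φ w) := by
  have m0 : (0 : ℝ) ∈ Icc (0 : ℝ) 1 := left_mem_Icc.2 zero_le_one
  have m1 : (1 : ℝ) ∈ Icc (0 : ℝ) 1 := right_mem_Icc.2 zero_le_one
  have hc := (wcomp_differentiable fun a ha => (hw a ha).1).continuous.continuousOn (s := Icc 0 1)
  rcases wcomp_mono hw with h | h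
  · have : wcomp Φ.φ w '' Ioo 0 1 = Ioo (wcomp Φ.φ w 0) (wcomp Φ.φ w 1) := by
      refine Subset.antisymm ?_ (intermediate_value_Ioo zero_le_one hc)
      rintro _ ⟨x, hx, rfl⟩
      exact ⟨h m0 (Ioo_subset_Icc_self hx) hx.1, h (Ioo_subset_Icc_self hx) m1 hx.2⟩
    rw [this, len, abs_of_pos (sub_pos.2 (h m0 m1 zero_lt_one))]
    exact ⟨measurableSet_Ioo, Real.volume_Ioo⟩
  · have : wcomp Φ.φ w '' Ioo 0 1 = Ioo (wcomp Φ.φ w 1) (wcomp Φ.φ w 0) := by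
      refine Subset.antisymm ?_ (intermediate_value_Ioo' zero_le_one hc)
      rintro _ ⟨x, hx, rfl⟩
      exact ⟨h (Ioo_subset_Icc_self hx) m1 hx.2, h m0 (Ioo_subset_Icc_self hx) hx.1⟩
    rw [this, len, abs_sub_comm, abs_of_pos (sub_pos.2 (h m0 m1 zero_lt_one))]
    exact ⟨measurableSet_Ioo, Real.volume_Ioo⟩

/-- Fundamental intervals of pairwise incomparable words inside an interval have total length
at most that of the interval. -/
lemma sum_len_le {T : Finset (List ℕ)} (hT : ∀ w ∈ T, ∀ a ∈ w, a ∈ Reg Φ)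
    (hp : ∀ u ∈ T, ∀ v ∈ T, u <+: v → u = v) {c d : ℝ} (hcd : c ≤ d)
    (hsub : ∀ w ∈ T, wcomp Φ.φ w '' Ioo 0 1 ⊆ Icc c d) : ∑ w ∈ T, len Φ w ≤ d - c := by
  have hdisj : (T : Set (List ℕ)).PairwiseDisjoint fun w => wcomp Φ.φ w '' Ioo 0 1 := by
    intro u hu v hv huv
    exact disjoint_image_Ioo (hT u hu) (hT v hv) (fun h => huv (hp u hu v hv h))
      (fun h => huv (hp v hv u hu h).symm)
  have h1 := measure_biUnion_finset (μ := volume) hdisj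
    fun w hw => (volume_image_Ioo (hT w hw)).1
  have h2 : volume (⋃ w ∈ T, wcomp Φ.φ w '' Ioo 0 1) ≤ ENNReal.ofReal (d - c) := by
    rw [← Real.volume_Icc]
    exact measure_mono (iUnion₂_subset hsub)
  rw [h1, Finset.sum_congr rfl fun w hw => (volume_image_Ioo (hT w hw)).2,
    ← ENNReal.ofReal_sum_of_nonneg fun w _ => len_nonneg w] at h2
  exact (ENNReal.ofReal_le_ofReal_iff (by linarith)).1 h2

lemma len_singleton_lt_one {i : ℕ} (hi : i ∈ Φ.I) : len Φ [i] < 1 := by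
  have := strict_contraction hi (right_mem_Icc.2 zero_le_one) (left_mem_Icc.2 zero_le_one)
    one_ne_zero
  simpa [len, wcomp] using this

lemma exists_len_singleton_le (Φ : PIFS) : ∃ ρ < 1, ∀ i ∈ Reg Φ, len Φ [i] ≤ ρ := by
  by_cases h : ∃ i ∈ Reg Φ, 1 / 2 < len Φ [i]
  · obtain ⟨i, hi, hl⟩ := h
    refine ⟨len Φ [i], len_singleton_lt_one hi.1, fun j hj => ?_⟩
    by_cases hij : i = j
    · rw [hij]
    · have hT : ∀ w ∈ ({[i], [j]} : Finset (List ℕ)), ∀ a ∈ w, a ∈ Reg Φ := by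
        simp [hi, hj]
      have := sum_len_le hT ?_ zero_le_one fun w hw =>
        (image_mono Ioo_subset_Icc_self).trans
          (wcomp_mapsTo fun a ha => (hT w hw a ha).1).image_subset
      · rw [Finset.sum_pair (by simpa using hij)] at this
        linarith
      · intro u hu v hv huv
        refine huv.eq_of_length ?_
        simp only [Finset.mem_insert, Finset.mem_singleton] at hu hv
        rcases hu with rfl | rfl <;> rcases hv with rfl | rfl <;> rfl
  · push Not at h
    exact ⟨1 / 2, by norm_num, h⟩

lemma Good.len_append_le {ρ : ℝ} (hρ : ∀ i ∈ Reg Φ, len Φ [i] ≤ ρ) {w : List ℕ} (h : Good Φ w)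
    (hw : ∀ a ∈ w, a ∈ Reg Φ) {i : ℕ} (hi : i ∈ Reg Φ) :
    len Φ (w ++ [i]) ≤ (1 - (1 - ρ) / Φ.distC) * len Φ w := by
  have m0 : (0 : ℝ) ∈ Icc (0 : ℝ) 1 := left_mem_Icc.2 zero_le_one
  have m1 : (1 : ℝ) ∈ Icc (0 : ℝ) 1 := right_mem_Icc.2 zero_le_one
  have hC : 0 < Φ.distC := zero_lt_one.trans_le Φ.distC_ge_one
  have hwI : ∀ a ∈ w, a ∈ Φ.I := fun a ha => (hw a ha).1
  have aux : ∀ a ∈ Icc (0 : ℝ) 1, ∀ b ∈ Icc (0 : ℝ) 1, a ≤ b → b - a ≤ ρ →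
      |wcomp Φ.φ w b - wcomp Φ.φ w a| ≤ (1 - (1 - ρ) / Φ.distC) * len Φ w := by
    intro a ha b hb hab hba
    have h1 := h.len_mul_le hwI ha m0
    have h2 := h.len_mul_le hwI m1 hb
    rw [sub_zero, abs_of_nonneg ha.1] at h1
    rw [abs_of_nonneg (sub_nonneg.2 hb.2)] at h2
    have h3 : len Φ w = |wcomp Φ.φ w b - wcomp Φ.φ w a| + |wcomp Φ.φ w a - wcomp Φ.φ w 0| +
        |wcomp Φ.φ w 1 - wcomp Φ.φ w b| := by
      rcases wcomp_mono hw with h | h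
      · have e1 := h.monotoneOn m0 ha ha.1
        have e2 := h.monotoneOn ha hb hab
        have e3 := h.monotoneOn hb m1 hb.2
        rw [len, abs_of_nonneg, abs_of_nonneg, abs_of_nonneg, abs_of_nonneg] <;> linarith
      · have e1 := h.antitoneOn m0 ha ha.1
        have e2 := h.antitoneOn ha hb hab
        have e3 := h.antitoneOn hb m1 hb.2
        rw [len, abs_of_nonpos, abs_of_nonpos, abs_of_nonpos, abs_of_nonpos] <;> linarith
    have h4 : len Φ w * (1 - ρ) ≤ Φ.distC * (|wcomp Φ.φ w a - wcomp Φ.φ w 0| +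
        |wcomp Φ.φ w 1 - wcomp Φ.φ w b|) := by
      have := mul_le_mul_of_nonneg_left (show 1 - ρ ≤ a + (1 - b) by linarith)
        (len_nonneg (Φ := Φ) w)
      linarith
    have h5 : len Φ w * (1 - ρ) / Φ.distC ≤ |wcomp Φ.φ w a - wcomp Φ.φ w 0| +
        |wcomp Φ.φ w 1 - wcomp Φ.φ w b| := by
      rw [div_le_iff₀ hC]; linarith
    have h6 : (1 - (1 - ρ) / Φ.distC) * len Φ w = len Φ w - len Φ w * (1 - ρ) / Φ.distC := by
      ring
    linarith
  have hl := hρ i hi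
  have e0 := Φ.maps_to i hi.1 m0
  have e1 := Φ.maps_to i hi.1 m1
  simp only [len, wcomp, Function.comp_id] at hl
  rw [len, wcomp_append]
  simp only [wcomp, Function.comp_apply, id]
  rcases le_total (Φ.φ i 0) (Φ.φ i 1) with h' | h'
  · exact aux _ e0 _ e1 h' ((le_abs_self _).trans hl)
  · rw [abs_sub_comm]
    exact aux _ e1 _ e0 h' (by linarith [neg_le_abs (Φ.φ i 1 - Φ.φ i 0)])

/-- Fundamental intervals shrink along sequences with infinitely many good prefixes. -/
lemma tendsto_len_pre {ω : ℕ → ℕ} (hω : ∀ k, ω k ∈ Reg Φ) (hg : ∃ᶠ n in atTop, Good Φ (pre ω n)) :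
    Tendsto (fun n => len Φ (pre ω n)) atTop (𝓝 0) := by
  obtain ⟨ρ, hρ1, hρ⟩ := exists_len_singleton_le Φ
  have hC : 0 < Φ.distC := zero_lt_one.trans_le Φ.distC_ge_one
  have hmem : ∀ n, ∀ a ∈ pre ω n, a ∈ Reg Φ := by
    intro n a ha
    obtain ⟨k, -, rfl⟩ := List.mem_map.1 ha
    exact hω k
  have hanti : Antitone fun n => len Φ (pre ω n) := by
    refine antitone_nat_of_succ_le fun n => ?_
    rw [pre_succ]
    exact len_append_le (hmem n) (by simpa using (hω n).1)
  have hlim : Tendsto (fun n => len Φ (pre ω n)) atTop (𝓝 (⨅ n, len Φ (pre ω n))) :=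
    tendsto_atTop_ciInf hanti ⟨0, by rintro _ ⟨n, rfl⟩; exact len_nonneg _⟩
  have h0 : 0 ≤ ⨅ n, len Φ (pre ω n) := le_ciInf fun n => len_nonneg _
  set d := ⨅ n, len Φ (pre ω n)
  have hle : (1 - (1 - ρ) / Φ.distC) * d - d ≥ 0 := by
    have ht := (hlim.const_mul (1 - (1 - ρ) / Φ.distC)).sub (hlim.comp (tendsto_add_atTop_nat 1))
    refine ge_of_tendsto_of_frequently ht (hg.mono fun n hn => sub_nonneg.2 ?_)
    simp only [Function.comp_apply, pre_succ]
    exact hn.len_append_le hρ (hmem n) (hω n)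
  have hpos : 0 < (1 - ρ) / Φ.distC := div_pos (by linarith) hC
  have : d = 0 := by nlinarith
  rwa [this] at hlim

/-! ### The limit set up to a countable set -/

lemma ediam_image_le {w : List ℕ} (hw : ∀ a ∈ w, a ∈ Reg Φ) :
    Metric.ediam (wcomp Φ.φ w '' Icc 0 1) ≤ ENNReal.ofReal (len Φ w) := by
  refine Metric.ediam_le ?_
  rintro _ ⟨x, hx, rfl⟩ _ ⟨y, hy, rfl⟩
  rw [edist_dist, Real.dist_eq]
  exact ENNReal.ofReal_le_ofReal (abs_sub_le_len hw hx hy)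

/-- The sequences of regular letters that are not eventually constant. -/
def RegSeqs (Φ : PIFS) : Set (ℕ → ℕ) := {ω | (∀ k, ω k ∈ Reg Φ) ∧ ∃ᶠ n in atTop, ω n ≠ ω (n + 1)}

lemma frequently_good {ω : ℕ → ℕ} (h : ω ∈ RegSeqs Φ) : ∃ᶠ n in atTop, Good Φ (pre ω n) := by
  have : ∃ᶠ n in atTop, Good Φ (pre ω (n + 2)) := by
    refine h.2.mono fun n hn => ⟨pre ω n, ω n, ω (n + 1), ?_, Or.inr hn⟩
    rw [pre_succ, pre_succ]; simp
  exact (tendsto_add_atTop_nat 2).frequently this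

lemma countable_eventually_const : {ω : ℕ → ℕ | ∀ᶠ n in atTop, ω n = ω (n + 1)}.Countable := by
  have : {ω : ℕ → ℕ | ∀ᶠ n in atTop, ω n = ω (n + 1)} ⊆
      range fun p : List ℕ × ℕ => fun n => p.1.getD n p.2 := by
    intro ω hω
    obtain ⟨N, hN⟩ := eventually_atTop.1 hω
    refine ⟨(pre ω N, ω N), funext fun n => ?_⟩
    by_cases hn : n < N
    · simp [pre, hn]
    · have : ∀ m ≥ N, ω m = ω N := fun m hm => by
        induction m, hm using Nat.le_induction with
        | base => rfl
        | succ m hm ih => rw [← hN m hm, ih]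
      simp [pre, hn, this n (not_lt.1 hn)]
  exact (countable_range _).mono this

lemma countable_limitSet_diff {M : ℝ} (hM : LogLip Φ M) {Pi : (ℕ → ℕ) → ℝ}
    (hPi : IsAddressMap Φ Pi) :
    ∃ S : Set ℝ, S.Countable ∧ limitSet Φ Pi ⊆ Pi '' RegSeqs Φ ∪ S := by
  refine ⟨Pi '' {ω | ∀ᶠ n in atTop, ω n = ω (n + 1)} ∪ range (fun w => wcomp Φ.φ w 0),
    (countable_eventually_const.image Pi).union (countable_range _), ?_⟩
  rintro _ ⟨ω, hω, rfl⟩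
  by_cases h : ∀ k, ω k ∈ Reg Φ
  · by_cases h' : ∃ᶠ n in atTop, ω n ≠ ω (n + 1)
    · exact Or.inl ⟨ω, ⟨h, h'⟩, rfl⟩
    · rw [not_frequently] at h'
      exact Or.inr (Or.inl ⟨ω, by simpa using h', rfl⟩)
  · push Not at h
    obtain ⟨k, hk⟩ := h
    right; right
    obtain ⟨x, hx, e⟩ := hPi ω hω (k + 1)
    refine ⟨pre ω (k + 1), ?_⟩
    simp only [← e, comp_eq_wcomp_pre, pre_succ, wcomp_append, Function.comp_apply]
    exact congrArg (wcomp Φ.φ (pre ω k))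
      (const_of_notMem_Reg hM (hω k) hk (left_mem_Icc.2 zero_le_one) hx)

/-- Good words of regular letters whose length first drops to at most `δ`. -/
def Stop (Φ : PIFS) (δ : ℝ) : Set (List ℕ) :=
  {w | (∀ a ∈ w, a ∈ Reg Φ) ∧ Good Φ w ∧ len Φ w ≤ δ ∧
    ∀ v, v <+: w → Good Φ v → len Φ v ≤ δ → v = w}

lemma exists_pre_mem_Stop {δ : ℝ} (hδ : 0 < δ) {ω : ℕ → ℕ} (h : ω ∈ RegSeqs Φ) :
    ∃ n, pre ω n ∈ Stop Φ δ := by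
  have hg := frequently_good h
  have he := (tendsto_len_pre h.1 hg).eventually (ge_mem_nhds hδ)
  have hex : ∃ n, Good Φ (pre ω n) ∧ len Φ (pre ω n) ≤ δ := (hg.and_eventually he).exists
  refine ⟨Nat.find hex, fun a ha => ?_, (Nat.find_spec hex).1, (Nat.find_spec hex).2,
    fun v hv hvg hvl => ?_⟩
  · obtain ⟨k, -, rfl⟩ := List.mem_map.1 ha
    exact h.1 k
  · have e := eq_pre_of_isPrefix hv
    have h1 := hv.length_le
    have h2 := Nat.find_min' hex ⟨e ▸ hvg, e ▸ hvl⟩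
    simp only [length_pre] at h1
    rw [e, le_antisymm h1 h2]

/-- If the dimension of the limit set exceeds `s`, there is a finite prefix-free family of good
words with large `s`-sum. -/
lemma exists_finset_words {M : ℝ} (hM : LogLip Φ M) {Pi : (ℕ → ℕ) → ℝ} (hPi : IsAddressMap Φ Pi)
    {s : ℝ≥0} (hs : (s : ℝ≥0∞) < dimH (limitSet Φ Pi)) (K : ℝ≥0) :
    ∃ F : Finset (List ℕ), (∀ w ∈ F, ∀ a ∈ w, a ∈ Reg Φ) ∧ (∀ w ∈ F, Good Φ w) ∧
      (∀ u ∈ F, ∀ v ∈ F, u <+: v → u = v) ∧ (K : ℝ) < ∑ w ∈ F, len Φ w ^ (s : ℝ) := by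
  obtain ⟨S, hS, hsub⟩ := countable_limitSet_diff hM hPi
  have h1 : (s : ℝ≥0∞) < dimH (Pi '' RegSeqs Φ) := by
    have := hs.trans_le (dimH_mono hsub)
    rwa [dimH_union, hS.dimH_zero, max_eq_left zero_le] at this
  have h2 : Measure.hausdorffMeasure (s : ℝ) (Pi '' RegSeqs Φ) = ⊤ :=
    hausdorffMeasure_of_lt_dimH h1
  have hr : Tendsto (fun n : ℕ => ENNReal.ofReal (1 / ((n : ℝ) + 1))) atTop (𝓝 0) := by
    rw [← ENNReal.ofReal_zero]
    exact ENNReal.tendsto_ofReal tendsto_one_div_add_atTop_nhds_zero_nat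
  have h3 := Measure.hausdorffMeasure_le_liminf_tsum (s : ℝ) (Pi '' RegSeqs Φ)
    (ι := fun n : ℕ => Stop Φ (1 / ((n : ℝ) + 1))) _ hr
    (fun n w => wcomp Φ.φ w.1 '' Icc 0 1)
    (Eventually.of_forall fun n w => (ediam_image_le w.2.1).trans
      (ENNReal.ofReal_le_ofReal w.2.2.2.1))
    (Eventually.of_forall fun n => by
      rintro _ ⟨ω, hω, rfl⟩
      obtain ⟨m, hm⟩ := exists_pre_mem_Stop (δ := 1 / ((n : ℝ) + 1)) (by positivity) hω
      refine mem_iUnion.2 ⟨⟨_, hm⟩, ?_⟩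
      rw [← comp_eq_wcomp_pre]
      exact hPi ω (fun k => (hω.1 k).1) m)
  rw [h2, top_le_iff] at h3
  obtain ⟨n, hn⟩ : ∃ n : ℕ, (K : ℝ≥0∞) < ∑' w : Stop Φ (1 / ((n : ℝ) + 1)),
      Metric.ediam (wcomp Φ.φ w.1 '' Icc 0 1) ^ (s : ℝ) := by
    by_contra hcon
    push Not at hcon
    have h4 := liminf_le_of_le (f := atTop) (a := (K : ℝ≥0∞))
      (u := fun n : ℕ => ∑' w : Stop Φ (1 / ((n : ℝ) + 1)),
        Metric.ediam (wcomp Φ.φ w.1 '' Icc 0 1) ^ (s : ℝ)) (by isBoundedDefault)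
      (fun b hb => (hb.exists.elim fun n hn => hn.trans (hcon n)))
    rw [h3, top_le_iff] at h4
    exact ENNReal.coe_ne_top h4
  rw [ENNReal.tsum_eq_iSup_sum, lt_iSup_iff] at hn
  obtain ⟨F, hF⟩ := hn
  refine ⟨F.map (Function.Embedding.subtype _), ?_, ?_, ?_, ?_⟩
  · intro w hw
    obtain ⟨v, -, rfl⟩ := Finset.mem_map.1 hw
    exact v.2.1
  · intro w hw
    obtain ⟨v, -, rfl⟩ := Finset.mem_map.1 hw
    exact v.2.2.1
  · intro u hu v hv huv
    obtain ⟨u, -, rfl⟩ := Finset.mem_map.1 hu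
    obtain ⟨v, -, rfl⟩ := Finset.mem_map.1 hv
    exact v.2.2.2.2 _ huv u.2.2.1 u.2.2.2.1
  · rw [Finset.sum_map]
    have h5 : ∑ w ∈ F, Metric.ediam (wcomp Φ.φ w.1 '' Icc 0 1) ^ (s : ℝ) ≤
        ∑ w ∈ F, ENNReal.ofReal (len Φ w.1 ^ (s : ℝ)) := by
      refine Finset.sum_le_sum fun w _ => ?_
      rw [← ENNReal.ofReal_rpow_of_nonneg (len_nonneg _) s.coe_nonneg]
      exact ENNReal.rpow_le_rpow (ediam_image_le w.2.1) s.coe_nonneg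
    rw [← ENNReal.ofReal_sum_of_nonneg fun w _ => Real.rpow_nonneg (len_nonneg _) _] at h5
    have h6 := hF.trans_le h5
    rw [← ENNReal.ofReal_coe_nnreal] at h6
    exact (ENNReal.ofReal_lt_ofReal_iff_of_nonneg K.2).1 h6

section Concat

variable {m : ℕ} (w : Fin m → List ℕ)

/-- The concatenation of the words `w i`, `i` running through the list `a`. -/
def flat (a : List (Fin m)) : List ℕ := a.flatMap w

/-- The digit sequence obtained by concatenating the words `w (σ 0), w (σ 1), …`. -/
def concatSeq (σ : ℕ → Fin m) (n : ℕ) : ℕ := (flat w (pre σ (n + 1))).getD n 0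

@[simp] lemma flat_nil : flat w [] = [] := rfl

@[simp] lemma flat_cons (i : Fin m) (a : List (Fin m)) : flat w (i :: a) = w i ++ flat w a := by
  simp [flat]

@[simp] lemma flat_append (a b : List (Fin m)) : flat w (a ++ b) = flat w a ++ flat w b := by
  simp [flat]

variable {w}

lemma mem_of_mem_flat {S : Set ℕ} (hS : ∀ i, ∀ b ∈ w i, b ∈ S) (a : List (Fin m)) :
    ∀ b ∈ flat w a, b ∈ S := by
  intro b hb
  obtain ⟨i, -, hi⟩ := List.mem_flatMap.1 hb
  exact hS i b hi

lemma length_le_length_flat (hne : ∀ i, w i ≠ []) (a : List (Fin m)) :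
    a.length ≤ (flat w a).length := by
  induction a with
  | nil => simp
  | cons i a ih =>
    have := List.length_pos_iff.2 (hne i)
    simp only [List.length_cons, flat_cons, List.length_append]
    omega

lemma flat_isPrefix_flat {a b : List (Fin m)} (h : a <+: b) : flat w a <+: flat w b := by
  obtain ⟨c, rfl⟩ := h
  exact ⟨flat w c, by simp⟩

lemma isPrefix_of_flat_isPrefix (hne : ∀ i, w i ≠ []) (hp : ∀ i j, w i <+: w j → i = j) :
    ∀ a b : List (Fin m), flat w a <+: flat w b → a <+: b
  | [], b, _ => ⟨b, rfl⟩
  | i :: a, [], h => by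
    have := List.eq_nil_of_prefix_nil h
    simp [hne i] at this
  | i :: a, j :: b, h => by
    rw [flat_cons, flat_cons] at h
    have hij : i = j := by
      rcases List.prefix_or_prefix_of_prefix ((List.prefix_append _ _).trans h)
        (List.prefix_append (w j) (flat w b)) with h' | h'
      · exact hp _ _ h'
      · exact (hp _ _ h').symm
    subst hij
    rw [List.prefix_append_right_inj] at h
    exact List.cons_prefix_cons.2 ⟨rfl, isPrefix_of_flat_isPrefix hne hp a b h⟩

lemma getD_of_isPrefix {u v : List ℕ} (h : u <+: v) {n : ℕ} (hn : n < u.length) :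
    v.getD n 0 = u.getD n 0 := by
  obtain ⟨c, rfl⟩ := h
  simp [List.getD_eq_getElem?_getD, List.getElem?_append_left hn]

lemma concatSeq_eq_getD (hne : ∀ i, w i ≠ []) (σ : ℕ → Fin m) {n k : ℕ}
    (h : n < (flat w (pre σ k)).length) : concatSeq w σ n = (flat w (pre σ k)).getD n 0 := by
  have h' : n < (flat w (pre σ (n + 1))).length :=
    lt_of_lt_of_le (by simp) (length_le_length_flat hne _)
  rcases le_total (n + 1) k with hk | hk
  · exact (getD_of_isPrefix (flat_isPrefix_flat (pre_isPrefix σ hk)) h').symm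
  · exact getD_of_isPrefix (flat_isPrefix_flat (pre_isPrefix σ hk)) h

lemma pre_concatSeq (hne : ∀ i, w i ≠ []) (σ : ℕ → Fin m) (k : ℕ) :
    pre (concatSeq w σ) (flat w (pre σ k)).length = flat w (pre σ k) := by
  refine List.ext_getElem (by simp) fun n h₁ h₂ => ?_
  have := concatSeq_eq_getD hne σ h₂
  rw [List.getD_eq_getElem _ _ h₂] at this
  simpa [pre] using this

lemma concatSeq_mem {S : Set ℕ} (hne : ∀ i, w i ≠ []) (hS : ∀ i, ∀ b ∈ w i, b ∈ S)
    (σ : ℕ → Fin m) (n : ℕ) : concatSeq w σ n ∈ S := by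
  have h' : n < (flat w (pre σ (n + 1))).length :=
    lt_of_lt_of_le (by simp) (length_le_length_flat hne _)
  rw [concatSeq, ← List.getElem_eq_getD (h := h')]
  exact mem_of_mem_flat hS _ _ (List.getElem_mem _)

lemma concatSeq_add (hne : ∀ i, w i ≠ []) (σ : ℕ → Fin m) (n : ℕ) :
    concatSeq w σ (n + (w (σ 0)).length) = concatSeq w (fun k => σ (k + 1)) n := by
  have h' : n < (flat w (pre (fun k => σ (k + 1)) (n + 1))).length :=
    lt_of_lt_of_le (by simp) (length_le_length_flat hne _)
  have e : flat w (pre σ (n + 1 + 1)) = w (σ 0) ++ flat w (pre (fun k => σ (k + 1)) (n + 1)) := by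
    rw [pre_succ', flat_cons]
  rw [concatSeq_eq_getD hne σ (k := n + 1 + 1) (by rw [e, List.length_append]; omega), e,
    concatSeq, List.getD_eq_getElem?_getD, List.getD_eq_getElem?_getD,
    List.getElem?_append_right (by omega), Nat.add_sub_cancel]

lemma shift_iterate (n : ℕ) (ω : ℕ → ℕ) : shift^[n] ω = fun k => ω (k + n) := by
  induction n generalizing ω with
  | zero => rfl
  | succ n ih =>
    rw [Function.iterate_succ_apply, ih]
    funext k
    simp [shift, add_assoc]

lemma shift_iterate_concatSeq (hne : ∀ i, w i ≠ []) (σ : ℕ → Fin m) :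
    shift^[(w (σ 0)).length] (concatSeq w σ) = concatSeq w (fun k => σ (k + 1)) := by
  rw [shift_iterate]
  exact funext (concatSeq_add hne σ)

lemma measurable_pre_comp {β : Type*} [MeasurableSpace β] (f : List (Fin m) → β) (n : ℕ) :
    Measurable fun σ : ℕ → Fin m => f (pre σ n) := by
  have e : (fun σ : ℕ → Fin m => f (pre σ n)) =
      (fun x : Fin n → Fin m => f (List.ofFn x)) ∘ fun σ i => σ i := by
    funext σ
    simp only [Function.comp_apply]
    congr 1
    exact List.ext_getElem (by simp [pre]) (by simp [pre])
  rw [e]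
  exact (measurable_of_countable _).comp (measurable_pi_lambda _ fun i => measurable_pi_apply _)

lemma measurable_concatSeq : Measurable (concatSeq w) :=
  measurable_pi_lambda _ fun n => measurable_pre_comp (fun a => (flat w a).getD n 0) (n + 1)

lemma measurable_shift : Measurable shift :=
  measurable_pi_lambda _ fun n => measurable_pi_apply (n + 1)

end Concat

section Bernoulli

variable {m : ℕ} (q : Measure (Fin m))

/-- The Bernoulli measure on `(Fin m)^ℕ` with marginal `q`. -/
def bernoulli : Measure (ℕ → Fin m) := Measure.infinitePi fun _ => q

variable [IsProbabilityMeasure q]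

instance : IsProbabilityMeasure (bernoulli q) := by
  unfold bernoulli
  infer_instance

lemma measurePreserving_tail :
    MeasurePreserving (fun (σ : ℕ → Fin m) k => σ (k + 1)) (bernoulli q) (bernoulli q) where
  measurable := measurable_pi_lambda _ fun n => measurable_pi_apply (n + 1)
  map_eq := Measure.map_infinitePi_infinitePi_of_inj (P := fun _ : ℕ => q)
    (f := fun k : ℕ => k + 1) (add_left_injective 1)

lemma bernoulli_cylinder (a : List (Fin m)) :
    bernoulli q {σ | pre σ a.length = a} = (a.map fun i => q {i}).prod := by
  have e : {σ : ℕ → Fin m | pre σ a.length = a} =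
      (Finset.range a.length : Set ℕ).pi fun k => {i | a[k]? = some i} := by
    ext σ
    simp only [mem_ofPred_eq, Set.mem_pi, Finset.coe_range, mem_Iio]
    constructor
    · intro h k hk
      rw [← h]
      simp [pre, hk]
    · intro h
      refine List.ext_getElem (by simp) fun k h₁ h₂ => ?_
      have := h k h₂
      rw [List.getElem?_eq_getElem h₂, Option.some_inj] at this
      simp [pre, this]
  rw [e, bernoulli, Measure.infinitePi_pi _ fun _ _ => MeasurableSet.of_discrete]
  clear e
  induction a with
  | nil => simp
  | cons i a ih =>
    rw [List.length_cons, Finset.prod_range_succ']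
    simp only [List.getElem?_cons_succ, ih, List.getElem?_cons_zero, Option.some_inj,
      List.map_cons, List.prod_cons]
    rw [mul_comm]
    congr 2
    ext j
    simp [eq_comm]

lemma bernoulli_eq_zero_or_one {B : Set (ℕ → Fin m)} (hB : MeasurableSet B)
    (h : (fun (σ : ℕ → Fin m) k => σ (k + 1)) ⁻¹' B = B) :
    bernoulli q B = 0 ∨ bernoulli q B = 1 := by
  have hind : ProbabilityTheory.iIndep
      (fun n : ℕ => MeasurableSpace.comap (fun σ : ℕ → Fin m => σ n) inferInstance)
      (bernoulli q) :=
    ProbabilityTheory.iIndepFun_infinitePi (P := fun _ : ℕ => q) (X := fun _ i => i)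
      fun _ => measurable_id
  refine ProbabilityTheory.measure_zero_or_one_of_measurableSet_limsup_atTop
    (fun n => (measurable_pi_apply n).comap_le) hind ?_
  rw [limsup_eq_iInf_iSup_of_nat, MeasurableSpace.measurableSet_iInf]
  intro n
  have hn : (fun (σ : ℕ → Fin m) k => σ (k + n)) ⁻¹' B = B := by
    induction n with
    | zero => rfl
    | succ n ih =>
      conv_rhs => rw [← ih, ← h]
      ext σ
      simp only [mem_preimage, add_right_comm _ 1 n]
      rfl
  rw [← hn]
  have hT : Measurable[⨆ i ≥ n,
      MeasurableSpace.comap (fun σ : ℕ → Fin m => σ i) inferInstance]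
      (fun (σ : ℕ → Fin m) k => σ (k + n)) := by
    refine @measurable_pi_lambda _ _ _ (_) _ _ fun k => ?_
    exact (comap_measurable (fun σ : ℕ → Fin m => σ (k + n))).mono
      (le_iSup₂_of_le (k + n) (Nat.le_add_left n k) le_rfl) le_rfl
  exact hT hB

end Bernoulli

section Suspension

variable {m : ℕ} (q : Measure (Fin m)) (w : Fin m → List ℕ)

/-- The sum of the images of the Bernoulli measure under the maps `σ ↦ shift^j (concatSeq w σ)`,
`j < min L |w (σ 0)|`. For large `L` it is shift-invariant. -/
def orbitSum (L : ℕ) : Measure (ℕ → ℕ) :=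
  ∑ j ∈ Finset.range L, Measure.map (fun σ => shift^[j] (concatSeq w σ))
    ((bernoulli q).restrict {σ | j < (w (σ 0)).length})

variable {w}

lemma measurable_shift_iterate_concatSeq (j : ℕ) :
    Measurable fun σ => shift^[j] (concatSeq w σ) :=
  (measurable_shift.iterate j).comp measurable_concatSeq

lemma measurableSet_lt_length (j : ℕ) :
    MeasurableSet {σ : ℕ → Fin m | j < (w (σ 0)).length} := by
  have : {σ : ℕ → Fin m | j < (w (σ 0)).length} =
      (fun σ : ℕ → Fin m => σ 0) ⁻¹' {i | j < (w i).length} := rfl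
  rw [this]
  exact measurable_pi_apply 0 MeasurableSet.of_discrete

lemma orbitSum_apply {L : ℕ} {A : Set (ℕ → ℕ)} (hA : MeasurableSet A) :
    orbitSum q w L A = ∑ j ∈ Finset.range L,
      bernoulli q ((fun σ => shift^[j] (concatSeq w σ)) ⁻¹' A ∩ {σ | j < (w (σ 0)).length}) := by
  rw [orbitSum, Measure.finsetSum_apply]
  refine Finset.sum_congr rfl fun j _ => ?_
  rw [Measure.map_apply (measurable_shift_iterate_concatSeq j) hA,
    Measure.restrict_apply (measurable_shift_iterate_concatSeq j hA)]

lemma orbitSum_apply_eq_lintegral {L : ℕ} (hL : ∀ i, (w i).length ≤ L) {A : Set (ℕ → ℕ)}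
    (hA : MeasurableSet A) :
    orbitSum q w L A = ∫⁻ σ, ∑ j ∈ Finset.range (w (σ 0)).length,
      A.indicator (fun _ => (1 : ℝ≥0∞)) (shift^[j] (concatSeq w σ)) ∂bernoulli q := by
  have hm (j : ℕ) : MeasurableSet
      ((fun σ => shift^[j] (concatSeq w σ)) ⁻¹' A ∩ {σ | j < (w (σ 0)).length}) :=
    (measurable_shift_iterate_concatSeq j hA).inter (measurableSet_lt_length j)
  rw [orbitSum_apply q hA]
  simp_rw [← lintegral_indicator_one (hm _)]
  rw [← lintegral_finsetSum _ fun j _ => measurable_one.indicator (hm j)]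
  refine lintegral_congr fun σ => ?_
  rw [← Finset.sum_subset (Finset.range_mono (hL (σ 0)))]
  · refine Finset.sum_congr rfl fun j hj => ?_
    simp only [Finset.mem_range] at hj
    by_cases h : shift^[j] (concatSeq w σ) ∈ A <;> simp [Set.indicator, h, hj]
  · intro j _ hj
    simp only [Finset.mem_range] at hj
    simp [hj]

lemma bernoulli_preimage_concatSeq_le_orbitSum (hne : ∀ i, w i ≠ []) {L : ℕ} (hL : 0 < L)
    {A : Set (ℕ → ℕ)} (hA : MeasurableSet A) :
    bernoulli q (concatSeq w ⁻¹' A) ≤ orbitSum q w L A := by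
  rw [orbitSum_apply q hA]
  refine le_trans (le_of_eq ?_) (Finset.single_le_sum (fun _ _ => zero_le)
    (Finset.mem_range.2 hL))
  congr 1
  ext σ
  simpa using fun _ => List.length_pos_iff.2 (hne (σ 0))

lemma orbitSum_eq_zero {L : ℕ} {A : Set (ℕ → ℕ)} (hA : MeasurableSet A)
    (h : ∀ j, bernoulli q ((fun σ => shift^[j] (concatSeq w σ)) ⁻¹' A) = 0) :
    orbitSum q w L A = 0 := by
  rw [orbitSum_apply q hA]
  exact Finset.sum_eq_zero fun j _ => measure_mono_null inter_subset_left (h j)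

lemma preimage_shift_iterate {A : Set (ℕ → ℕ)} (h : shift ⁻¹' A = A) (j : ℕ) :
    shift^[j] ⁻¹' A = A :=
  Function.IsFixedPt.preimage_iterate h j

variable [IsProbabilityMeasure q]

lemma orbitSum_preimage_shift (hne : ∀ i, w i ≠ []) {L : ℕ} (hL : ∀ i, (w i).length ≤ L)
    {A : Set (ℕ → ℕ)} (hA : MeasurableSet A) :
    orbitSum q w L (shift ⁻¹' A) = orbitSum q w L A := by
  set f : (ℕ → ℕ) → ℝ≥0∞ := A.indicator fun _ => 1 with hf
  have hfm : Measurable f := measurable_const.indicator hA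
  have hc : Measurable fun σ => f (concatSeq w σ) := hfm.comp measurable_concatSeq
  have hc' : Measurable fun σ : ℕ → Fin m => f (concatSeq w fun k => σ (k + 1)) :=
    hc.comp (measurePreserving_tail q).measurable
  have hfin : ∫⁻ σ, f (concatSeq w σ) ∂bernoulli q ≠ ⊤ := by
    refine ne_top_of_le_ne_top (b := 1) (by simp) ?_
    calc ∫⁻ σ, f (concatSeq w σ) ∂bernoulli q ≤ ∫⁻ _, 1 ∂bernoulli q :=
          lintegral_mono fun σ => Set.indicator_le_self _ _ _
      _ = 1 := by simp
  have hinv : ∫⁻ σ, f (concatSeq w fun k => σ (k + 1)) ∂bernoulli q =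
      ∫⁻ σ, f (concatSeq w σ) ∂bernoulli q :=
    (measurePreserving_tail q).lintegral_comp hc
  rw [orbitSum_apply_eq_lintegral q hL hA,
    orbitSum_apply_eq_lintegral q hL (measurable_shift hA)]
  refine (ENNReal.add_left_inj hfin).1 ?_
  conv_rhs => rw [← hinv]
  rw [← lintegral_add_right _ hc, ← lintegral_add_right _ hc']
  refine lintegral_congr fun σ => ?_
  rw [← shift_iterate_concatSeq hne σ,
    ← Finset.sum_range_succ (fun j => f (shift^[j] (concatSeq w σ))),
    Finset.sum_range_succ' (fun j => f (shift^[j] (concatSeq w σ)))]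
  congr 1
  refine Finset.sum_congr rfl fun j _ => ?_
  rw [Function.iterate_succ_apply']
  rfl

lemma preErgodic_orbitSum (hne : ∀ i, w i ≠ []) (L : ℕ) : PreErgodic shift (orbitSum q w L) where
  aeconst_set A hA h := by
    have key (B : Set (ℕ → ℕ)) (hB : MeasurableSet B) (h : shift ⁻¹' B = B)
        (h0 : bernoulli q (concatSeq w ⁻¹' B) = 0) : orbitSum q w L B = 0 := by
      refine orbitSum_eq_zero q hB fun j => ?_
      have e : (fun σ => shift^[j] (concatSeq w σ)) ⁻¹' B =
          concatSeq w ⁻¹' (shift^[j] ⁻¹' B) := rfl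
      rw [e, preimage_shift_iterate h, h0]
    have hT : (fun (σ : ℕ → Fin m) k => σ (k + 1)) ⁻¹' (concatSeq w ⁻¹' A) =
        concatSeq w ⁻¹' A := by
      ext σ
      simp only [mem_preimage]
      rw [← shift_iterate_concatSeq hne σ, ← mem_preimage, preimage_shift_iterate h]
    have hcA : MeasurableSet (concatSeq w ⁻¹' A) := measurable_concatSeq hA
    rw [eventuallyConst_set', ae_eq_empty, ae_eq_univ]
    rcases bernoulli_eq_zero_or_one q hcA hT with h0 | h1
    · exact Or.inl (key A hA h h0)
    · refine Or.inr (key Aᶜ hA.compl (by rw [preimage_compl, h]) ?_)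
      rw [preimage_compl, prob_compl_eq_zero_iff hcA, h1]

variable (w) in
/-- The distribution of a concatenation of independent random words is absolutely continuous with
respect to an ergodic shift-invariant probability measure carried by the letters of the words. -/
lemma exists_ergodic (hne : ∀ i, w i ≠ []) :
    ∃ ν : Measure (ℕ → ℕ), IsProbabilityMeasure ν ∧ Ergodic shift ν ∧
      (∀ S : Set ℕ, (∀ i, ∀ b ∈ w i, b ∈ S) → ∀ᵐ ω ∂ν, ∀ k, ω k ∈ S) ∧
      ∀ A, MeasurableSet A → ν A = 0 → bernoulli q (concatSeq w ⁻¹' A) = 0 := by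
  set L := 1 + ∑ i, (w i).length with hLdef
  have hL : ∀ i, (w i).length ≤ L := fun i =>
    (Finset.single_le_sum (f := fun i => (w i).length) (fun _ _ => Nat.zero_le _)
      (Finset.mem_univ i)).trans (Nat.le_add_left _ _)
  have hL0 : 0 < L := by omega
  have hone : 1 ≤ orbitSum q w L univ := by
    simpa using bernoulli_preimage_concatSeq_le_orbitSum q hne hL0 MeasurableSet.univ
  have htop : orbitSum q w L univ ≠ ⊤ := by
    rw [orbitSum_apply q MeasurableSet.univ]
    exact (ENNReal.sum_lt_top.2 fun j _ => measure_lt_top _ _).ne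
  have h0 : orbitSum q w L univ ≠ 0 := (zero_lt_one.trans_le hone).ne'
  have hc0 : (orbitSum q w L univ)⁻¹ ≠ 0 := ENNReal.inv_ne_zero.2 htop
  refine ⟨(orbitSum q w L univ)⁻¹ • orbitSum q w L, ⟨?_⟩, ⟨⟨measurable_shift, ?_⟩,
    (preErgodic_orbitSum q hne L).smul_measure _⟩, fun S hS => ?_, fun A hA hνA => ?_⟩
  · rw [Measure.smul_apply, smul_eq_mul, ENNReal.inv_mul_cancel h0 htop]
  · rw [Measure.map_smul]
    congr 1
    ext A hA
    rw [Measure.map_apply measurable_shift hA, orbitSum_preimage_shift q hne hL hA]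
  · refine Measure.ae_smul_measure ?_ _
    have hP : MeasurableSet {ω : ℕ → ℕ | ∀ k, ω k ∈ S} := by
      have : {ω : ℕ → ℕ | ∀ k, ω k ∈ S} = Set.univ.pi fun _ => S := by ext; simp
      rw [this]
      exact MeasurableSet.univ_pi fun _ => MeasurableSet.of_discrete
    refine mem_ae_iff.2 (orbitSum_eq_zero q hP.compl fun j => ?_)
    have : (fun σ => shift^[j] (concatSeq w σ)) ⁻¹' {ω : ℕ → ℕ | ∀ k, ω k ∈ S}ᶜ = ∅ := by
      ext σ
      simp only [shift_iterate, mem_preimage, mem_compl_iff, mem_ofPred_eq, mem_empty_iff_false,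
        iff_false, not_not]
      exact fun k => concatSeq_mem hne hS σ _
    rw [this, measure_empty]
  · rw [Measure.smul_apply, smul_eq_mul, mul_eq_zero, or_iff_right hc0] at hνA
    exact le_antisymm
      ((bernoulli_preimage_concatSeq_le_orbitSum q hne hL0 hA).trans hνA.le) zero_le

end Suspension

lemma coe_le_dimH_of_measure_Icc_le {μ : Measure ℝ} {D : ℝ} (hD : 0 < D) {s : ℝ≥0}
    (h : ∀ x r : ℝ, 0 < r → r < 1 → μ (Icc (x - r) (x + r)) ≤ ENNReal.ofReal (D * r ^ (s : ℝ)))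
    {A : Set ℝ} (hA : μ A ≠ 0) : (s : ℝ≥0∞) ≤ dimH A := by
  have hD0 : ENNReal.ofReal D ≠ 0 := (ENNReal.ofReal_pos.2 hD).ne'
  have key : (ENNReal.ofReal D)⁻¹ • μ ≤ μH[(s : ℝ)] := by
    refine Measure.le_hausdorffMeasure _ _ (ENNReal.ofReal (1 / 2))
      (ENNReal.ofReal_pos.2 (by norm_num)) fun S hS => ?_
    rcases S.eq_empty_or_nonempty with rfl | ⟨x, hx⟩
    · simp
    have hfin : Metric.ediam S ≠ ⊤ := ne_top_of_le_ne_top ENNReal.ofReal_ne_top hS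
    have hb : Bornology.IsBounded S := Metric.isBounded_iff_ediam_ne_top.2 hfin
    have hd : Metric.diam S ≤ 1 / 2 := ENNReal.toReal_le_of_le_ofReal (by norm_num) hS
    have hle : μ S ≤ ENNReal.ofReal (D * Metric.diam S ^ (s : ℝ)) := by
      have hc : Tendsto (fun r : ℝ => ENNReal.ofReal (D * r ^ (s : ℝ))) (𝓝[>] Metric.diam S)
          (𝓝 (ENNReal.ofReal (D * Metric.diam S ^ (s : ℝ)))) := by
        refine (ENNReal.continuous_ofReal.tendsto _).comp ?_
        exact (((Real.continuous_rpow_const s.coe_nonneg).tendsto _).const_mul D).mono_left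
          nhdsWithin_le_nhds
      refine ge_of_tendsto hc ?_
      filter_upwards [Ioo_mem_nhdsGT (show Metric.diam S < 1 by linarith)] with r hr
      refine le_trans (measure_mono fun y hy => ?_)
        (h x r (Metric.diam_nonneg.trans_lt hr.1) hr.2)
      have := (Metric.dist_le_diam_of_mem hb hy hx).trans hr.1.le
      rw [Real.dist_eq, abs_le] at this
      exact ⟨by linarith, by linarith⟩
    rw [Measure.smul_apply, smul_eq_mul]
    have e : Metric.ediam S = ENNReal.ofReal (Metric.diam S) :=
      (ENNReal.ofReal_toReal hfin).symm
    rw [e, ENNReal.ofReal_rpow_of_nonneg Metric.diam_nonneg s.coe_nonneg]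
    rw [ENNReal.ofReal_mul hD.le] at hle
    calc (ENNReal.ofReal D)⁻¹ * μ S
        ≤ (ENNReal.ofReal D)⁻¹ * (ENNReal.ofReal D *
            ENNReal.ofReal (Metric.diam S ^ (s : ℝ))) := by gcongr
      _ = _ := by
          rw [← mul_assoc, ENNReal.inv_mul_cancel hD0 ENNReal.ofReal_ne_top, one_mul]
  refine le_dimH_of_hausdorffMeasure_ne_zero fun h0 => hA ?_
  have := key A
  rw [h0, Measure.smul_apply, smul_eq_mul, nonpos_iff_eq_zero, mul_eq_zero] at this
  exact this.resolve_left (ENNReal.inv_ne_zero.2 ENNReal.ofReal_ne_top)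

section Frostman

variable {m : ℕ} {w : Fin m → List ℕ}

lemma len_flat_mul_le (hR : ∀ i, ∀ b ∈ w i, b ∈ Reg Φ) (hG : ∀ i, Good Φ (w i))
    (a : List (Fin m)) {v : List ℕ} (hv : ∀ b ∈ v, b ∈ Φ.I) :
    len Φ (flat w a) * len Φ v ≤ Φ.distC * len Φ (flat w a ++ v) := by
  rcases List.eq_nil_or_concat a with rfl | ⟨a, i, rfl⟩
  · simpa using le_mul_of_one_le_left (len_nonneg v) Φ.distC_ge_one
  · have : Good Φ (flat w (a.concat i)) := by simpa using (hG i).append (flat w a)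
    exact this.len_mul_len_le (fun b hb => (mem_of_mem_flat hR _ b hb).1) hv

lemma tendsto_len_flat_pre (hR : ∀ i, ∀ b ∈ w i, b ∈ Reg Φ) (hG : ∀ i, Good Φ (w i))
    (σ : ℕ → Fin m) : Tendsto (fun k => len Φ (flat w (pre σ k))) atTop (𝓝 0) := by
  have hne : ∀ i, w i ≠ [] := fun i => (hG i).ne_nil
  have hlen : Tendsto (fun k => (flat w (pre σ k)).length) atTop atTop :=
    tendsto_atTop_mono (fun k => by simpa using length_le_length_flat hne (pre σ k)) tendsto_id
  have h1 : ∃ᶠ n in atTop, Good Φ (pre (concatSeq w σ) n) := by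
    refine hlen.frequently (Eventually.frequently ?_)
    filter_upwards [eventually_ge_atTop 1] with k hk
    obtain ⟨k, rfl⟩ := Nat.exists_eq_add_of_le' hk
    rw [pre_concatSeq hne, pre_succ]
    simpa using (hG (σ k)).append (flat w (pre σ k))
  have := (tendsto_len_pre (concatSeq_mem hne hR σ) h1).comp hlen
  refine this.congr fun k => ?_
  rw [Function.comp_apply, pre_concatSeq hne]

lemma bernoulli_cylinder_le {q : Measure (Fin m)} [IsProbabilityMeasure q] {s : ℝ≥0}
    (hR : ∀ i, ∀ b ∈ w i, b ∈ Reg Φ) (hG : ∀ i, Good Φ (w i))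
    (hq : ∀ i, q {i} ≤ ENNReal.ofReal ((len Φ (w i) / Φ.distC) ^ (s : ℝ)))
    (a : List (Fin m)) :
    bernoulli q {σ | pre σ a.length = a} ≤ ENNReal.ofReal (len Φ (flat w a) ^ (s : ℝ)) := by
  have hC : 0 < Φ.distC := zero_lt_one.trans_le Φ.distC_ge_one
  rw [bernoulli_cylinder]
  induction a with
  | nil => simp
  | cons i a ih =>
    rw [List.map_cons, List.prod_cons, flat_cons]
    refine (mul_le_mul' (hq i) ih).trans ?_
    have h0 : 0 ≤ len Φ (w i) / Φ.distC := div_nonneg (len_nonneg _) hC.le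
    rw [← ENNReal.ofReal_mul (by positivity), ← Real.mul_rpow h0 (len_nonneg _)]
    refine ENNReal.ofReal_le_ofReal
      (Real.rpow_le_rpow (mul_nonneg h0 (len_nonneg _)) ?_ s.coe_nonneg)
    rw [div_mul_eq_mul_div, div_le_iff₀ hC, mul_comm _ Φ.distC]
    exact (hG i).len_mul_len_le (fun b hb => (hR i b hb).1)
      fun b hb => (mem_of_mem_flat hR a b hb).1

/-- The words `a` such that the interval of `flat w a` has length at most `r`, is maximal with this
property, and contains a point with a `concatSeq` address at distance at most `r` from `x`. -/
def stopWords (Φ : PIFS) (Pi : (ℕ → ℕ) → ℝ) (w : Fin m → List ℕ) (x r : ℝ) :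
    Set (List (Fin m)) :=
  {a | ∃ σ k, a = pre σ k ∧ len Φ (flat w a) ≤ r ∧ (∀ j < k, r < len Φ (flat w (pre σ j))) ∧
    Pi (concatSeq w σ) ∈ Icc (x - r) (x + r)}

lemma exists_mem_stopWords {Pi : (ℕ → ℕ) → ℝ} (hR : ∀ i, ∀ b ∈ w i, b ∈ Reg Φ)
    (hG : ∀ i, Good Φ (w i)) {x r : ℝ} (hr : 0 < r) {σ : ℕ → Fin m}
    (hσ : Pi (concatSeq w σ) ∈ Icc (x - r) (x + r)) :
    ∃ a ∈ stopWords Φ Pi w x r, pre σ a.length = a := by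
  have h : ∃ k, len Φ (flat w (pre σ k)) ≤ r :=
    ((tendsto_len_flat_pre hR hG σ).eventually (eventually_le_nhds hr)).exists
  exact ⟨pre σ (Nat.find h), ⟨σ, Nat.find h, rfl, Nat.find_spec h,
    fun j hj => not_le.1 (Nat.find_min h hj), hσ⟩, by simp⟩

lemma card_mul_le_of_subset_stopWords {Pi : (ℕ → ℕ) → ℝ} (hPi : IsAddressMap Φ Pi)
    (hR : ∀ i, ∀ b ∈ w i, b ∈ Reg Φ) (hG : ∀ i, Good Φ (w i))
    (hp : ∀ i j, w i <+: w j → i = j) {δ : ℝ} (hδ : ∀ i, δ ≤ len Φ (w i)) {x r : ℝ}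
    (hr : 0 < r) (hr1 : r < 1) {T : Finset (List (Fin m))} (hT : ↑T ⊆ stopWords Φ Pi w x r) :
    T.card * δ ≤ 4 * Φ.distC := by
  have hC : 0 < Φ.distC := zero_lt_one.trans_le Φ.distC_ge_one
  have hne : ∀ i, w i ≠ [] := fun i => (hG i).ne_nil
  have hpre : ∀ a ∈ T, ∀ b ∈ T, flat w a <+: flat w b → a = b := by
    intro a ha b hb hab
    obtain ⟨σ, k, rfl, hk, -, -⟩ := hT ha
    obtain ⟨σ', k', rfl, -, hk', -⟩ := hT hb
    have h1 := isPrefix_of_flat_isPrefix hne hp _ _ hab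
    have h2 := eq_pre_of_isPrefix h1
    rw [length_pre] at h2
    refine h1.eq_of_length_le ?_
    rw [length_pre, length_pre]
    by_contra! hlt
    have := hk' k hlt
    rw [← h2] at this
    exact absurd hk (not_le.2 this)
  have hlow : ∀ a ∈ T, r * δ ≤ Φ.distC * len Φ (flat w a) := by
    intro a ha
    obtain ⟨σ, k, rfl, hk, hk', -⟩ := hT ha
    rcases k with _ | k
    · have : len Φ (flat w (pre σ 0)) = 1 := by simp [pre]
      linarith
    · have h1 := len_flat_mul_le hR hG (pre σ k) fun b hb => (hR (σ k) b hb).1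
      have e : flat w (pre σ (k + 1)) = flat w (pre σ k) ++ w (σ k) := by simp [pre_succ]
      rw [e]
      refine le_trans ?_ h1
      exact (mul_le_mul_of_nonneg_left (hδ _) hr.le).trans
        (mul_le_mul_of_nonneg_right (hk' k (Nat.lt_succ_self k)).le (len_nonneg _))
  have hsum : ∑ u ∈ T.image (flat w), len Φ u ≤ (x + 2 * r) - (x - 2 * r) := by
    refine sum_len_le (fun u hu => ?_) (fun u hu v hv huv => ?_) (by linarith) fun u hu => ?_
    · obtain ⟨a, -, rfl⟩ := Finset.mem_image.1 hu
      exact mem_of_mem_flat hR a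
    · obtain ⟨a, ha, rfl⟩ := Finset.mem_image.1 hu
      obtain ⟨b, hb, rfl⟩ := Finset.mem_image.1 hv
      rw [hpre a ha b hb huv]
    · obtain ⟨a, ha, rfl⟩ := Finset.mem_image.1 hu
      obtain ⟨σ, k, rfl, hk, -, hσ⟩ := hT ha
      rintro _ ⟨y, hy, rfl⟩
      obtain ⟨z, hz, hzPi⟩ := hPi (concatSeq w σ) (fun n => (concatSeq_mem hne hR σ n).1)
        (flat w (pre σ k)).length
      rw [comp_eq_wcomp_pre, pre_concatSeq hne] at hzPi
      rw [← hzPi] at hσ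
      have := (abs_sub_le_len (mem_of_mem_flat hR (pre σ k)) (Ioo_subset_Icc_self hy) hz).trans hk
      rw [abs_le] at this
      exact ⟨by linarith [hσ.1], by linarith [hσ.2]⟩
  rw [Finset.sum_image fun a ha b hb hab => hpre a ha b hb (by rw [hab])] at hsum
  have h3 : (T.card : ℝ) * (r * δ) ≤ Φ.distC * (4 * r) := by
    calc (T.card : ℝ) * (r * δ) = ∑ a ∈ T, r * δ := by simp
      _ ≤ ∑ a ∈ T, Φ.distC * len Φ (flat w a) := Finset.sum_le_sum hlow
      _ = Φ.distC * ∑ a ∈ T, len Φ (flat w a) := by rw [Finset.mul_sum]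
      _ ≤ _ := mul_le_mul_of_nonneg_left (by linarith) hC.le
  nlinarith

lemma bernoulli_preimage_Icc_le {q : Measure (Fin m)} [IsProbabilityMeasure q] {s : ℝ≥0}
    {Pi : (ℕ → ℕ) → ℝ} (hPi : IsAddressMap Φ Pi)
    (hR : ∀ i, ∀ b ∈ w i, b ∈ Reg Φ) (hG : ∀ i, Good Φ (w i))
    (hp : ∀ i j, w i <+: w j → i = j)
    (hq : ∀ i, q {i} ≤ ENNReal.ofReal ((len Φ (w i) / Φ.distC) ^ (s : ℝ)))
    {δ : ℝ} (hδ0 : 0 < δ) (hδ : ∀ i, δ ≤ len Φ (w i)) {x r : ℝ} (hr : 0 < r) (hr1 : r < 1) :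
    bernoulli q {σ | Pi (concatSeq w σ) ∈ Icc (x - r) (x + r)} ≤
      ENNReal.ofReal (4 * Φ.distC / δ * r ^ (s : ℝ)) := by
  have hcard {T : Finset (List (Fin m))} (hT : ↑T ⊆ stopWords Φ Pi w x r) :
      (T.card : ℝ) ≤ 4 * Φ.distC / δ := by
    rw [le_div_iff₀ hδ0]
    exact card_mul_le_of_subset_stopWords hPi hR hG hp hδ hr hr1 hT
  have hfin : (stopWords Φ Pi w x r).Finite := by
    by_contra hinf
    obtain ⟨T, hT, hc⟩ := Set.Infinite.exists_subset_card_eq hinf (⌊4 * Φ.distC / δ⌋₊ + 1)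
    have := hcard hT
    rw [hc] at this
    push_cast at this
    linarith [Nat.lt_floor_add_one (4 * Φ.distC / δ)]
  calc bernoulli q {σ | Pi (concatSeq w σ) ∈ Icc (x - r) (x + r)}
      ≤ bernoulli q (⋃ a ∈ hfin.toFinset, {σ | pre σ a.length = a}) := by
        refine measure_mono fun σ hσ => ?_
        obtain ⟨a, ha, h⟩ := exists_mem_stopWords hR hG hr hσ
        exact mem_biUnion (hfin.mem_toFinset.2 ha) h
    _ ≤ ∑ a ∈ hfin.toFinset, bernoulli q {σ | pre σ a.length = a} :=
        measure_biUnion_finset_le _ _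
    _ ≤ ∑ a ∈ hfin.toFinset, ENNReal.ofReal (r ^ (s : ℝ)) := by
        refine Finset.sum_le_sum fun a ha => ?_
        refine (bernoulli_cylinder_le hR hG hq a).trans (ENNReal.ofReal_le_ofReal ?_)
        obtain ⟨σ, k, rfl, hk, -, -⟩ := hfin.mem_toFinset.1 ha
        exact Real.rpow_le_rpow (len_nonneg _) hk s.coe_nonneg
    _ = ENNReal.ofReal (hfin.toFinset.card * r ^ (s : ℝ)) := by
        rw [Finset.sum_const, nsmul_eq_mul, ENNReal.ofReal_mul (Nat.cast_nonneg _),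
          ENNReal.ofReal_natCast]
    _ ≤ _ := ENNReal.ofReal_le_ofReal
        (mul_le_mul_of_nonneg_right (hcard (by simp)) (Real.rpow_nonneg hr.le _))

end Frostman

lemma exists_neg_log_deriv_le {i : ℕ} (hi : i ∈ Reg Φ) :
    ∃ B : ℝ, ∀ x ∈ Icc (0 : ℝ) 1, -Real.log |deriv (Φ.φ i) x| ≤ B := by
  have hc : ContinuousOn (fun x => -Real.log |deriv (Φ.φ i) x|) (Icc 0 1) :=
    (ContinuousOn.log ((Φ.smooth i hi.1).continuous_deriv le_rfl).abs.continuousOn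
      fun x hx => abs_ne_zero.2 (hi.2 x hx)).neg
  obtain ⟨B, hB⟩ := (isCompact_Icc.image_of_continuousOn hc).bddAbove
  exact ⟨B, fun x hx => hB (mem_image_of_mem _ hx)⟩

lemma IsAddressMap.mem_Icc {Pi : (ℕ → ℕ) → ℝ} (hPi : IsAddressMap Φ Pi) {ω : ℕ → ℕ}
    (hω : ω ∈ Φ.Seqs) : Pi ω ∈ Icc (0 : ℝ) 1 := by
  simpa [comp] using hPi ω hω 0

lemma lyap_lt_top {Pi : (ℕ → ℕ) → ℝ} (hPi : IsAddressMap Φ Pi) {ν : Measure (ℕ → ℕ)}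
    [IsFiniteMeasure ν] {D : Set ℕ} (hD : D.Finite) (hDR : D ⊆ Reg Φ)
    (hν : ∀ᵐ ω ∂ν, ∀ k, ω k ∈ D) : lyap Φ Pi ν < ⊤ := by
  have h (i : ℕ) : ∃ B : ℝ, i ∈ D → ∀ x ∈ Icc (0 : ℝ) 1, -Real.log |deriv (Φ.φ i) x| ≤ B := by
    by_cases hi : i ∈ D
    · obtain ⟨B, hB⟩ := exists_neg_log_deriv_le (hDR hi)
      exact ⟨B, fun _ => hB⟩
    · exact ⟨0, fun h => absurd h hi⟩
  choose B hB using h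
  obtain ⟨M, hM⟩ := (hD.image B).bddAbove
  calc lyap Φ Pi ν ≤ ∫⁻ _, ENNReal.ofReal M ∂ν := by
        refine lintegral_mono_ae ?_
        filter_upwards [hν] with ω hω
        refine ENNReal.ofReal_le_ofReal ((hB (ω 0) (hω 0) _ ?_).trans
          (hM (mem_image_of_mem _ (hω 0))))
        exact hPi.mem_Icc fun k => (hDR (hω k)).1
    _ < ⊤ := by
        rw [lintegral_const]
        exact ENNReal.mul_lt_top ENNReal.ofReal_lt_top (measure_lt_top _ _)

lemma exists_prob_le {m : ℕ} {l : Fin m → ℝ} (hl : ∀ i, 0 < l i) {C : ℝ} (hC : 0 < C) {s : ℝ}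
    (hs : C ^ s < ∑ i, l i ^ s) :
    ∃ q : Measure (Fin m), IsProbabilityMeasure q ∧
      ∀ i, q {i} ≤ ENNReal.ofReal ((l i / C) ^ s) := by
  have hCs : 0 < C ^ s := Real.rpow_pos_of_pos hC s
  have hZ : 0 < ∑ i, l i ^ s := hCs.trans hs
  have hl' (i : Fin m) : 0 ≤ l i ^ s := Real.rpow_nonneg (hl i).le s
  have h1 : ∑ i, ENNReal.ofReal (l i ^ s / ∑ j, l j ^ s) = 1 := by
    rw [← ENNReal.ofReal_sum_of_nonneg fun i _ => div_nonneg (hl' i) hZ.le, ← Finset.sum_div,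
      div_self hZ.ne', ENNReal.ofReal_one]
  refine ⟨(PMF.ofFintype _ h1).toMeasure, inferInstance, fun i => ?_⟩
  rw [PMF.toMeasure_apply_singleton _ _ (measurableSet_singleton i), PMF.ofFintype_apply,
    Real.div_rpow (hl i).le hC.le]
  exact ENNReal.ofReal_le_ofReal (div_le_div_of_nonneg_left (hl' i) hCs hs.le)

lemma exists_mem_measClass {M : ℝ} (hM : LogLip Φ M) {Pi : (ℕ → ℕ) → ℝ} (hPiMeas : Measurable Pi)
    (hPi : IsAddressMap Φ Pi) {s : ℝ≥0} (hs : (s : ℝ≥0∞) < dimH (limitSet Φ Pi)) :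
    ∃ ν ∈ MeasClass Φ Pi, (s : ℝ≥0∞) ≤ mdim (Measure.map Pi ν) := by
  have hC : 0 < Φ.distC := zero_lt_one.trans_le Φ.distC_ge_one
  obtain ⟨F, hFR, hFG, hFp, hFs⟩ :=
    exists_finset_words hM hPi hs (NNReal.mk (Φ.distC ^ (s : ℝ)) (Real.rpow_nonneg hC.le _))
  rw [NNReal.coe_mk] at hFs
  set w : Fin F.card → List ℕ := fun i => F.equivFin.symm i with hw
  have hwF : ∀ i, w i ∈ F := fun i => (F.equivFin.symm i).2
  have hR : ∀ i, ∀ b ∈ w i, b ∈ Reg Φ := fun i => hFR _ (hwF i)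
  have hG : ∀ i, Good Φ (w i) := fun i => hFG _ (hwF i)
  have hne : ∀ i, w i ≠ [] := fun i => (hG i).ne_nil
  have hp : ∀ i j, w i <+: w j → i = j := fun i j h =>
    F.equivFin.symm.injective (Subtype.ext (hFp _ (hwF i) _ (hwF j) h))
  have hsum : ∑ i, len Φ (w i) ^ (s : ℝ) = ∑ u ∈ F, len Φ u ^ (s : ℝ) := by
    rw [← Finset.sum_coe_sort F]
    exact F.equivFin.symm.sum_comp fun u : F => len Φ (u : List ℕ) ^ (s : ℝ)
  obtain ⟨q, hqprob, hq⟩ := exists_prob_le (l := fun i => len Φ (w i))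
    (fun i => len_pos (hR i)) hC (hFs.trans_eq hsum.symm)
  have hFne : F.Nonempty := by
    by_contra hF
    rw [Finset.not_nonempty_iff_eq_empty.1 hF, Finset.sum_empty] at hFs
    exact absurd hFs (not_lt.2 (Real.rpow_nonneg hC.le _))
  obtain ⟨u, huF, hu⟩ := F.exists_min_image (len Φ) hFne
  obtain ⟨ν, hνprob, hνerg, hνS, hνac⟩ := exists_ergodic q w hne
  have hD := hνS {b | ∃ i, b ∈ w i} fun i b hb => ⟨i, hb⟩
  have hDfin : {b | ∃ i, b ∈ w i}.Finite := by
    have : {b | ∃ i, b ∈ w i} = ⋃ i, {b | b ∈ w i} := by ext; simp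
    rw [this]
    exact finite_iUnion fun i => List.finite_toSet (w i)
  have hDR : {b | ∃ i, b ∈ w i} ⊆ Reg Φ := fun b ⟨i, hb⟩ => hR i b hb
  refine ⟨ν, ⟨hνprob, ?_, hνerg, lyap_lt_top hPi hDfin hDR hD⟩, ?_⟩
  · refine (measure_congr (ae_eq_univ.2 ?_)).trans measure_univ
    exact mem_ae_iff.1 (hD.mono fun ω hω k => (hDR (hω k)).1)
  · refine le_iInf fun A => le_iInf fun _ => le_iInf fun hA => ?_
    have hcc : Measurable fun σ => Pi (concatSeq w σ) := hPiMeas.comp measurable_concatSeq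
    refine coe_le_dimH_of_measure_Icc_le
      (μ := Measure.map (fun σ => Pi (concatSeq w σ)) (bernoulli q))
      (D := 4 * Φ.distC / len Φ u) (div_pos (by linarith) (len_pos (hFR u huF)))
      (fun x r hr hr1 => ?_) fun h0 => ?_
    · rw [Measure.map_apply hcc measurableSet_Icc]
      exact bernoulli_preimage_Icc_le hPi hR hG hp hq (len_pos (hFR u huF))
        (fun i => hu _ (hwF i)) hr hr1
    · obtain ⟨B, hAB, hB, hB0⟩ := exists_measurable_superset_of_null h0
      rw [Measure.map_apply hcc hB] at hB0
      have hνB : ν (Pi ⁻¹' B) = 1 := by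
        rw [← Measure.map_apply hPiMeas hB]
        have := Measure.isProbabilityMeasure_map (μ := ν) hPiMeas.aemeasurable
        exact le_antisymm prob_le_one (hA.symm.trans_le (measure_mono hAB))
      have h2 := hνac _ (hPiMeas hB).compl ((prob_compl_eq_zero_iff (hPiMeas hB)).2 hνB)
      rw [preimage_compl, prob_compl_eq_zero_iff (measurable_concatSeq (hPiMeas hB))] at h2
      exact zero_ne_one (hB0.symm.trans h2)

lemma mdim_map_le_dimH_limitSet {Pi : (ℕ → ℕ) → ℝ} (hPiMeas : Measurable Pi)
    (hPi : IsAddressMap Φ Pi) {ν : Measure (ℕ → ℕ)} (hν : ν ∈ MeasClass Φ Pi) :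
    mdim (Measure.map Pi ν) ≤ dimH (limitSet Φ Pi) := by
  have hprob : IsProbabilityMeasure ν := hν.1
  have := Measure.isProbabilityMeasure_map (μ := ν) hPiMeas.aemeasurable
  refine iInf_le_of_le (limitSet Φ Pi) (iInf_le_of_le ?_ (iInf_le _ ?_))
  · rintro _ ⟨ω, hω, rfl⟩
    exact hPi.mem_Icc hω
  · refine le_antisymm prob_le_one ?_
    calc 1 = ν Φ.Seqs := hν.2.1.symm
      _ ≤ ν (Pi ⁻¹' limitSet Φ Pi) := measure_mono fun ω hω => mem_image_of_mem _ hω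
      _ ≤ _ := Measure.le_map_apply hPiMeas.aemeasurable _

lemma satB1_of_logLip {M : ℝ} (hM : LogLip Φ M) {Pi : (ℕ → ℕ) → ℝ} (hPiMeas : Measurable Pi)
    (hPi : IsAddressMap Φ Pi) : SatB1 Φ Pi := by
  refine le_antisymm (ENNReal.le_of_forall_nnreal_lt fun s hs => ?_)
    (iSup₂_le fun ν hν => mdim_map_le_dimH_limitSet hPiMeas hPi hν)
  obtain ⟨ν, hν, h⟩ := exists_mem_measClass hM hPiMeas hPi hs
  exact h.trans (le_iSup₂_of_le ν hν le_rfl)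

end

/-- **Proposition.** An infinite parabolic IFS whose maps are `C²` with
`sup_i max_x |(log |φ_i'|)'(x)| < ∞` satisfies (B1) and (B2). -/
theorem satB1_mildB2_of_bounded_log_deriv (Φ : PIFS) (hI : Φ.I.Infinite)
    (hC2 : ∀ i ∈ Φ.I, ContDiff ℝ 2 (Φ.φ i))
    (hbd : ∃ M : ℝ, ∀ i ∈ Φ.I, ∀ x ∈ Icc (0:ℝ) 1,
      |deriv (fun t => Real.log |deriv (Φ.φ i) t|) x| ≤ M)
    (Pi : (ℕ → ℕ) → ℝ) (hPiMeas : Measurable Pi) (hPi : IsAddressMap Φ Pi) :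
    SatB1 Φ Pi ∧ MildB2 Φ := by
  obtain ⟨M, hM⟩ := hbd
  obtain ⟨i, hi⟩ := hI.nonempty
  have hM0 : 0 ≤ M := (abs_nonneg _).trans (hM i hi 0 (left_mem_Icc.2 zero_le_one))
  have hlog : LogLip Φ M := logLip_of_bounded hC2 hM
  exact ⟨satB1_of_logLip hlog hPiMeas hPi, mildB2_of_logLip hM0 hlog⟩

end

end ParabolicIFSPaper
end

section
/- Let f : [0,1) → ℝ be a C² map with f(0) = 0, f'(0) = 1, and f'(x) > 1 for all x ∈ (0,1). Let q₀ = 1 and let q_{i+1} ∈ [0,1) satisfy f(q_{i+1}) = q_i for each i ≥ 0 (assuming such backward orbit points exist), and set J_i = [q_{i+1}, q_i). Then there exists a constant C > 0 such that for every n ∈ ℕ and all x, y ∈ J_{n−1}: log((fⁿ)'(x)/(fⁿ)'(y)) ≤ C |fⁿ(x) − fⁿ(y)| · Σ_{i=0}^{n−1} |J_i|/|J₀|, where |J_i| denotes the length of J_i. -/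
open Set Filter Topology

namespace ParabolicDistortion

variable {f : ℝ → ℝ} {q : ℕ → ℝ}

theorem one_le_deriv_of_mem_Icc (hf : ContDiff ℝ 2 f)
    (hf' : ∀ x ∈ Ioo (0:ℝ) 1, 1 < deriv f x) : ∀ x ∈ Icc (0:ℝ) 1, 1 ≤ deriv f x := by
  have hc : Continuous (deriv f) := hf.continuous_deriv (by norm_num)
  have hcl : IsClosed {x | 1 ≤ deriv f x} := isClosed_le continuous_const hc
  intro x hx
  rw [← closure_Ioo (zero_ne_one' ℝ)] at hx
  exact closure_minimal (fun y hy => (hf' y hy).le) hcl hx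

theorem sub_lt_image_sub (hf : Differentiable ℝ f)
    (hf' : ∀ x ∈ Ioo (0:ℝ) 1, 1 < deriv f x) {x y : ℝ} (hx : 0 ≤ x) (hy : y ≤ 1)
    (hxy : x < y) : y - x < f y - f x := by
  obtain ⟨c, hc, h⟩ := exists_deriv_eq_slope f hxy hf.continuous.continuousOn hf.differentiableOn
  have h1 := hf' c ⟨hx.trans_lt hc.1, hc.2.trans_le hy⟩
  rw [h, lt_div_iff₀ (sub_pos.2 hxy)] at h1
  linarith

theorem sub_le_image_sub (hf : Differentiable ℝ f)
    (hf' : ∀ x ∈ Ioo (0:ℝ) 1, 1 < deriv f x) {x y : ℝ} (hx : 0 ≤ x) (hy : y ≤ 1)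
    (hxy : x ≤ y) : y - x ≤ f y - f x := by
  rcases hxy.eq_or_lt with rfl | h
  · simp
  · exact (sub_lt_image_sub hf hf' hx hy h).le

/-- The logarithm of the derivative is Lipschitz on `[0, 1]`. -/
theorem exists_log_deriv_sub_le (hf : ContDiff ℝ 2 f)
    (hf' : ∀ x ∈ Icc (0:ℝ) 1, 1 ≤ deriv f x) :
    ∃ M : ℝ, 0 < M ∧ ∀ x ∈ Icc (0:ℝ) 1, ∀ y ∈ Icc (0:ℝ) 1,
      Real.log (deriv f x) - Real.log (deriv f y) ≤ M * |x - y| := by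
  have hd : ContDiff ℝ 1 (deriv f) := by
    have h2 : ContDiff ℝ (1 + 1) f := by simpa [one_add_one_eq_two] using hf
    exact (contDiff_succ_iff_deriv.1 h2).2.2
  have hdd : Continuous (deriv (deriv f)) := hd.continuous_deriv le_rfl
  obtain ⟨M, hM⟩ := isCompact_Icc.exists_bound_of_continuousOn
    (s := Icc (0:ℝ) 1) hdd.continuousOn
  have hM0 : 0 ≤ M := (norm_nonneg _).trans (hM 0 (by simp))
  refine ⟨M + 1, by linarith, fun x hx y hy => ?_⟩
  have key := (convex_Icc (0:ℝ) 1).norm_image_sub_le_of_norm_hasDerivWithin_le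
    (f := fun x => Real.log (deriv f x)) (f' := fun x => deriv (deriv f) x / deriv f x)
    (C := M + 1) (fun z hz => (((hd.differentiable one_ne_zero z).hasDerivAt.log
      (by linarith [hf' z hz])).hasDerivWithinAt))
    (fun z hz => by
      have h1 := hf' z hz
      rw [norm_div, Real.norm_of_nonneg (by linarith : 0 ≤ deriv f z)]
      exact (div_le_self (norm_nonneg _) h1).trans ((hM z hz).trans (by linarith))) hy hx
  exact (le_abs_self _).trans key

theorem deriv_iterate_succ (hf : Differentiable ℝ f) (k : ℕ) (x : ℝ) :
    deriv (f^[k + 1]) x = deriv (f^[k]) (f x) * deriv f x := by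
  rw [Function.iterate_succ]
  exact deriv_comp x (hf.iterate k (f x)) (hf x)

theorem orbit_pos (hf0 : f 0 = 0) (hq0 : q 0 = 1) (hqmem : ∀ i : ℕ, q (i + 1) ∈ Ico (0:ℝ) 1)
    (hqf : ∀ i : ℕ, f (q (i + 1)) = q i) (i : ℕ) : 0 < q i := by
  induction i with
  | zero => simp [hq0]
  | succ i ih =>
    refine (hqmem i).1.lt_of_ne fun h => ?_
    have := hqf i
    rw [← h, hf0] at this
    linarith

theorem orbit_le_one (hq0 : q 0 = 1) (hqmem : ∀ i : ℕ, q (i + 1) ∈ Ico (0:ℝ) 1) (i : ℕ) :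
    q i ≤ 1 := by
  cases i with
  | zero => exact hq0.le
  | succ i => exact (hqmem i).2.le

theorem orbit_succ_lt (hf : Differentiable ℝ f) (hf0 : f 0 = 0)
    (hf' : ∀ x ∈ Ioo (0:ℝ) 1, 1 < deriv f x) (hq0 : q 0 = 1)
    (hqmem : ∀ i : ℕ, q (i + 1) ∈ Ico (0:ℝ) 1) (hqf : ∀ i : ℕ, f (q (i + 1)) = q i) (i : ℕ) :
    q (i + 1) < q i := by
  have := sub_lt_image_sub hf hf' le_rfl (hqmem i).2.le (orbit_pos hf0 hq0 hqmem hqf (i + 1))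
  rw [hqf, hf0] at this
  linarith

theorem iterate_orbit (hqf : ∀ i : ℕ, f (q (i + 1)) = q i) (k j : ℕ) :
    f^[k] (q (j + k)) = q j := by
  induction k with
  | zero => rfl
  | succ k ih => rw [Function.iterate_succ_apply, ← add_assoc, hqf, ih]

theorem image_mem_Icc (hf : Differentiable ℝ f)
    (hf' : ∀ x ∈ Ioo (0:ℝ) 1, 1 < deriv f x) (hpos : ∀ i, 0 < q i) (hle : ∀ i, q i ≤ 1)
    (hqf : ∀ i : ℕ, f (q (i + 1)) = q i) {k : ℕ} {x : ℝ}
    (hx : x ∈ Icc (q (k + 2)) (q (k + 1))) : f x ∈ Icc (q (k + 1)) (q k) := by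
  have h1 := sub_le_image_sub hf hf' (hpos _).le (hx.2.trans (hle _)) hx.1
  have h2 := sub_le_image_sub hf hf' ((hpos _).le.trans hx.1) (hle _) hx.2
  rw [hqf] at h1 h2
  constructor <;> linarith [hx.1, hx.2]

theorem Icc_orbit_subset (hpos : ∀ i, 0 < q i) (hle : ∀ i, q i ≤ 1) (k : ℕ) :
    Icc (q (k + 1)) (q k) ⊆ Icc (0:ℝ) 1 :=
  Icc_subset_Icc (hpos _).le (hle _)

theorem iterate_mem_Icc (hf : Differentiable ℝ f)
    (hf' : ∀ x ∈ Ioo (0:ℝ) 1, 1 < deriv f x) (hpos : ∀ i, 0 < q i) (hle : ∀ i, q i ≤ 1)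
    (hqf : ∀ i : ℕ, f (q (i + 1)) = q i) {k : ℕ} {x : ℝ}
    (hx : x ∈ Icc (q (k + 1)) (q k)) : f^[k] x ∈ Icc (q 1) (q 0) := by
  induction k generalizing x with
  | zero => exact hx
  | succ k ih => exact ih (image_mem_Icc hf hf' hpos hle hqf hx)

theorem deriv_iterate_pos (hf : Differentiable ℝ f)
    (hf' : ∀ x ∈ Ioo (0:ℝ) 1, 1 < deriv f x) (hf1 : ∀ x ∈ Icc (0:ℝ) 1, 1 ≤ deriv f x)
    (hpos : ∀ i, 0 < q i) (hle : ∀ i, q i ≤ 1)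
    (hqf : ∀ i : ℕ, f (q (i + 1)) = q i) {k : ℕ} {x : ℝ}
    (hx : x ∈ Icc (q (k + 1)) (q k)) : 0 < deriv (f^[k]) x ∧ 0 < deriv (f^[k + 1]) x := by
  induction k generalizing x with
  | zero =>
    have := hf1 x (Icc_orbit_subset hpos hle 0 hx)
    simp only [Function.iterate_zero, deriv_id, zero_add, Function.iterate_one]
    constructor <;> linarith
  | succ k ih =>
    have h := ih (image_mem_Icc hf hf' hpos hle hqf hx)
    have h1 : 0 < deriv f x := by linarith [hf1 x (Icc_orbit_subset hpos hle _ hx)]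
    rw [deriv_iterate_succ hf k, deriv_iterate_succ hf (k + 1)]
    exact ⟨mul_pos h.1 h1, mul_pos h.2 h1⟩

variable {M : ℝ}

/-- Uniform distortion bound for `f^[k]` on the `k`-th fundamental interval. -/
theorem log_deriv_iterate_sub_le (hf : Differentiable ℝ f)
    (hf' : ∀ x ∈ Ioo (0:ℝ) 1, 1 < deriv f x) (hf1 : ∀ x ∈ Icc (0:ℝ) 1, 1 ≤ deriv f x)
    (hpos : ∀ i, 0 < q i) (hle : ∀ i, q i ≤ 1)
    (hqf : ∀ i : ℕ, f (q (i + 1)) = q i) (hM : 0 < M)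
    (hlog : ∀ x ∈ Icc (0:ℝ) 1, ∀ y ∈ Icc (0:ℝ) 1,
      Real.log (deriv f x) - Real.log (deriv f y) ≤ M * |x - y|)
    {k : ℕ} {x y : ℝ} (hx : x ∈ Icc (q (k + 1)) (q k)) (hy : y ∈ Icc (q (k + 1)) (q k)) :
    Real.log (deriv (f^[k]) x) - Real.log (deriv (f^[k]) y) ≤ M * (1 - q (k + 1)) := by
  induction k generalizing x y with
  | zero =>
    simpa using mul_nonneg hM.le (sub_nonneg.2 (hle 1))
  | succ k ih =>
    have hfx := image_mem_Icc hf hf' hpos hle hqf hx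
    have hfy := image_mem_Icc hf hf' hpos hle hqf hy
    have hx01 := Icc_orbit_subset hpos hle _ hx
    have hy01 := Icc_orbit_subset hpos hle _ hy
    have h := ih hfx hfy
    have hl := hlog x hx01 y hy01
    have hxy : M * |x - y| ≤ M * (q (k + 1) - q (k + 2)) := by
      refine mul_le_mul_of_nonneg_left ?_ hM.le
      rw [abs_le]
      constructor <;> linarith [hx.1, hx.2, hy.1, hy.2]
    rw [deriv_iterate_succ hf, deriv_iterate_succ hf,
      Real.log_mul (deriv_iterate_pos hf hf' hf1 hpos hle hqf hfx).1.ne'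
        (by linarith [hf1 x hx01]),
      Real.log_mul (deriv_iterate_pos hf hf' hf1 hpos hle hqf hfy).1.ne'
        (by linarith [hf1 y hy01])]
    linarith

/-- Distances in the `k`-th fundamental interval, relative to its length, are controlled by
distances of the images under `f^[k + 1]`. -/
theorem mul_sub_le_iterate_sub (hf : Differentiable ℝ f)
    (hf' : ∀ x ∈ Ioo (0:ℝ) 1, 1 < deriv f x) (hf1 : ∀ x ∈ Icc (0:ℝ) 1, 1 ≤ deriv f x)
    (hpos : ∀ i, 0 < q i) (hle : ∀ i, q i ≤ 1) (hlt : ∀ i, q (i + 1) < q i)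
    (hqf : ∀ i : ℕ, f (q (i + 1)) = q i) (hM : 0 < M)
    (hlog : ∀ x ∈ Icc (0:ℝ) 1, ∀ y ∈ Icc (0:ℝ) 1,
      Real.log (deriv f x) - Real.log (deriv f y) ≤ M * |x - y|)
    {k : ℕ} {x y : ℝ} (hx : x ∈ Icc (q (k + 1)) (q k)) (hy : y ∈ Icc (q (k + 1)) (q k))
    (hxy : x < y) :
    (q 0 - q 1) * (y - x) ≤
      Real.exp M * (q k - q (k + 1)) * (f^[k + 1] y - f^[k + 1] x) := by
  have hF : Differentiable ℝ (f^[k]) := hf.iterate k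
  obtain ⟨c, hc, hcs⟩ :=
    exists_deriv_eq_slope (f^[k]) hxy hF.continuous.continuousOn hF.differentiableOn
  obtain ⟨d, hd, hds⟩ :=
    exists_deriv_eq_slope (f^[k]) (hlt k) hF.continuous.continuousOn hF.differentiableOn
  have hc' : c ∈ Icc (q (k + 1)) (q k) := ⟨hx.1.trans hc.1.le, hc.2.le.trans hy.2⟩
  have hd' : d ∈ Icc (q (k + 1)) (q k) := Ioo_subset_Icc_self hd
  have hcpos := (deriv_iterate_pos hf hf' hf1 hpos hle hqf hc').1
  have hdpos := (deriv_iterate_pos hf hf' hf1 hpos hle hqf hd').1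
  have hratio : deriv (f^[k]) d ≤ Real.exp M * deriv (f^[k]) c := by
    rw [← Real.log_le_log_iff hdpos (by positivity),
      Real.log_mul (Real.exp_pos M).ne' hcpos.ne', Real.log_exp]
    have := log_deriv_iterate_sub_le hf hf' hf1 hpos hle hqf hM hlog hd' hc'
    nlinarith [mul_pos hM (hpos (k + 1))]
  have hk0 : f^[k] (q k) = q 0 := by simpa using iterate_orbit hqf k 0
  have hk1 : f^[k] (q (k + 1)) = q 1 := by simpa [add_comm] using iterate_orbit hqf k 1
  have hJ : 0 < q k - q (k + 1) := sub_pos.2 (hlt k)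
  have hyx : 0 < y - x := sub_pos.2 hxy
  rw [hk0, hk1, eq_div_iff hJ.ne'] at hds
  rw [eq_div_iff hyx.ne'] at hcs
  have hFxy : f^[k] x ≤ f^[k] y := by nlinarith [mul_pos hcpos hyx]
  have hexp : f^[k] y - f^[k] x ≤ f^[k + 1] y - f^[k + 1] x := by
    rw [Function.iterate_succ_apply', Function.iterate_succ_apply']
    exact sub_le_image_sub hf hf'
      ((hpos 1).le.trans (iterate_mem_Icc hf hf' hpos hle hqf hx).1)
      ((iterate_mem_Icc hf hf' hpos hle hqf hy).2.trans (hle 0)) hFxy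
  calc (q 0 - q 1) * (y - x)
      = deriv (f^[k]) d * ((q k - q (k + 1)) * (y - x)) := by rw [← hds]; ring
    _ ≤ Real.exp M * deriv (f^[k]) c * ((q k - q (k + 1)) * (y - x)) := by gcongr
    _ = Real.exp M * (q k - q (k + 1)) * (f^[k] y - f^[k] x) := by rw [← hcs]; ring
    _ ≤ _ := by gcongr

theorem abs_sub_le_iterate_abs_sub (hf : Differentiable ℝ f)
    (hf' : ∀ x ∈ Ioo (0:ℝ) 1, 1 < deriv f x) (hf1 : ∀ x ∈ Icc (0:ℝ) 1, 1 ≤ deriv f x)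
    (hpos : ∀ i, 0 < q i) (hle : ∀ i, q i ≤ 1) (hlt : ∀ i, q (i + 1) < q i)
    (hqf : ∀ i : ℕ, f (q (i + 1)) = q i) (hM : 0 < M)
    (hlog : ∀ x ∈ Icc (0:ℝ) 1, ∀ y ∈ Icc (0:ℝ) 1,
      Real.log (deriv f x) - Real.log (deriv f y) ≤ M * |x - y|)
    {k : ℕ} {x y : ℝ} (hx : x ∈ Icc (q (k + 1)) (q k)) (hy : y ∈ Icc (q (k + 1)) (q k)) :
    |x - y| ≤ Real.exp M * |f^[k + 1] x - f^[k + 1] y| * ((q k - q (k + 1)) / (q 0 - q 1)) := by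
  wlog hxy : x ≤ y generalizing x y
  · rw [abs_sub_comm x, abs_sub_comm (f^[k + 1] x)]
    exact this hy hx (le_of_not_ge hxy)
  rcases hxy.eq_or_lt with rfl | hxy
  · simp
  have h := mul_sub_le_iterate_sub hf hf' hf1 hpos hle hlt hqf hM hlog hx hy hxy
  have hJ : 0 < q k - q (k + 1) := sub_pos.2 (hlt k)
  rw [← mul_div_assoc, le_div_iff₀ (sub_pos.2 (hlt 0)), abs_sub_comm x, abs_sub_comm (f^[k + 1] x),
    abs_of_pos (sub_pos.2 hxy), mul_comm]
  refine h.trans ?_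
  rw [mul_right_comm]
  gcongr
  exact le_abs_self _

theorem log_deriv_iterate_succ_sub_le (hf : Differentiable ℝ f)
    (hf' : ∀ x ∈ Ioo (0:ℝ) 1, 1 < deriv f x) (hf1 : ∀ x ∈ Icc (0:ℝ) 1, 1 ≤ deriv f x)
    (hpos : ∀ i, 0 < q i) (hle : ∀ i, q i ≤ 1) (hlt : ∀ i, q (i + 1) < q i)
    (hqf : ∀ i : ℕ, f (q (i + 1)) = q i) (hM : 0 < M)
    (hlog : ∀ x ∈ Icc (0:ℝ) 1, ∀ y ∈ Icc (0:ℝ) 1,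
      Real.log (deriv f x) - Real.log (deriv f y) ≤ M * |x - y|)
    {k : ℕ} {x y : ℝ} (hx : x ∈ Icc (q (k + 1)) (q k)) (hy : y ∈ Icc (q (k + 1)) (q k)) :
    Real.log (deriv (f^[k + 1]) x) - Real.log (deriv (f^[k + 1]) y) ≤
      M * Real.exp M * |f^[k + 1] x - f^[k + 1] y| *
        ∑ i ∈ Finset.range (k + 1), (q i - q (i + 1)) / (q 0 - q 1) := by
  have hx01 := Icc_orbit_subset hpos hle _ hx
  have hy01 := Icc_orbit_subset hpos hle _ hy
  have hl := hlog x hx01 y hy01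
  have hd := mul_le_mul_of_nonneg_left
    (abs_sub_le_iterate_abs_sub hf hf' hf1 hpos hle hlt hqf hM hlog hx hy) hM.le
  induction k generalizing x y with
  | zero =>
    rw [Finset.sum_range_one]
    simp only [zero_add, Function.iterate_one] at hd ⊢
    linarith
  | succ k ih =>
    have hfx := image_mem_Icc hf hf' hpos hle hqf hx
    have hfy := image_mem_Icc hf hf' hpos hle hqf hy
    have hfx01 := Icc_orbit_subset hpos hle _ hfx
    have hfy01 := Icc_orbit_subset hpos hle _ hfy
    have h := ih hfx hfy hfx01 hfy01 (hlog _ hfx01 _ hfy01) (mul_le_mul_of_nonneg_left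
      (abs_sub_le_iterate_abs_sub hf hf' hf1 hpos hle hlt hqf hM hlog hfx hfy) hM.le)
    rw [deriv_iterate_succ hf (k + 1), deriv_iterate_succ hf (k + 1),
      Real.log_mul (deriv_iterate_pos hf hf' hf1 hpos hle hqf hfx).2.ne'
        (by linarith [hf1 x hx01]),
      Real.log_mul (deriv_iterate_pos hf hf' hf1 hpos hle hqf hfy).2.ne'
        (by linarith [hf1 y hy01]), Finset.sum_range_succ, mul_add]
    rw [← Function.iterate_succ_apply, ← Function.iterate_succ_apply] at h
    linarith

end ParabolicDistortion

/-- **Lemma.** Bounded distortion near a neutral fixed point:  for a `C²` map `f` with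
`f(0) = 0`, `f'(0) = 1` and `f' > 1` on `(0,1)`, and the backward orbit `q₀ = 1`,
`f(q_{i+1}) = q_i`, `J_i = [q_{i+1}, q_i)`, there is `C > 0` such that for all `n ≥ 1` and
`x, y ∈ J_{n-1}`, `log((fⁿ)'(x)/(fⁿ)'(y)) ≤ C |fⁿ(x) - fⁿ(y)| ∑_{i<n} |J_i|/|J_0|`. -/
theorem parabolic_bounded_distortion (f : ℝ → ℝ) (hf : ContDiff ℝ 2 f)
    (hf0 : f 0 = 0) (hf'0 : deriv f 0 = 1) (hf' : ∀ x ∈ Ioo (0:ℝ) 1, 1 < deriv f x)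
    (q : ℕ → ℝ) (hq0 : q 0 = 1) (hqmem : ∀ i : ℕ, q (i + 1) ∈ Ico (0:ℝ) 1)
    (hqf : ∀ i : ℕ, f (q (i + 1)) = q i) :
    ∃ C : ℝ, 0 < C ∧ ∀ n : ℕ, 1 ≤ n →
      ∀ x ∈ Ico (q n) (q (n - 1)), ∀ y ∈ Ico (q n) (q (n - 1)),
        Real.log (deriv (f^[n]) x / deriv (f^[n]) y) ≤
          C * |f^[n] x - f^[n] y| *
            ∑ i ∈ Finset.range n, (q i - q (i + 1)) / (q 0 - q 1) := by
  have hd : Differentiable ℝ f := hf.differentiable two_ne_zero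
  have hf1 := ParabolicDistortion.one_le_deriv_of_mem_Icc hf hf'
  have hpos := ParabolicDistortion.orbit_pos hf0 hq0 hqmem hqf
  have hle := ParabolicDistortion.orbit_le_one hq0 hqmem
  have hlt := ParabolicDistortion.orbit_succ_lt hd hf0 hf' hq0 hqmem hqf
  obtain ⟨M, hM, hlog⟩ := ParabolicDistortion.exists_log_deriv_sub_le hf hf1
  refine ⟨M * Real.exp M, by positivity, fun n hn x hx y hy => ?_⟩
  obtain ⟨k, rfl⟩ := Nat.exists_eq_add_of_le' hn
  rw [Nat.add_sub_cancel] at hx hy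
  replace hx := Ico_subset_Icc_self hx
  replace hy := Ico_subset_Icc_self hy
  rw [Real.log_div (ParabolicDistortion.deriv_iterate_pos hd hf' hf1 hpos hle hqf hx).2.ne'
    (ParabolicDistortion.deriv_iterate_pos hd hf' hf1 hpos hle hqf hy).2.ne']
  exact ParabolicDistortion.log_deriv_iterate_succ_sub_le hd hf' hf1 hpos hle hlt hqf hM hlog hx hy
end

section
/- For the regular continued fraction: for every α ∈ [0,∞] (with the convention that the limit equals ∞ means the quantity tends to infinity), the set {x ∈ (0,1)∖ℚ : lim_{n→∞} L_n(x)·(log log n)/n = α} has Hausdorff dimension 1, where L_n(x) = max{a₁(x),…,a_n(x)}. -/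
open Set MeasureTheory Filter Topology

open scoped ENNReal NNReal Classical

namespace ParabolicIFSPaper

noncomputable section

/-- The maps `φ_i(x) = 1/(x+i)` generating the regular continued fraction. -/
def rcf : ℕ → ℝ → ℝ := fun i x => 1 / (x + i)

/-- For `q' / q = r`, the ratio between the length of a cylinder and that of its `i`-th child. -/
def lenRatio (r : ℝ) (i : ℕ) : ℝ := (1 + r) / ((i + r) * (i + 1 + r))

/-- The quotients `q_{n-1} / q_n` of consecutive continuants. -/
def contRatio (a : ℕ → ℕ) : ℕ → ℝ
  | 0 => 0
  | n + 1 => 1 / (a n + contRatio a n)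

/-- The length of the cylinder of order `n` around the digit sequence `a`. -/
def cylLen (a : ℕ → ℕ) (n : ℕ) : ℝ := ∏ k ∈ Finset.range n, lenRatio (contRatio a k) (a k)

/-- The value of the continued fraction with digits `a`. -/
def cfVal (a : ℕ → ℕ) : ℝ := limUnder atTop fun n => comp rcf a n 0

lemma lenRatio_pos {r : ℝ} (hr : 0 ≤ r) {i : ℕ} (hi : 1 ≤ i) : 0 < lenRatio r i := by
  have : (1 : ℝ) ≤ i := by exact_mod_cast hi
  unfold lenRatio; positivity

lemma lenRatio_le_half {r : ℝ} (hr : 0 ≤ r) {i : ℕ} (hi : 1 ≤ i) : lenRatio r i ≤ 1 / 2 := by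
  have : (1 : ℝ) ≤ i := by exact_mod_cast hi
  unfold lenRatio
  rw [div_le_div_iff₀ (by positivity) (by norm_num)]
  nlinarith

lemma inv_le_lenRatio {r : ℝ} (hr : r ∈ Icc (0 : ℝ) 1) {i : ℕ} (hi : 1 ≤ i) :
    1 / (((i : ℝ) + 1) * (i + 2)) ≤ lenRatio r i := by
  have : (1 : ℝ) ≤ i := by exact_mod_cast hi
  obtain ⟨h0, h1⟩ := hr
  unfold lenRatio
  rw [div_le_div_iff₀ (by positivity) (by positivity)]
  have : ((i : ℝ) + r) * (i + 1 + r) ≤ (i + 1) * (i + 2) := by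
    apply mul_le_mul <;> linarith
  nlinarith [mul_nonneg h0 (show (0 : ℝ) ≤ (i + 1) * (i + 2) by positivity)]

lemma inv_add_mem_Icc {r : ℝ} (hr : 0 ≤ r) {i : ℕ} (hi : 1 ≤ i) :
    1 / ((i : ℝ) + r) ∈ Icc (0 : ℝ) 1 := by
  have : (1 : ℝ) ≤ i := by exact_mod_cast hi
  refine ⟨by positivity, ?_⟩
  rw [div_le_one (by linarith)]; linarith

lemma contRatio_mem {a : ℕ → ℕ} (ha : ∀ k, 1 ≤ a k) (n : ℕ) :
    contRatio a n ∈ Icc (0 : ℝ) 1 := by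
  induction n with
  | zero => simp [contRatio]
  | succ n ih => exact inv_add_mem_Icc ih.1 (ha n)

lemma cylLen_pos {a : ℕ → ℕ} (ha : ∀ k, 1 ≤ a k) (n : ℕ) : 0 < cylLen a n :=
  Finset.prod_pos fun k _ => lenRatio_pos (contRatio_mem ha k).1 (ha k)

lemma cylLen_le {a : ℕ → ℕ} (ha : ∀ k, 1 ≤ a k) (n : ℕ) : cylLen a n ≤ (1 / 2) ^ n := by
  have := Finset.prod_le_prod (s := Finset.range n)
    (fun k _ => (lenRatio_pos (contRatio_mem ha k).1 (ha k)).le)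
    (fun k _ => lenRatio_le_half (contRatio_mem ha k).1 (ha k))
  simpa [cylLen] using this

lemma cylLen_succ (a : ℕ → ℕ) (n : ℕ) :
    cylLen a (n + 1) = cylLen a n * lenRatio (contRatio a n) (a n) :=
  Finset.prod_range_succ _ _

lemma abs_comp_rcf_sub {a : ℕ → ℕ} (ha : ∀ k, 1 ≤ a k) (n : ℕ) {t u : ℝ} (ht : 0 ≤ t)
    (hu : 0 ≤ u) :
    |comp rcf a n t - comp rcf a n u| = cylLen a n * (1 + contRatio a n) * |t - u| /
      ((1 + contRatio a n * t) * (1 + contRatio a n * u)) := by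
  induction n generalizing t u with
  | zero => simp [comp, cylLen, contRatio]
  | succ n ih =>
    have h1 : (1 : ℝ) ≤ a n := by exact_mod_cast ha n
    have hr := (contRatio_mem ha n).1
    have := ih (t := rcf (a n) t) (u := rcf (a n) u) (by unfold rcf; positivity)
      (by unfold rcf; positivity)
    simp only [comp, Function.comp_apply]
    rw [this, cylLen_succ]
    have e : |rcf (a n) t - rcf (a n) u| = |t - u| / ((t + a n) * (u + a n)) := by
      unfold rcf
      rw [div_sub_div _ _ (by positivity) (by positivity), abs_div, abs_sub_comm,
        abs_of_pos (show 0 < (t + a n) * (u + (a n : ℝ)) by positivity)]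
      congr 2
      ring
    rw [e]
    simp only [contRatio, lenRatio, rcf]
    set r := contRatio a n
    have : 0 < a n + r := by positivity
    field_simp
    ring

lemma abs_comp_rcf_sub_le {a : ℕ → ℕ} (ha : ∀ k, 1 ≤ a k) (n : ℕ) {t u : ℝ} (ht : 0 ≤ t)
    (hu : 0 ≤ u) :
    |comp rcf a n t - comp rcf a n u| ≤ 2 * cylLen a n * |t - u| := by
  rw [abs_comp_rcf_sub ha n ht hu]
  obtain ⟨h0, h1⟩ := contRatio_mem ha n
  have hl := cylLen_pos ha n
  have h2 : 1 ≤ (1 + contRatio a n * t) * (1 + contRatio a n * u) := by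
    nlinarith [mul_nonneg h0 ht, mul_nonneg h0 hu, mul_nonneg (mul_nonneg h0 ht) (mul_nonneg h0 hu)]
  refine (div_le_self (by positivity) h2).trans ?_
  apply mul_le_mul_of_nonneg_right _ (abs_nonneg _)
  nlinarith

lemma le_abs_comp_rcf_sub {a : ℕ → ℕ} (ha : ∀ k, 1 ≤ a k) (n : ℕ) {t u : ℝ}
    (ht : t ∈ Icc (0 : ℝ) 1) (hu : u ∈ Icc (0 : ℝ) 1) :
    cylLen a n * |t - u| / 2 ≤ |comp rcf a n t - comp rcf a n u| := by
  rw [abs_comp_rcf_sub ha n ht.1 hu.1]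
  obtain ⟨h0, h1⟩ := contRatio_mem ha n
  have hl := cylLen_pos ha n
  have ht0 := ht.1
  have hu0 := hu.1
  set r := contRatio a n
  have h2 : (1 + r * t) * (1 + r * u) ≤ (1 + r) * 2 := by
    apply mul_le_mul
    · nlinarith [ht.2]
    · nlinarith [hu.2]
    · positivity
    · positivity
  rw [div_le_div_iff₀ (by norm_num) (by positivity)]
  have := mul_le_mul_of_nonneg_left h2 (show 0 ≤ cylLen a n * |t - u| by positivity)
  linarith

lemma comp_rcf_mem {a : ℕ → ℕ} (ha : ∀ k, 1 ≤ a k) (n : ℕ) {t : ℝ} (ht : t ∈ Icc (0 : ℝ) 1) :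
    comp rcf a n t ∈ Icc (0 : ℝ) 1 := by
  induction n generalizing t with
  | zero => exact ht
  | succ n ih =>
    refine ih ?_
    have := inv_add_mem_Icc ht.1 (ha n)
    rwa [add_comm] at this

lemma comp_succ_shift (φ : ℕ → ℝ → ℝ) (a : ℕ → ℕ) (n : ℕ) (t : ℝ) :
    comp φ a (n + 1) t = φ (a 0) (comp φ (fun k => a (k + 1)) n t) := by
  induction n generalizing t with
  | zero => rfl
  | succ n ih =>
    have := ih (φ (a (n + 1)) t)
    simpa [comp] using this

lemma tendsto_cfVal {a : ℕ → ℕ} (ha : ∀ k, 1 ≤ a k) :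
    Tendsto (fun n => comp rcf a n 0) atTop (𝓝 (cfVal a)) := by
  refine (cauchySeq_of_le_geometric (1 / 2) 2 (by norm_num) fun n => ?_).tendsto_limUnder
  have h1 : (1 : ℝ) ≤ a n := by exact_mod_cast ha n
  have hm := inv_add_mem_Icc (le_refl (0 : ℝ)) (ha n)
  have := abs_comp_rcf_sub_le ha n (t := 0) (u := rcf (a n) 0) le_rfl (by unfold rcf; positivity)
  rw [Real.dist_eq]
  refine this.trans ?_
  have h2 : |0 - rcf (a n) 0| ≤ 1 := by
    rw [zero_sub, abs_neg, rcf, zero_add, abs_of_nonneg (by positivity)]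
    simpa using hm.2
  have h3 := cylLen_le ha n
  have h4 := cylLen_pos ha n
  calc 2 * cylLen a n * |0 - rcf (a n) 0| ≤ 2 * cylLen a n * 1 := by gcongr
    _ ≤ 2 * (1 / 2) ^ n := by rw [mul_one]; gcongr

lemma cfVal_mem_Icc {a : ℕ → ℕ} (ha : ∀ k, 1 ≤ a k) : cfVal a ∈ Icc (0 : ℝ) 1 :=
  isClosed_Icc.mem_of_tendsto (tendsto_cfVal ha)
    (Eventually.of_forall fun n => comp_rcf_mem ha n ⟨le_rfl, zero_le_one⟩)

lemma cfVal_eq {a : ℕ → ℕ} (ha : ∀ k, 1 ≤ a k) :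
    cfVal a = 1 / (cfVal (fun k => a (k + 1)) + a 0) := by
  have h1 := (tendsto_cfVal ha).comp (tendsto_add_atTop_nat 1)
  have hb : ∀ k, 1 ≤ a (k + 1) := fun k => ha _
  have h2 := tendsto_cfVal (a := fun k => a (k + 1)) hb
  have h0 : (1 : ℝ) ≤ a 0 := by exact_mod_cast ha 0
  refine tendsto_nhds_unique h1 ?_
  have hne : cfVal (fun k => a (k + 1)) + a 0 ≠ 0 := by
    have := (cfVal_mem_Icc (a := fun k => a (k + 1)) hb).1
    positivity
  have h3 := (tendsto_const_nhds (x := (1 : ℝ))).div (h2.add_const (a 0 : ℝ)) hne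
  refine h3.congr fun n => ?_
  simp only [Function.comp_apply, comp_succ_shift]
  rfl

lemma cfVal_mem_Ioo {a : ℕ → ℕ} (ha : ∀ k, 1 ≤ a k) : cfVal a ∈ Ioo (0 : ℝ) 1 := by
  have pos : ∀ {b : ℕ → ℕ}, (∀ k, 1 ≤ b k) → 0 < cfVal b := fun {b} hb => by
    rw [cfVal_eq hb]
    have h0 : (1 : ℝ) ≤ b 0 := by exact_mod_cast hb 0
    have := (cfVal_mem_Icc (a := fun k => b (k + 1)) fun k => hb _).1
    positivity
  refine ⟨pos ha, ?_⟩
  rw [cfVal_eq ha]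
  have h0 : (1 : ℝ) ≤ a 0 := by exact_mod_cast ha 0
  have := pos (b := fun k => a (k + 1)) fun k => ha _
  rw [div_lt_one (by positivity)]
  linarith

lemma comp_rcf_cfVal_shift {a : ℕ → ℕ} (ha : ∀ k, 1 ≤ a k) (n : ℕ) :
    comp rcf a n (cfVal fun k => a (k + n)) = cfVal a := by
  induction n with
  | zero => rfl
  | succ n ih =>
    rw [← ih, cfVal_eq (a := fun k => a (k + n)) fun k => ha _]
    simp only [comp, Function.comp_apply, rcf, zero_add]
    congr! 5 with k
    ring_nf

lemma irrational_cfVal {a : ℕ → ℕ} (ha : ∀ k, 1 ≤ a k) : Irrational (cfVal a) := by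
  have key : ∀ q : ℕ, ∀ p : ℕ, ∀ b : ℕ → ℕ, (∀ k, 1 ≤ b k) → cfVal b * q ≠ p ∨ q = 0 := by
    intro q
    induction q using Nat.strong_induction_on with
    | _ q ih =>
      intro p b hb
      by_contra! h
      obtain ⟨h, hq⟩ := h
      have hq0 : (0 : ℝ) < q := by exact_mod_cast Nat.pos_of_ne_zero hq
      obtain ⟨hx0, hx1⟩ := cfVal_mem_Ioo hb
      have hv := (cfVal_mem_Ioo (a := fun k => b (k + 1)) fun k => hb _).1
      have hpq : p < q := by
        have : (p : ℝ) < q := by rw [← h]; nlinarith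
        exact_mod_cast this
      have hp0 : (0 : ℝ) < p := by rw [← h]; positivity
      have he := cfVal_eq hb
      set v := cfVal (fun k => b (k + 1))
      have hb0 : (0 : ℝ) ≤ b 0 := by positivity
      have e1 : v * p = q - b 0 * p := by
        rw [he] at h
        field_simp at h
        linarith
      have hle : b 0 * p ≤ q := by
        have : (b 0 : ℝ) * p ≤ q := by nlinarith
        exact_mod_cast this
      rcases ih p hpq (q - b 0 * p) (fun k => b (k + 1)) (fun k => hb _) with h' | h'
      · apply h'
        rw [Nat.cast_sub hle]
        push_cast
        exact e1
      · rw [h'] at hp0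
        simp at hp0
  rintro ⟨x, hx⟩
  have hpos := (cfVal_mem_Ioo ha).1
  rw [← hx] at hpos
  have hx0 : 0 < x := by exact_mod_cast hpos
  have hnum : ((x.num.toNat : ℕ) : ℤ) = x.num := Int.toNat_of_nonneg (Rat.num_nonneg.2 hx0.le)
  rcases key x.den x.num.toNat a ha with h | h
  · apply h
    rw [← hx]
    have h1 : x * x.den = x.num := Rat.mul_den_eq_num x
    have h2 : ((x * x.den : ℚ) : ℝ) = ((x.num : ℚ) : ℝ) := by rw [h1]
    push_cast at h2
    rw [h2]
    exact_mod_cast hnum.symm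
  · exact x.den_nz h

lemma comp_congr (φ : ℕ → ℝ → ℝ) {a b : ℕ → ℕ} {n : ℕ} (h : ∀ k < n, a k = b k) :
    comp φ a n = comp φ b n := by
  induction n with
  | zero => rfl
  | succ n ih => simp only [comp, ih fun k hk => h k (by omega), h n (by omega)]

lemma le_abs_one_div_sub {i j : ℕ} (hi : 1 ≤ i) (hij : i < j) {M : ℝ} (hj : (j : ℝ) ≤ M)
    {u v δ : ℝ} (hu : u ∈ Ioo (0 : ℝ) 1) (hv : v ∈ Ioo (0 : ℝ) 1) (hδv : δ ≤ v) (hδ : 0 ≤ δ) :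
    δ / (M + 1) ^ 2 ≤ |1 / (u + i) - 1 / (v + j)| := by
  have h1 : (1 : ℝ) ≤ i := by exact_mod_cast hi
  have h2 : (i : ℝ) + 1 ≤ j := by exact_mod_cast hij
  obtain ⟨hu0, hu1⟩ := hu
  obtain ⟨hv0, hv1⟩ := hv
  refine le_trans ?_ (le_abs_self _)
  rw [div_sub_div _ _ (by positivity) (by positivity)]
  apply div_le_div₀ <;> nlinarith

/-- Two continued fractions that agree up to order `n` and then differ are far apart on the scale
of their common cylinder, unless a digit of order `n + 1` or `n + 2` is large. -/
lemma cylLen_le_abs_cfVal_sub {a b : ℕ → ℕ} (ha : ∀ k, 1 ≤ a k) (hb : ∀ k, 1 ≤ b k) {n : ℕ}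
    (hab : ∀ k < n, a k = b k) (hn : a n ≠ b n) {M D : ℝ} (haM : a n ≤ M) (hbM : b n ≤ M)
    (haD : a (n + 1) ≤ D) (hbD : b (n + 1) ≤ D) :
    cylLen a n ≤ 2 * (M + 1) ^ 2 * (D + 1) * |cfVal a - cfVal b| := by
  have hM : 0 ≤ M := le_trans (by positivity) haM
  have hD : 0 ≤ D := le_trans (by positivity) haD
  have low : ∀ {c : ℕ → ℕ}, (∀ k, 1 ≤ c k) → (c (n + 1) : ℝ) ≤ D →
      1 / (D + 1) ≤ cfVal fun k => c (k + (n + 1)) := fun {c} hc hcD => by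
    rw [cfVal_eq (a := fun k => c (k + (n + 1))) fun k => hc _]
    have h1 := (cfVal_mem_Ioo (a := fun k => c (k + 1 + (n + 1))) fun k => hc _)
    have h2 : (1 : ℝ) ≤ c (n + 1) := by exact_mod_cast hc _
    simp only [zero_add]
    apply one_div_le_one_div_of_le
    · linarith [h1.1]
    · linarith [h1.2]
  have hta : ∀ {c : ℕ → ℕ}, (∀ k, 1 ≤ c k) →
      cfVal (fun k => c (k + n)) = 1 / (cfVal (fun k => c (k + (n + 1))) + c n) := fun {c} hc => by
    rw [cfVal_eq (a := fun k => c (k + n)) fun k => hc _]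
    simp only [zero_add]
    congr! 4 with k
    ring_nf
  have gap : 1 / (D + 1) / (M + 1) ^ 2 ≤
      |cfVal (fun k => a (k + n)) - cfVal fun k => b (k + n)| := by
    rw [hta ha, hta hb]
    have ua := cfVal_mem_Ioo (a := fun k => a (k + (n + 1))) fun k => ha _
    have ub := cfVal_mem_Ioo (a := fun k => b (k + (n + 1))) fun k => hb _
    rcases lt_or_gt_of_ne hn with h | h
    · exact le_abs_one_div_sub (ha n) h hbM ua ub (low hb hbD) (by positivity)
    · rw [abs_sub_comm]
      exact le_abs_one_div_sub (hb n) h haM ub ua (low ha haD) (by positivity)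
  have h1 := le_abs_comp_rcf_sub ha n (cfVal_mem_Icc (a := fun k => a (k + n)) fun k => ha _)
    (cfVal_mem_Icc (a := fun k => b (k + n)) fun k => hb _)
  rw [comp_rcf_cfVal_shift ha, comp_congr rcf hab, comp_rcf_cfVal_shift hb] at h1
  have hl := cylLen_pos ha n
  have h2 := mul_le_mul_of_nonneg_left gap hl.le
  have h3 : cylLen a n * (1 / (D + 1) / (M + 1) ^ 2) / 2 ≤ |cfVal a - cfVal b| := by linarith
  rw [div_div, mul_one_div, div_div, div_le_iff₀ (by positivity)] at h3
  linarith

lemma sum_lenRatio {r : ℝ} (hr : 0 ≤ r) (M : ℕ) :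
    ∑ i ∈ Finset.range M, lenRatio r (i + 1) = 1 - (1 + r) / (M + 1 + r) := by
  induction M with
  | zero => simp [div_self (show 1 + r ≠ 0 by positivity)]
  | succ M ih =>
    rw [Finset.sum_range_succ, ih, lenRatio]
    push_cast
    field_simp
    ring

lemma exists_one_lt_sum_lenRatio_rpow {s : ℝ} (hs : s < 1) :
    ∃ M : ℕ, ∃ ρ : ℝ, 1 < ρ ∧ ∀ r ∈ Icc (0 : ℝ) 1,
      ρ ≤ ∑ i ∈ Finset.range M, lenRatio r (i + 1) ^ s := by
  have h2 : (1 : ℝ) < 2 ^ (1 - s) := Real.one_lt_rpow (by norm_num) (by linarith)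
  have hlim : Tendsto (fun M : ℕ => (2 : ℝ) ^ (1 - s) * (1 - 2 * (1 / ((M : ℝ) + 1)))) atTop
      (𝓝 (2 ^ (1 - s) * (1 - 2 * 0))) :=
    ((tendsto_one_div_add_atTop_nhds_zero_nat.const_mul 2).const_sub 1).const_mul _
  rw [mul_zero, sub_zero, mul_one] at hlim
  obtain ⟨M, hM⟩ := (hlim.eventually (lt_mem_nhds h2)).exists
  refine ⟨M, _, hM, fun r hr => ?_⟩
  have h1 : ∀ i ∈ Finset.range M, 2 ^ (1 - s) * lenRatio r (i + 1) ≤ lenRatio r (i + 1) ^ s := by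
    intro i _
    have hp := lenRatio_pos hr.1 (Nat.le_add_left 1 i)
    have hh := lenRatio_le_half hr.1 (Nat.le_add_left 1 i)
    calc (2 : ℝ) ^ (1 - s) * lenRatio r (i + 1)
        = 2 ^ (1 - s) * (lenRatio r (i + 1) ^ (1 - s) * lenRatio r (i + 1) ^ s) := by
          rw [← Real.rpow_add hp]; simp
      _ = (2 * lenRatio r (i + 1)) ^ (1 - s) * lenRatio r (i + 1) ^ s := by
          rw [Real.mul_rpow (by norm_num) hp.le]; ring
      _ ≤ 1 * lenRatio r (i + 1) ^ s := by
          gcongr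
          exact Real.rpow_le_one (by positivity) (by linarith) (by linarith)
      _ = _ := one_mul _
  refine le_trans ?_ (Finset.sum_le_sum h1)
  rw [← Finset.mul_sum, sum_lenRatio hr.1]
  obtain ⟨h0, h1⟩ := hr
  have : (1 + r) / (M + 1 + r) ≤ 2 * (1 / ((M : ℝ) + 1)) := by
    rw [mul_one_div, div_le_div_iff₀ (by positivity) (by positivity)]
    nlinarith [(Nat.cast_nonneg M : (0 : ℝ) ≤ M)]
  gcongr

/-- Partition of (at most) `[0, 1)` into intervals of lengths `w i / ρ`, each mapped affinely. -/
lemma exists_affine_partition {w : ℕ → ℝ} (hw : ∀ i, 0 < w i) {M : ℕ} {ρ : ℝ} (hρ : 0 < ρ)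
    (hsum : ρ ≤ ∑ i ∈ Finset.range M, w (i + 1)) :
    ∃ d : ℝ → ℕ, ∃ T : ℝ → ℝ, ∀ y ∈ Ico (0 : ℝ) 1, (1 ≤ d y ∧ d y ≤ M) ∧ T y ∈ Ico (0 : ℝ) 1 ∧
      ∀ y' ∈ Ico (0 : ℝ) 1, d y = d y' → |y - y'| = ρ⁻¹ * w (d y) * |T y - T y'| := by
  set S : ℕ → ℝ := fun m => ∑ i ∈ Finset.range m, w (i + 1) with hS
  have key : ∀ y : ℝ, ∃ i : ℕ, y ∈ Ico (0 : ℝ) 1 →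
      (1 ≤ i ∧ i ≤ M) ∧ S (i - 1) ≤ ρ * y ∧ ρ * y < S i := by
    intro y
    by_cases hy : y ∈ Ico (0 : ℝ) 1
    · have hex : ∃ m, ρ * y < S m := ⟨M, lt_of_lt_of_le (by nlinarith [hy.2]) hsum⟩
      have hpos : 1 ≤ Nat.find hex := by
        rw [Nat.one_le_iff_ne_zero]
        intro h0
        have := Nat.find_spec hex
        rw [h0] at this
        simp only [hS, Finset.range_zero, Finset.sum_empty] at this
        nlinarith [hy.1]
      refine ⟨Nat.find hex, fun _ => ⟨⟨hpos, Nat.find_min' hex ?_⟩, ?_, Nat.find_spec hex⟩⟩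
      · exact lt_of_lt_of_le (by nlinarith [hy.2]) hsum
      · exact not_lt.1 (Nat.find_min hex (by omega))
    · exact ⟨0, fun h => absurd h hy⟩
  choose d hd using key
  refine ⟨d, fun y => (ρ * y - S (d y - 1)) / w (d y), fun y hy => ⟨(hd y hy).1, ⟨?_, ?_⟩, ?_⟩⟩
  · exact div_nonneg (by linarith [(hd y hy).2.1]) (hw _).le
  · rw [div_lt_one (hw _)]
    have h1 := (hd y hy).2.2
    have h2 : S (d y) = S (d y - 1) + w (d y) := by
      obtain ⟨k, hk⟩ := Nat.exists_eq_add_of_le' (hd y hy).1.1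
      rw [hk, Nat.add_sub_cancel]
      exact Finset.sum_range_succ _ _
    linarith
  · intro y' _ h
    have hwp := hw (d y)
    simp only [← h]
    rw [div_sub_div_same, abs_div, abs_of_pos hwp,
      show ρ * y - S (d y - 1) - (ρ * y' - S (d y - 1)) = ρ * (y - y') by ring, abs_mul,
      abs_of_pos hρ]
    field_simp

lemma exists_coding_step {s : ℝ} (hs0 : 0 < s) (hs1 : s < 1) {N : ℕ → ℕ} (hN : ∀ n, 1 ≤ N n) :
    ∃ M : ℕ, ∃ ρ : ℝ, 1 < ρ ∧ ∃ d : ℕ → ℝ → ℝ → ℕ, ∃ T : ℕ → ℝ → ℝ → ℝ,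
      ∀ n, ∀ r ∈ Icc (0 : ℝ) 1, ∀ y ∈ Ico (0 : ℝ) 1,
        (IsSquare n → d n r y = N n) ∧ (¬ IsSquare n → 1 ≤ d n r y ∧ d n r y ≤ M) ∧
        T n r y ∈ Ico (0 : ℝ) 1 ∧ ∀ y' ∈ Ico (0 : ℝ) 1, d n r y = d n r y' →
          |y - y'| ≤ (if IsSquare n then ((N n : ℝ) + 2) ^ 2 else ρ⁻¹) *
            lenRatio r (d n r y) ^ s * |T n r y - T n r y'| := by
  obtain ⟨M, ρ, hρ, hsum⟩ := exists_one_lt_sum_lenRatio_rpow hs1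
  refine ⟨M, ρ, hρ, ?_⟩
  have key : ∀ n : ℕ, ∀ r : ℝ, ∃ d : ℝ → ℕ, ∃ T : ℝ → ℝ, r ∈ Icc (0 : ℝ) 1 →
      ∀ y ∈ Ico (0 : ℝ) 1,
        (IsSquare n → d y = N n) ∧ (¬ IsSquare n → 1 ≤ d y ∧ d y ≤ M) ∧
        T y ∈ Ico (0 : ℝ) 1 ∧ ∀ y' ∈ Ico (0 : ℝ) 1, d y = d y' →
          |y - y'| ≤ (if IsSquare n then ((N n : ℝ) + 2) ^ 2 else ρ⁻¹) *
            lenRatio r (d y) ^ s * |T y - T y'| := by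
    intro n r
    by_cases hr : r ∈ Icc (0 : ℝ) 1
    swap
    · exact ⟨fun _ => 0, fun _ => 0, fun h => absurd h hr⟩
    by_cases hn : IsSquare n
    · refine ⟨fun _ => N n, id, fun _ y hy => ⟨fun _ => rfl, fun h => absurd hn h, hy, ?_⟩⟩
      intro y' _ _
      rw [if_pos hn]
      have h1 := inv_le_lenRatio hr (hN n)
      have hp := lenRatio_pos hr.1 (hN n)
      have h2 : lenRatio r (N n) ≤ lenRatio r (N n) ^ s := by
        have := Real.rpow_le_rpow_of_exponent_ge hp
          ((lenRatio_le_half hr.1 (hN n)).trans (by norm_num)) hs1.le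
        rwa [Real.rpow_one] at this
      have h3 : 1 ≤ ((N n : ℝ) + 2) ^ 2 * lenRatio r (N n) ^ s := by
        refine le_trans ?_ (mul_le_mul_of_nonneg_left (h1.trans h2) (by positivity))
        rw [mul_one_div, one_le_div (by positivity)]
        nlinarith [(Nat.cast_nonneg (N n) : (0 : ℝ) ≤ N n)]
      simpa using mul_le_mul_of_nonneg_right h3 (abs_nonneg (y - y'))
    · obtain ⟨d, T, h⟩ := exists_affine_partition (M := M)
        (w := fun i => if 1 ≤ i then lenRatio r i ^ s else 1) (ρ := ρ)
        (fun i => by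
          split_ifs with hi
          · exact Real.rpow_pos_of_pos (lenRatio_pos hr.1 hi) _
          · exact one_pos) (by linarith) (by simpa using hsum r hr)
      refine ⟨d, T, fun _ y hy => ⟨fun h => absurd h hn, fun _ => (h y hy).1, (h y hy).2.1, ?_⟩⟩
      intro y' hy' hd
      have := (h y hy).2.2 y' hy' hd
      rw [if_pos (h y hy).1.1] at this
      rw [if_neg hn, this]
  choose d T h using key
  exact ⟨d, T, h⟩

lemma exists_stretched_pow_le {ρ K : ℝ} (hρ : 1 < ρ) (hK : 1 ≤ K) :
    ∃ B : ℝ, 0 < B ∧ ∀ n : ℕ,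
      ((n : ℝ) + 2) * (ρ * (K * (n + 2)) ^ 2) ^ (Nat.sqrt n + 1) ≤ B * ρ ^ n := by
  have hL : 0 < Real.log ρ := Real.log_pos hρ
  have hLK : 0 ≤ Real.log K := Real.log_nonneg hK
  set L := Real.log ρ
  set c := L + 2 * Real.log K with hc
  have hc0 : 0 ≤ c := by positivity
  set A := 2 * c + 20 with hA
  refine ⟨Real.exp (A * (A / L) ^ 3 + 2 * L), Real.exp_pos _, fun n => ?_⟩
  rw [← Real.log_le_log_iff (by positivity) (by positivity), Real.log_mul (by positivity)
    (by positivity), Real.log_pow, Real.log_mul (by positivity) (by positivity), Real.log_pow,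
    Real.log_mul (by positivity) (by positivity), Real.log_mul (by positivity) (by positivity),
    Real.log_exp, Real.log_pow]
  set z := √√((n : ℝ) + 2) with hz
  have hz2 : z ^ 2 = √((n : ℝ) + 2) := Real.sq_sqrt (by positivity)
  have hz4 : z ^ 4 = (n : ℝ) + 2 := by
    rw [show z ^ 4 = (z ^ 2) ^ 2 by ring, hz2, Real.sq_sqrt (by positivity)]
  have hz1 : 1 ≤ z := by
    rw [hz, Real.one_le_sqrt, Real.one_le_sqrt]
    linarith [(Nat.cast_nonneg n : (0 : ℝ) ≤ n)]
  have hlog : Real.log ((n : ℝ) + 2) ≤ 4 * z := by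
    rw [← hz4, Real.log_pow]
    have := Real.log_le_self (by linarith : 0 ≤ z)
    push_cast
    linarith
  have hsqrt : ((Nat.sqrt n : ℕ) : ℝ) ≤ z ^ 2 := by
    rw [hz2]
    refine Real.le_sqrt_of_sq_le ?_
    have : ((Nat.sqrt n ^ 2 : ℕ) : ℝ) ≤ n := by exact_mod_cast Nat.sqrt_le' n
    push_cast at this
    linarith
  have hlog0 : 0 ≤ Real.log ((n : ℝ) + 2) :=
    Real.log_nonneg (by linarith [(Nat.cast_nonneg n : (0 : ℝ) ≤ n)])
  have hn : (n : ℝ) = z ^ 4 - 2 := by linarith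
  have h1 : Real.log ((n : ℝ) + 2) + (((Nat.sqrt n + 1 : ℕ) : ℝ)) *
      (L + (2 : ℕ) * (Real.log K + Real.log ((n : ℝ) + 2))) ≤ A * z ^ 3 := by
    push_cast
    calc Real.log ((n : ℝ) + 2) + ((Nat.sqrt n : ℝ) + 1) *
          (L + 2 * (Real.log K + Real.log ((n : ℝ) + 2)))
        ≤ 4 * z + (z ^ 2 + 1) * (c + 8 * z) := by
          apply add_le_add hlog
          apply mul_le_mul (by linarith) (by rw [hc]; linarith) (by positivity) (by positivity)
      _ ≤ 4 * z ^ 3 + (z ^ 2 + z ^ 2) * (c * z + 8 * z) := by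
          have e1 : z ≤ z ^ 3 := by nlinarith [mul_self_nonneg (z - 1)]
          have e2 : 1 ≤ z ^ 2 := by nlinarith
          have e3 : c ≤ c * z := by nlinarith
          gcongr
      _ = A * z ^ 3 := by rw [hA]; ring
  refine h1.trans ?_
  rw [hn]
  have hA0 : 0 ≤ A := by positivity
  rcases le_total z (A / L) with h | h
  · have : A * z ^ 3 ≤ A * (A / L) ^ 3 := by gcongr
    nlinarith [pow_nonneg (by linarith : 0 ≤ z) 4]
  · rw [div_le_iff₀ hL] at h
    have h3 : 0 ≤ A * (A / L) ^ 3 := by positivity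
    have h4 := mul_le_mul_of_nonneg_right h (pow_nonneg (by linarith : 0 ≤ z) 3)
    nlinarith

lemma card_filter_isSquare_le (n : ℕ) :
    ((Finset.range n).filter IsSquare).card ≤ Nat.sqrt n + 1 := by
  have : (Finset.range n).filter IsSquare ⊆
      (Finset.range (Nat.sqrt n + 1)).image fun m => m * m := by
    intro k hk
    simp only [Finset.mem_filter, Finset.mem_range, Finset.mem_image] at hk ⊢
    obtain ⟨hkn, m, rfl⟩ := hk
    exact ⟨m, Nat.lt_succ_of_le (Nat.le_sqrt.2 hkn.le), rfl⟩
  calc _ ≤ _ := Finset.card_le_card this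
    _ ≤ _ := Finset.card_image_le
    _ = _ := Finset.card_range _

lemma exists_prod_mul_le {ρ K : ℝ} (hρ : 1 < ρ) (hK : 1 ≤ K) {N : ℕ → ℕ}
    (hNK : ∀ n, (N n : ℝ) + 2 ≤ K * (n + 2)) :
    ∃ B : ℝ, 0 < B ∧ ∀ n : ℕ, (∏ k ∈ Finset.range n,
      if IsSquare k then ((N k : ℝ) + 2) ^ 2 else ρ⁻¹) * ((n : ℝ) + 2) ≤ B := by
  obtain ⟨B, hB, h⟩ := exists_stretched_pow_le hρ hK
  refine ⟨B, hB, fun n => ?_⟩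
  have hρ0 : 0 < ρ := by linarith
  have h1 : (∏ k ∈ Finset.range n, if IsSquare k then ((N k : ℝ) + 2) ^ 2 else ρ⁻¹) =
      (ρ ^ n)⁻¹ * ∏ k ∈ (Finset.range n).filter IsSquare, ρ * ((N k : ℝ) + 2) ^ 2 := by
    have hpow : (ρ ^ n)⁻¹ = ∏ _k ∈ Finset.range n, ρ⁻¹ := by simp
    rw [Finset.prod_filter, hpow, ← Finset.prod_mul_distrib]
    refine Finset.prod_congr rfl fun k _ => ?_
    split_ifs
    · field_simp
    · simp
  have h2 : ∏ k ∈ (Finset.range n).filter IsSquare, ρ * ((N k : ℝ) + 2) ^ 2 ≤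
      (ρ * (K * (n + 2)) ^ 2) ^ (Nat.sqrt n + 1) := by
    calc _ ≤ ∏ k ∈ (Finset.range n).filter IsSquare, ρ * (K * ((n : ℝ) + 2)) ^ 2 := by
          refine Finset.prod_le_prod (fun k _ => by positivity) fun k hk => ?_
          have hkn : (k : ℝ) ≤ n := by
            exact_mod_cast (Finset.mem_range.1 (Finset.mem_filter.1 hk).1).le
          have := hNK k
          have : (N k : ℝ) + 2 ≤ K * (n + 2) := this.trans (by gcongr)
          gcongr
      _ = (ρ * (K * (n + 2)) ^ 2) ^ ((Finset.range n).filter IsSquare).card :=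
          Finset.prod_const _
      _ ≤ _ := by
          refine pow_le_pow_right₀ ?_ (card_filter_isSquare_le n)
          have : 1 ≤ K * ((n : ℝ) + 2) := by
            nlinarith [(Nat.cast_nonneg n : (0 : ℝ) ≤ n)]
          nlinarith [one_le_pow₀ (n := 2) this]
  rw [h1, mul_assoc, inv_mul_le_iff₀ (by positivity)]
  calc _ ≤ (ρ * (K * (n + 2)) ^ 2) ^ (Nat.sqrt n + 1) * ((n : ℝ) + 2) := by gcongr
    _ ≤ _ := by linarith [h n]

/-- The orbit of `(0, y)` under the skew product with digit map `d` and fibre maps `T`. -/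
def codingOrbit (d : ℕ → ℝ → ℝ → ℕ) (T : ℕ → ℝ → ℝ → ℝ) (y : ℝ) : ℕ → ℝ × ℝ
  | 0 => (0, y)
  | n + 1 => (1 / (d n (codingOrbit d T y n).1 (codingOrbit d T y n).2 +
      (codingOrbit d T y n).1), T n (codingOrbit d T y n).1 (codingOrbit d T y n).2)

/-- The digits read off along the orbit of `(0, y)`. -/
def codingDigit (d : ℕ → ℝ → ℝ → ℕ) (T : ℕ → ℝ → ℝ → ℝ) (y : ℝ) (n : ℕ) : ℕ :=
  d n (codingOrbit d T y n).1 (codingOrbit d T y n).2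

lemma codingOrbit_fst (d : ℕ → ℝ → ℝ → ℕ) (T : ℕ → ℝ → ℝ → ℝ) (y : ℝ) (n : ℕ) :
    (codingOrbit d T y n).1 = contRatio (codingDigit d T y) n := by
  induction n with
  | zero => rfl
  | succ n ih =>
    rw [contRatio, ← ih]
    rfl

lemma contRatio_congr {a b : ℕ → ℕ} {n : ℕ} (h : ∀ k < n, a k = b k) :
    contRatio a n = contRatio b n := by
  induction n with
  | zero => rfl
  | succ n ih => simp only [contRatio, ih fun k hk => h k (by omega), h n (by omega)]

/-- For every `s < 1` there is a map from `[0, 1)` to continued fractions with prescribed digits at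
square positions and bounded digits elsewhere, whose inverse is `s`-Hölder. -/
lemma exists_holder_coding {s : ℝ} (hs0 : 0 < s) (hs1 : s < 1) {N : ℕ → ℕ} (hN : ∀ n, 1 ≤ N n)
    {K : ℝ} (hNK : ∀ n, (N n : ℝ) ≤ K * (n + 1)) :
    ∃ M : ℕ, ∃ A : ℝ → ℕ → ℕ, ∃ B : ℝ, 0 < B ∧ ∀ y ∈ Ico (0 : ℝ) 1,
      (∀ n, IsSquare n → A y n = N n) ∧ (∀ n, ¬ IsSquare n → 1 ≤ A y n ∧ A y n ≤ M) ∧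
      ∀ y' ∈ Ico (0 : ℝ) 1, |y - y'| ≤ B * |cfVal (A y) - cfVal (A y')| ^ s := by
  obtain ⟨M, ρ, hρ, d, T, hdT⟩ := exists_coding_step hs0 hs1 hN
  set C : ℕ → ℝ := fun n => if IsSquare n then ((N n : ℝ) + 2) ^ 2 else ρ⁻¹ with hC
  have hC0 : ∀ n, 0 < C n := fun n => by
    simp only [hC]
    split_ifs
    · positivity
    · exact inv_pos.2 (by linarith)
  set A := codingDigit d T with hA
  have hK : 0 ≤ K := by
    have := hNK 0
    have h1 : (1 : ℝ) ≤ N 0 := by exact_mod_cast hN 0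
    simp at this
    linarith
  set K' := K + M + 2 with hK'
  obtain ⟨B, hB, hprod⟩ := exists_prod_mul_le (K := K') hρ (by linarith [M.cast_nonneg (α := ℝ)])
    (N := N) fun n => by
      have := hNK n
      have h0 : (0 : ℝ) ≤ n := n.cast_nonneg
      have h1 : (0 : ℝ) ≤ M := M.cast_nonneg
      nlinarith [mul_nonneg h1 h0]
  have horb : ∀ y ∈ Ico (0 : ℝ) 1, ∀ n, (codingOrbit d T y n).1 ∈ Icc (0 : ℝ) 1 ∧
      (codingOrbit d T y n).2 ∈ Ico (0 : ℝ) 1 := by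
    intro y hy n
    induction n with
    | zero => exact ⟨⟨le_rfl, zero_le_one⟩, hy⟩
    | succ n ih =>
      obtain ⟨h1, h2, h3, -⟩ := hdT n _ ih.1 _ ih.2
      refine ⟨inv_add_mem_Icc ih.1.1 ?_, h3⟩
      by_cases hn : IsSquare n
      · rw [h1 hn]; exact hN n
      · exact (h2 hn).1
  have hsq : ∀ y ∈ Ico (0 : ℝ) 1, ∀ n, IsSquare n → A y n = N n := fun y hy n =>
    (hdT n _ (horb y hy n).1 _ (horb y hy n).2).1
  have hnsq : ∀ y ∈ Ico (0 : ℝ) 1, ∀ n, ¬ IsSquare n → 1 ≤ A y n ∧ A y n ≤ M := fun y hy n =>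
    (hdT n _ (horb y hy n).1 _ (horb y hy n).2).2.1
  have hA1 : ∀ y ∈ Ico (0 : ℝ) 1, ∀ n, 1 ≤ A y n := fun y hy n => by
    by_cases hn : IsSquare n
    · rw [hsq y hy n hn]; exact hN n
    · exact (hnsq y hy n hn).1
  have hAD : ∀ y ∈ Ico (0 : ℝ) 1, ∀ n, (A y n : ℝ) ≤ K' * (n + 1) := fun y hy n => by
    have h0 : (0 : ℝ) ≤ n := n.cast_nonneg
    have h1 : (0 : ℝ) ≤ M := M.cast_nonneg
    by_cases hn : IsSquare n
    · rw [hsq y hy n hn]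
      refine (hNK n).trans ?_
      gcongr
      linarith
    · have : (A y n : ℝ) ≤ M := by exact_mod_cast (hnsq y hy n hn).2
      nlinarith [mul_nonneg h1 h0, mul_nonneg hK h0]
  have hcommon : ∀ y ∈ Ico (0 : ℝ) 1, ∀ y' ∈ Ico (0 : ℝ) 1, ∀ n, (∀ k < n, A y k = A y' k) →
      |y - y'| ≤ (∏ k ∈ Finset.range n, C k) * cylLen (A y) n ^ s *
        |(codingOrbit d T y n).2 - (codingOrbit d T y' n).2| := by
    intro y hy y' hy' n
    induction n with
    | zero => intro _; simp [cylLen, codingOrbit]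
    | succ n ih =>
      intro h
      have h' : ∀ k < n, A y k = A y' k := fun k hk => h k (by omega)
      refine (ih h').trans ?_
      have hr : (codingOrbit d T y' n).1 = (codingOrbit d T y n).1 := by
        rw [codingOrbit_fst, codingOrbit_fst, contRatio_congr h']
      have hstep := (hdT n _ (horb y hy n).1 _ (horb y hy n).2).2.2.2 _ (horb y' hy' n).2 (by
        have := h n (by omega)
        rw [hA, codingDigit, codingDigit, hr] at this
        exact this)
      have hl := cylLen_pos (hA1 y hy) n
      have hP : 0 < ∏ k ∈ Finset.range n, C k := Finset.prod_pos fun k _ => hC0 k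
      rw [Finset.prod_range_succ, cylLen_succ, Real.mul_rpow hl.le
        (lenRatio_pos (contRatio_mem (hA1 y hy) n).1 (hA1 y hy n)).le, ← codingOrbit_fst]
      simp only [codingOrbit, hr]
      refine (mul_le_mul_of_nonneg_left hstep (by positivity)).trans (le_of_eq ?_)
      simp only [hA, codingDigit, hC]
      ring
  have hcommon' : ∀ y ∈ Ico (0 : ℝ) 1, ∀ y' ∈ Ico (0 : ℝ) 1, ∀ n, (∀ k < n, A y k = A y' k) →
      |y - y'| * (n + 2) ≤ B * cylLen (A y) n ^ s := by
    intro y hy y' hy' n h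
    have h1 := hcommon y hy y' hy' n h
    have hl := cylLen_pos (hA1 y hy) n
    have hP : 0 < ∏ k ∈ Finset.range n, C k := Finset.prod_pos fun k _ => hC0 k
    have h2 : |(codingOrbit d T y n).2 - (codingOrbit d T y' n).2| ≤ 1 := by
      have e1 := (horb y hy n).2
      have e2 := (horb y' hy' n).2
      rw [abs_le]
      constructor <;> linarith [e1.1, e1.2, e2.1, e2.2]
    have h3 : |y - y'| ≤ (∏ k ∈ Finset.range n, C k) * cylLen (A y) n ^ s :=
      h1.trans (mul_le_of_le_one_right (by positivity) h2)
    calc |y - y'| * (n + 2)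
        ≤ (∏ k ∈ Finset.range n, C k) * cylLen (A y) n ^ s * (n + 2) := by gcongr
      _ = ((∏ k ∈ Finset.range n, C k) * (n + 2)) * cylLen (A y) n ^ s := by ring
      _ ≤ _ := by
        have := hprod n
        gcongr
  set G := 2 * ((M : ℝ) + 1) ^ 2 * (K' + 1) with hG
  have hG0 : 1 ≤ G := by
    have h1 : (0 : ℝ) ≤ M := M.cast_nonneg
    rw [hG]
    nlinarith [sq_nonneg (M : ℝ)]
  refine ⟨M, A, B * G, by positivity, fun y hy => ⟨hsq y hy, hnsq y hy, fun y' hy' => ?_⟩⟩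
  by_cases hne : ∃ n, A y n ≠ A y' n
  · set n := Nat.find hne with hn
    have hlt : ∀ k < n, A y k = A y' k := fun k hk => not_not.1 (Nat.find_min hne hk)
    have hdiff : A y n ≠ A y' n := Nat.find_spec hne
    have hns : ¬ IsSquare n := fun h => hdiff (by rw [hsq y hy n h, hsq y' hy' n h])
    have hD : ∀ z ∈ Ico (0 : ℝ) 1, (A z (n + 1) : ℝ) ≤ K' * (n + 2) := fun z hz => by
      have := hAD z hz (n + 1)
      push_cast at this
      linarith
    have h1 := cylLen_le_abs_cfVal_sub (hA1 y hy) (hA1 y' hy') hlt hdiff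
      (M := M) (by exact_mod_cast (hnsq y hy n hns).2) (by exact_mod_cast (hnsq y' hy' n hns).2)
      (hD y hy) (hD y' hy')
    set X := |cfVal (A y) - cfVal (A y')|
    have hl := cylLen_pos (hA1 y hy) n
    have hX : 0 ≤ X := abs_nonneg _
    have hn0 : (0 : ℝ) ≤ n := n.cast_nonneg
    have hn2 : (0 : ℝ) < (n : ℝ) + 2 := by positivity
    have h2 : cylLen (A y) n ≤ G * (n + 2) * X := by
      refine h1.trans ?_
      apply mul_le_mul_of_nonneg_right _ hX
      rw [hG, mul_assoc _ (K' + 1)]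
      apply mul_le_mul_of_nonneg_left _ (by positivity)
      linarith
    have h3 : cylLen (A y) n ^ s ≤ G * (n + 2) * X ^ s := by
      refine (Real.rpow_le_rpow hl.le h2 hs0.le).trans ?_
      rw [Real.mul_rpow (by positivity) hX]
      apply mul_le_mul_of_nonneg_right _ (by positivity)
      have : 1 ≤ G * ((n : ℝ) + 2) := by nlinarith
      have := Real.rpow_le_rpow_of_exponent_le this hs1.le
      rwa [Real.rpow_one] at this
    have h4 := (hcommon' y hy y' hy' n hlt).trans (mul_le_mul_of_nonneg_left h3 hB.le)
    refine le_of_mul_le_mul_right (h4.trans (le_of_eq ?_)) hn2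
    ring
  · push Not at hne
    have h0 : |y - y'| ≤ 0 := by
      refine ge_of_tendsto' (tendsto_one_div_add_atTop_nhds_zero_nat.const_mul B |>.trans
        (by rw [mul_zero])) fun n => ?_
      have h1 := hcommon' y hy y' hy' n fun k _ => hne k
      have h2 : cylLen (A y) n ^ s ≤ 1 := Real.rpow_le_one (cylLen_pos (hA1 y hy) n).le
        ((cylLen_le (hA1 y hy) n).trans (pow_le_one₀ (by norm_num) (by norm_num))) hs0.le
      have hn0 : (0 : ℝ) ≤ n := n.cast_nonneg
      rw [mul_one_div, le_div_iff₀ (by positivity)]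
      nlinarith [abs_nonneg (y - y')]
    exact h0.trans (by positivity)

lemma le_dimH_of_holder_coding {S : Set ℝ} {s B : ℝ} (hs0 : 0 < s) (hB : 0 < B) {g : ℝ → ℝ}
    (hg : MapsTo g (Ico 0 1) S)
    (h : ∀ y ∈ Ico (0 : ℝ) 1, ∀ y' ∈ Ico (0 : ℝ) 1, |y - y'| ≤ B * |g y - g y'| ^ s) :
    ENNReal.ofReal s ≤ dimH S := by
  have hinj : InjOn g (Ico 0 1) := fun y hy y' hy' he => by
    have := h y hy y' hy'
    rw [he, sub_self, abs_zero, Real.zero_rpow hs0.ne', mul_zero] at this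
    exact sub_eq_zero.1 (abs_nonpos_iff.1 this)
  have hinv : ∀ y ∈ Ico (0 : ℝ) 1, Function.invFunOn g (Ico 0 1) (g y) = y := fun y hy =>
    hinj.leftInvOn_invFunOn hy
  lift B to ℝ≥0 using hB.le
  lift s to ℝ≥0 using hs0.le
  have hH : HolderOnWith B s (Function.invFunOn g (Ico 0 1)) (g '' Ico 0 1) := by
    rintro _ ⟨y, hy, rfl⟩ _ ⟨y', hy', rfl⟩
    rw [hinv y hy, hinv y' hy', edist_dist, edist_dist, Real.dist_eq, Real.dist_eq,
      ENNReal.ofReal_rpow_of_nonneg (abs_nonneg _) s.coe_nonneg]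
    refine (ENNReal.ofReal_le_ofReal (h y hy y' hy')).trans (le_of_eq ?_)
    rw [ENNReal.ofReal_mul hB.le, ENNReal.ofReal_coe_nnreal]
  have himg : Function.invFunOn g (Ico 0 1) '' (g '' Ico 0 1) = Ico (0 : ℝ) 1 := by
    rw [image_image]
    exact (image_congr hinv).trans (image_id' _)
  have hs : 0 < s := by exact_mod_cast hs0
  have hd := hH.dimH_image_le hs
  rw [himg, Real.dimH_of_nonempty_interior (by rw [interior_Ico]; exact ⟨1 / 2, by norm_num⟩),
    ENNReal.le_div_iff_mul_le (Or.inl (by simpa using hs.ne')) (Or.inl ENNReal.coe_ne_top),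
    Module.finrank_self, Nat.cast_one, one_mul] at hd
  rw [ENNReal.ofReal_coe_nnreal]
  exact hd.trans (dimH_mono hg.image_subset)

lemma one_lt_log_sixteen : 1 < Real.log 16 ∧ 1 < Real.log (Real.log 16) := by
  have h2 := Real.log_two_gt_d9
  have h16 : Real.log 16 = 4 * Real.log 2 := by
    rw [show (16 : ℝ) = 2 ^ 4 by norm_num, Real.log_pow]
    norm_num
  have h := Real.exp_one_lt_d9
  have h3 : Real.exp 1 < Real.log 16 := by rw [h16]; linarith
  refine ⟨by linarith, ?_⟩
  rw [Real.lt_log_iff_exp_lt (by linarith)]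
  exact h3

lemma one_lt_log_log {x : ℝ} (hx : 16 ≤ x) : 1 < Real.log x ∧ 1 < Real.log (Real.log x) := by
  obtain ⟨h1, h2⟩ := one_lt_log_sixteen
  have h3 : Real.log 16 ≤ Real.log x := Real.log_le_log (by norm_num) hx
  exact ⟨by linarith, h2.trans_le (Real.log_le_log (by linarith) h3)⟩

lemma log_log_mono {x y : ℝ} (hx : 16 ≤ x) (hxy : x ≤ y) :
    Real.log (Real.log x) ≤ Real.log (Real.log y) :=
  Real.log_le_log (by linarith [(one_lt_log_log hx).1]) (Real.log_le_log (by linarith) hxy)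

lemma tau_mono {x y : ℝ} (hx : 16 ≤ x) (hxy : x ≤ y) : tau x ≤ tau y := by
  obtain ⟨h1, h2⟩ := one_lt_log_log hx
  obtain ⟨h3, h4⟩ := one_lt_log_log (hx.trans hxy)
  unfold tau
  rw [div_le_div_iff₀ (by linarith) (by linarith)]
  have e1 : Real.log (Real.log y) - Real.log (Real.log x) ≤ Real.log y / Real.log x - 1 := by
    rw [← Real.log_div (by linarith) (by linarith)]
    exact Real.log_le_sub_one_of_pos (by positivity)
  have e2 : Real.log y - Real.log x ≤ y / x - 1 := by
    rw [← Real.log_div (by linarith) (by linarith)]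
    exact Real.log_le_sub_one_of_pos (by apply div_pos <;> linarith)
  have e3 : Real.log y / Real.log x - 1 ≤ y / x - 1 := by
    rw [div_sub_one (by linarith)]
    refine (div_le_self ?_ h1.le).trans e2
    exact sub_nonneg.2 (Real.log_le_log (by linarith) hxy)
  have e4 : x * (Real.log (Real.log y) - Real.log (Real.log x)) ≤ y - x := by
    calc _ ≤ x * (y / x - 1) := by
          apply mul_le_mul_of_nonneg_left (e1.trans e3) (by linarith)
      _ = y - x := by
          have : x ≠ 0 := by linarith
          field_simp
  nlinarith

lemma tendsto_log_log_div : Tendsto (fun n : ℕ => Real.log (Real.log n) / n) atTop (𝓝 0) := by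
  have h1 : Tendsto (fun n : ℕ => Real.log n / n) atTop (𝓝 0) := by
    have := (Real.isLittleO_log_id_atTop.tendsto_div_nhds_zero).comp
      (tendsto_natCast_atTop_atTop (R := ℝ))
    exact this
  refine squeeze_zero' ?_ ?_ h1
  · filter_upwards [eventually_ge_atTop 16] with n hn
    have := (one_lt_log_log (x := n) (by exact_mod_cast hn)).2
    positivity
  · filter_upwards [eventually_ge_atTop 16] with n hn
    have := (one_lt_log_log (x := n) (by exact_mod_cast hn)).1
    gcongr
    exact Real.log_le_self (by linarith)

lemma tendsto_log_log : Tendsto (fun n : ℕ => Real.log (Real.log n)) atTop atTop :=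
  Real.tendsto_log_atTop.comp (Real.tendsto_log_atTop.comp tendsto_natCast_atTop_atTop)

/-- The largest perfect square below `n ≥ 1` is asymptotic to `n`. -/
lemma tendsto_sqrt_pred_sq_div :
    Tendsto (fun n : ℕ => ((Nat.sqrt (n - 1) * Nat.sqrt (n - 1) : ℕ) : ℝ) / n) atTop (𝓝 1) := by
  have h1 : Tendsto (fun n : ℕ => 1 - 3 * (√(n : ℝ))⁻¹) atTop (𝓝 (1 - 3 * 0)) :=
    ((tendsto_inv_atTop_zero.comp (Real.tendsto_sqrt_atTop.comp
      tendsto_natCast_atTop_atTop)).const_mul 3).const_sub 1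
  rw [mul_zero, sub_zero] at h1
  refine tendsto_of_tendsto_of_tendsto_of_le_of_le' h1 tendsto_const_nhds ?_ ?_
  · filter_upwards [eventually_ge_atTop 1] with n hn
    have hn0 : (1 : ℝ) ≤ n := by exact_mod_cast hn
    set m := Nat.sqrt (n - 1)
    have h2 : n ≤ (m + 1) * (m + 1) := by
      have : n - 1 < (m + 1) * (m + 1) := Nat.lt_succ_sqrt (n - 1)
      omega
    have h3 : m * m ≤ n := (Nat.sqrt_le _).trans (by omega)
    have h2' : (n : ℝ) ≤ (m + 1) * (m + 1) := by exact_mod_cast h2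
    have h3' : (m : ℝ) * m ≤ n := by exact_mod_cast h3
    have h4 : (m : ℝ) ≤ √n := Real.le_sqrt_of_sq_le (by nlinarith)
    have h5 : √(n : ℝ) * √n = n := Real.mul_self_sqrt (by linarith)
    have h6 : 1 ≤ √(n : ℝ) := Real.one_le_sqrt.2 hn0
    rw [le_div_iff₀ (by linarith)]
    push_cast
    have h7 : (1 - 3 * (√(n : ℝ))⁻¹) * n = n - 3 * √n := by
      nth_rewrite 2 [← h5]
      have : √(n : ℝ) ≠ 0 := by linarith
      field_simp
      linarith
    rw [h7]
    nlinarith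
  · filter_upwards [eventually_ge_atTop 1] with n hn
    have hn0 : (1 : ℝ) ≤ n := by exact_mod_cast hn
    rw [div_le_one (by linarith)]
    exact_mod_cast (Nat.sqrt_le _).trans (by omega : n - 1 ≤ n)

lemma le_sup_range_of_isSquare {a N : ℕ → ℕ} (ha : ∀ n, IsSquare n → a n = N n) {n : ℕ}
    (hn : 1 ≤ n) : N (Nat.sqrt (n - 1) * Nat.sqrt (n - 1)) ≤ (Finset.range n).sup a := by
  rw [← ha _ ⟨_, rfl⟩]
  have : Nat.sqrt (n - 1) * Nat.sqrt (n - 1) ≤ n - 1 := Nat.sqrt_le _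
  exact Finset.le_sup (f := a) (Finset.mem_range.2 (by omega))

lemma tendsto_ratio_top {a : ℕ → ℕ} (ha : ∀ n, IsSquare n → a n = n + 1) :
    Tendsto (ratio a) atTop atTop := by
  have h := tendsto_sqrt_pred_sq_div.pos_mul_atTop one_pos tendsto_log_log
  refine tendsto_atTop_mono' _ ?_ h
  filter_upwards [eventually_ge_atTop 16] with n hn
  have h1 := (one_lt_log_log (x := n) (by exact_mod_cast hn)).2
  have h2 := le_sup_range_of_isSquare ha (n := n) (by omega)
  have h3 : ((Nat.sqrt (n - 1) * Nat.sqrt (n - 1) : ℕ) : ℝ) ≤ ((Finset.range n).sup a : ℕ) := by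
    exact_mod_cast (Nat.le_succ _).trans h2
  rw [ratio, div_mul_eq_mul_div]
  gcongr

/-- The digit `⌊α τ(n)⌋ + 1`, set to `1` for small `n`. -/
def insDigit (α : ℝ) (n : ℕ) : ℕ := if 16 ≤ n then ⌊α * tau n⌋₊ + 1 else 1

lemma one_le_insDigit (α : ℝ) (n : ℕ) : 1 ≤ insDigit α n := by
  unfold insDigit; split_ifs <;> omega

lemma insDigit_le_tau {α : ℝ} (hα : 0 ≤ α) {k n : ℕ} (hn : 16 ≤ n) (hk : k ≤ n) :
    (insDigit α k : ℝ) ≤ α * tau n + 1 := by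
  have hn' : (16 : ℝ) ≤ n := by exact_mod_cast hn
  have hpos : ∀ {x : ℝ}, 16 ≤ x → 0 ≤ tau x := fun {x} hx =>
    div_nonneg (by linarith) (by linarith [(one_lt_log_log hx).2])
  unfold insDigit
  split_ifs with h
  · have hk' : (16 : ℝ) ≤ k := by exact_mod_cast h
    push_cast
    have h1 := Nat.floor_le (mul_nonneg hα (hpos hk'))
    have h2 := mul_le_mul_of_nonneg_left (tau_mono hk' (by exact_mod_cast hk : (k : ℝ) ≤ n)) hα
    linarith
  · have := mul_nonneg hα (hpos hn')
    push_cast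
    linarith

lemma insDigit_le {α : ℝ} (hα : 0 ≤ α) (n : ℕ) : (insDigit α n : ℝ) ≤ (α + 1) * (n + 1) := by
  have hn0 : (0 : ℝ) ≤ n := n.cast_nonneg
  by_cases h : 16 ≤ n
  · have h1 := insDigit_le_tau hα h le_rfl
    have h2 : tau n ≤ n := div_le_self hn0 (one_lt_log_log (by exact_mod_cast h)).2.le
    nlinarith [mul_le_mul_of_nonneg_left h2 hα]
  · rw [insDigit, if_neg h]
    push_cast
    nlinarith [mul_nonneg hα hn0]

lemma tendsto_ratio_insDigit {α : ℝ} (hα : 0 ≤ α) {a : ℕ → ℕ} {M : ℕ}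
    (ha : ∀ n, IsSquare n → a n = insDigit α n) (haM : ∀ n, ¬ IsSquare n → a n ≤ M) :
    Tendsto (ratio a) atTop (𝓝 α) := by
  have hup : Tendsto (fun n : ℕ => α + (1 + M) * (Real.log (Real.log n) / n)) atTop (𝓝 α) := by
    simpa using (tendsto_log_log_div.const_mul (1 + (M : ℝ))).const_add α
  have hlow : Tendsto (fun n : ℕ =>
      α * (((Nat.sqrt (n - 1) * Nat.sqrt (n - 1) : ℕ) : ℝ) / n)) atTop (𝓝 α) := by
    simpa using tendsto_sqrt_pred_sq_div.const_mul α
  refine tendsto_of_tendsto_of_tendsto_of_le_of_le' hlow hup ?_ ?_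
  · filter_upwards [eventually_ge_atTop 26] with n hn
    have hn' : (26 : ℝ) ≤ n := by exact_mod_cast hn
    have h1 := (one_lt_log_log (x := n) (by linarith)).2
    have h2 := le_sup_range_of_isSquare ha (n := n) (by omega)
    set q := Nat.sqrt (n - 1) * Nat.sqrt (n - 1) with hq
    have hq16 : 16 ≤ q := by
      have : 4 ≤ Nat.sqrt (n - 1) := Nat.le_sqrt.2 (by omega)
      nlinarith
    have hqn : q ≤ n := (Nat.sqrt_le _).trans (by omega : n - 1 ≤ n)
    have hq16' : (16 : ℝ) ≤ q := by exact_mod_cast hq16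
    have hqn' : (q : ℝ) ≤ n := by exact_mod_cast hqn
    have h3 : α * tau q ≤ ((Finset.range n).sup a : ℕ) := by
      have e1 : α * tau q ≤ insDigit α q := by
        rw [insDigit, if_pos hq16]
        push_cast
        exact (Nat.lt_floor_add_one _).le
      exact e1.trans (by exact_mod_cast h2)
    have h4 := (one_lt_log_log hq16').2
    have h5 := log_log_mono hq16' hqn'
    rw [ratio, ← mul_div_assoc]
    apply div_le_div_of_nonneg_right _ (by linarith)
    calc α * q = α * tau q * Real.log (Real.log q) := by
          rw [tau]
          have : Real.log (Real.log q) ≠ 0 := by linarith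
          field_simp
      _ ≤ α * tau q * Real.log (Real.log n) := by
          apply mul_le_mul_of_nonneg_left h5
          exact mul_nonneg hα (div_nonneg (by linarith) (by linarith))
      _ ≤ _ := by gcongr
  · filter_upwards [eventually_ge_atTop 16] with n hn
    have hn' : (16 : ℝ) ≤ n := by exact_mod_cast hn
    have h1 := (one_lt_log_log hn').2
    have htau : 0 ≤ tau n := div_nonneg (by linarith) (by linarith)
    have h2 : (((Finset.range n).sup a : ℕ) : ℝ) ≤ α * tau n + 1 + M := by
      obtain ⟨k, hk, hka⟩ := Finset.exists_mem_eq_sup (Finset.range n)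
        (Finset.nonempty_range_iff.2 (by omega)) a
      rw [hka]
      have hkn := (Finset.mem_range.1 hk).le
      by_cases hks : IsSquare k
      · rw [ha k hks]
        linarith [insDigit_le_tau hα hn hkn, M.cast_nonneg (α := ℝ)]
      · have : (a k : ℝ) ≤ M := by exact_mod_cast haM k hks
        linarith [mul_nonneg hα htau]
    have h3 : α + (1 + M) * (Real.log (Real.log n) / n) =
        (α * tau n + 1 + M) * Real.log (Real.log n) / n := by
      rw [tau]
      have : Real.log (Real.log n) ≠ 0 := by linarith
      have : (n : ℝ) ≠ 0 := by linarith
      field_simp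
      ring
    rw [h3, ratio]
    gcongr

/-- Lower bound for the dimension of any set of continued fractions containing all those with
prescribed digits of at most linear growth at square positions and bounded digits elsewhere. -/
lemma one_le_dimH_of_prescribed_digits {S : Set ℝ} {N : ℕ → ℕ} (hN : ∀ n, 1 ≤ N n) {K : ℝ}
    (hNK : ∀ n, (N n : ℝ) ≤ K * (n + 1))
    (hS : ∀ a : ℕ → ℕ, (∀ k, 1 ≤ a k) → (∀ n, IsSquare n → a n = N n) →
      (∃ M, ∀ n, ¬ IsSquare n → a n ≤ M) → cfVal a ∈ S) :
    1 ≤ dimH S := by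
  refine le_of_forall_lt fun c hc => ?_
  obtain ⟨s, hcs, hs1⟩ := exists_between hc
  have hst : s ≠ ⊤ := (hs1.trans ENNReal.one_lt_top).ne
  have hs0 : 0 < s.toReal := ENNReal.toReal_pos (pos_of_gt hcs).ne' hst
  have hs1' : s.toReal < 1 := by
    simpa using (ENNReal.toReal_lt_toReal hst ENNReal.one_ne_top).2 hs1
  obtain ⟨M, A, B, hB, h⟩ := exists_holder_coding hs0 hs1' hN hNK
  have := le_dimH_of_holder_coding (S := S) (g := fun y => cfVal (A y)) hs0 hB
    (fun y hy => by
      obtain ⟨h1, h2, -⟩ := h y hy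
      refine hS _ (fun n => ?_) h1 ⟨M, fun n hn => (h2 n hn).2⟩
      by_cases hn : IsSquare n
      · rw [h1 n hn]; exact hN n
      · exact (h2 n hn).1)
    fun y hy => (h y hy).2.2
  rw [ENNReal.ofReal_toReal hst] at this
  exact hcs.trans_le this

/-- **Theorem (Wu–Xu).** For the regular continued fraction, for every `α ∈ [0,∞]` the set
of irrationals `x ∈ (0,1)` with `L_n(x) (log log n)/n → α` has Hausdorff dimension `1`. -/
theorem wu_xu (α : EReal) (hα : 0 ≤ α) :
    dimH {x : ℝ | x ∈ Ioo (0:ℝ) 1 ∧ Irrational x ∧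
      ∃ a : ℕ → ℕ, (∀ k, 1 ≤ a k) ∧
        Tendsto (fun n => comp rcf a n 0) atTop (𝓝 x) ∧
        Tendsto (fun n => (ratio a n : EReal)) atTop (𝓝 α)} = 1 := by
  refine le_antisymm ((dimH_mono (subset_univ _)).trans Real.dimH_univ.le) ?_
  have mem : ∀ a : ℕ → ℕ, (∀ k, 1 ≤ a k) →
      Tendsto (fun n => (ratio a n : EReal)) atTop (𝓝 α) → cfVal a ∈ {x : ℝ |
        x ∈ Ioo (0:ℝ) 1 ∧ Irrational x ∧ ∃ a : ℕ → ℕ, (∀ k, 1 ≤ a k) ∧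
          Tendsto (fun n => comp rcf a n 0) atTop (𝓝 x) ∧
          Tendsto (fun n => (ratio a n : EReal)) atTop (𝓝 α)} := fun a ha h =>
    ⟨cfVal_mem_Ioo ha, irrational_cfVal ha, a, ha, tendsto_cfVal ha, h⟩
  induction α with
  | bot => simp at hα
  | top =>
    refine one_le_dimH_of_prescribed_digits (N := fun n => n + 1) (K := 1)
      (fun n => Nat.le_add_left 1 n) (fun n => by push_cast; linarith) fun a ha hN _ => mem a ha ?_
    exact EReal.tendsto_coe_nhds_top_iff.2 (tendsto_ratio_top hN)
  | coe α =>
    have hα' : 0 ≤ α := by exact_mod_cast hα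
    refine one_le_dimH_of_prescribed_digits (one_le_insDigit α) (insDigit_le hα')
      fun a ha hN ⟨M, hM⟩ => mem a ha ?_
    exact EReal.tendsto_coe.2 (tendsto_ratio_insDigit hα' hN hM)

end

end ParabolicIFSPaper
end
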